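/- Suppose ℋ is a hereditary 3-graph property with finite VC₂-dimension such that B_ℋ contains bigraphs with arbitrarily large first vertex set. Then there are constants K,K'>0 such that for all sufficiently small ε₁>0 and all ε₂:ℕ→(0,1] tending to 0 sufficiently fast, ε₁^{-K} ≤ L_ℋ(ε₁,ε₂) ≤ ε₁^{-K'}. -/

import Mathlib

open scoped Classical
open Finset

set_option maxHeartbeats 1000000

/-- A 3-uniform hypergraph on a finite vertex set of naturals. -/
structure ThreeGraph where
  verts : Finset ℕ
  edges : Finset (Finset ℕ)
  edges_sub : ∀ e ∈ edges, e ⊆ verts ∧ e.card = 3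

/-- The set `Ē` of ordered triples corresponding to edges. -/
def ThreeGraph.obar (H : ThreeGraph) : Finset (ℕ × ℕ × ℕ) :=
  (H.verts ×ˢ H.verts ×ˢ H.verts).filter fun p => ({p.1, p.2.1, p.2.2} : Finset ℕ) ∈ H.edges

/-- A bigraph `(U,V;E)`. -/
structure Bigraph where
  left : Finset ℕ
  right : Finset ℕ
  edges : Finset (ℕ × ℕ)
  edges_sub : edges ⊆ left ×ˢ right

noncomputable def Bigraph.density (B : Bigraph) : ℝ :=
  (B.edges.card : ℝ) / ((B.left.card : ℝ) * (B.right.card : ℝ))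

noncomputable def Bigraph.gfun (B : Bigraph) (u w : ℕ) : ℝ :=
  if (u, w) ∈ B.edges then 1 - B.density else -B.density

noncomputable def Bigraph.devSum (B : Bigraph) : ℝ :=
  ∑ u₀ ∈ B.left, ∑ u₁ ∈ B.left, ∑ w₀ ∈ B.right, ∑ w₁ ∈ B.right,
    B.gfun u₀ w₀ * B.gfun u₀ w₁ * B.gfun u₁ w₀ * B.gfun u₁ w₁

/-- `B` has `dev₂(ε,d)`. -/
def Bigraph.dev2 (B : Bigraph) (ε d : ℝ) : Prop :=
  |B.density - d| ≤ ε ∧ B.devSum ≤ ε * (B.left.card : ℝ) ^ 2 * (B.right.card : ℝ) ^ 2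

/-- `B` has `dev₂(ε)`, i.e. `dev₂(ε, d_B)`. -/
def Bigraph.dev2self (B : Bigraph) (ε : ℝ) : Prop := B.dev2 ε B.density

noncomputable def Bigraph.dBetween (B : Bigraph) (X Y : Finset ℕ) : ℝ :=
  ((B.edges ∩ X ×ˢ Y).card : ℝ) / ((X.card : ℝ) * (Y.card : ℝ))

/-- `ε`-regularity for a bigraph. -/
def Bigraph.EpsRegular (B : Bigraph) (ε : ℝ) : Prop :=
  ∀ X ⊆ B.left, ∀ Y ⊆ B.right,
    ε * (B.left.card : ℝ) ≤ (X.card : ℝ) → ε * (B.right.card : ℝ) ≤ (Y.card : ℝ) →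
      |B.density - B.dBetween X Y| ≤ ε

/-- Irreducibility: distinct vertices have distinct neighborhoods, on both sides. -/
def Bigraph.Irreducible (B : Bigraph) : Prop :=
  (∀ u ∈ B.left, ∀ u' ∈ B.left, (∀ v : ℕ, (u, v) ∈ B.edges ↔ (u', v) ∈ B.edges) → u = u') ∧
  (∀ v ∈ B.right, ∀ v' ∈ B.right, (∀ u : ℕ, (u, v) ∈ B.edges ↔ (u, v') ∈ B.edges) → v = v')

def Bigraph.leftNbhd (B : Bigraph) (v : ℕ) : Finset ℕ :=
  B.left.filter fun u => (u, v) ∈ B.edges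

/-- `B` contains an induced copy of the abstract bigraph on `Fin k × Fin k` given by `F`. -/
def Bigraph.HasInducedPattern (B : Bigraph) (k : ℕ) (F : Fin k → Fin k → Prop) : Prop :=
  ∃ u v : Fin k → ℕ, (∀ a, u a ∈ B.left) ∧ (∀ b, v b ∈ B.right) ∧
    ∀ a b, ((u a, v b) ∈ B.edges ↔ F a b)

/-- A triad `(X,Y,Z; E_XY, E_YZ, E_XZ)`. -/
structure Triad where
  X : Finset ℕ
  Y : Finset ℕ
  Z : Finset ℕ
  EXY : Finset (ℕ × ℕ)
  EYZ : Finset (ℕ × ℕ)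
  EXZ : Finset (ℕ × ℕ)
  hXY : EXY ⊆ X ×ˢ Y
  hYZ : EYZ ⊆ Y ×ˢ Z
  hXZ : EXZ ⊆ X ×ˢ Z

def Triad.K3 (G : Triad) : Finset (ℕ × ℕ × ℕ) :=
  (G.X ×ˢ G.Y ×ˢ G.Z).filter fun p =>
    (p.1, p.2.1) ∈ G.EXY ∧ (p.2.1, p.2.2) ∈ G.EYZ ∧ (p.1, p.2.2) ∈ G.EXZ

def Triad.bXY (G : Triad) : Bigraph := ⟨G.X, G.Y, G.EXY, G.hXY⟩
def Triad.bYZ (G : Triad) : Bigraph := ⟨G.Y, G.Z, G.EYZ, G.hYZ⟩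
def Triad.bXZ (G : Triad) : Bigraph := ⟨G.X, G.Z, G.EXZ, G.hXZ⟩

/-- `d_H(G)` where the (tri)graph is given by its set `R` of ordered triples. -/
noncomputable def relDensity (R : Finset (ℕ × ℕ × ℕ)) (G : Triad) : ℝ :=
  ((R ∩ G.K3).card : ℝ) / (G.K3.card : ℝ)

noncomputable def hFun (R : Finset (ℕ × ℕ × ℕ)) (G : Triad) (x y z : ℕ) : ℝ :=
  if (x, y, z) ∈ G.K3 then
    (if (x, y, z) ∈ R then 1 - relDensity R G else -(relDensity R G))
  else 0

noncomputable def devSum3 (R : Finset (ℕ × ℕ × ℕ)) (G : Triad) : ℝ :=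
  ∑ u₀ ∈ G.X, ∑ u₁ ∈ G.X, ∑ w₀ ∈ G.Y, ∑ w₁ ∈ G.Y, ∑ z₀ ∈ G.Z, ∑ z₁ ∈ G.Z,
    hFun R G u₀ w₀ z₀ * hFun R G u₀ w₀ z₁ * hFun R G u₀ w₁ z₀ * hFun R G u₀ w₁ z₁ *
      hFun R G u₁ w₀ z₀ * hFun R G u₁ w₀ z₁ * hFun R G u₁ w₁ z₀ * hFun R G u₁ w₁ z₁

/-- `(H,G)` has `dev_{2,3}(ε₁,ε₂)`, where the trigraph/3-graph is given by triples `R`. -/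
def dev23 (R : Finset (ℕ × ℕ × ℕ)) (G : Triad) (ε₁ ε₂ : ℝ) : Prop :=
  ∃ dXY dYZ dXZ : ℝ, 0 < dXY ∧ 0 < dYZ ∧ 0 < dXZ ∧
    G.bXY.dev2 ε₂ dXY ∧ G.bXZ.dev2 ε₂ dXZ ∧ G.bYZ.dev2 ε₂ dYZ ∧
    devSum3 R G ≤ ε₁ * dXY ^ 4 * dYZ ^ 4 * dXZ ^ 4 *
      (G.X.card : ℝ) ^ 2 * (G.Y.card : ℝ) ^ 2 * (G.Z.card : ℝ) ^ 2

/-- `G` is `μ`-homogeneous with respect to the triples `R`: `d_H(G) ∈ [0,μ) ∪ (1-μ,1]`. -/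
def homTriad (R : Finset (ℕ × ℕ × ℕ)) (G : Triad) (μ : ℝ) : Prop :=
  relDensity R G < μ ∨ 1 - μ < relDensity R G

/-- A `(t,ℓ)`-decomposition of `V`, with part-indices `ι` and pair-indices `κ`. -/
structure Decomp (V : Finset ℕ) (ι κ : Type) where
  part : ι → Finset ℕ
  part_sub : ∀ i, part i ⊆ V
  part_disj : ∀ i j, i ≠ j → Disjoint (part i) (part j)
  part_cover : ∀ x ∈ V, ∃ i, x ∈ part i
  pairs : ι → ι → κ → Finset (ℕ × ℕ)
  pairs_sub : ∀ i j α, pairs i j α ⊆ part i ×ˢ part j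
  pairs_disj : ∀ i j α β, α ≠ β → Disjoint (pairs i j α) (pairs i j β)
  pairs_cover : ∀ i j, ∀ p ∈ part i ×ˢ part j, ∃ α, p ∈ pairs i j α

def Decomp.pairBG {V : Finset ℕ} {ι κ : Type} (P : Decomp V ι κ) (i j : ι) (α : κ) : Bigraph :=
  ⟨P.part i, P.part j, P.pairs i j α, P.pairs_sub i j α⟩

/-- The triad `G^{ijk}_{α,β,γ} = (V_i,V_j,V_k; P^α_{ij}, P^β_{ik}, P^γ_{jk})`. -/
def Decomp.triadOf {V : Finset ℕ} {ι κ : Type} (P : Decomp V ι κ) (i j k : ι) (α β γ : κ) :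
    Triad :=
  ⟨P.part i, P.part j, P.part k, P.pairs i j α, P.pairs j k γ, P.pairs i k β,
    P.pairs_sub i j α, P.pairs_sub j k γ, P.pairs_sub i k β⟩

/-- `P` is a `(t,ℓ,ε₁,ε₂)`-decomposition. -/
def Decomp.isReg {V : Finset ℕ} {ι κ : Type} (P : Decomp V ι κ) (ε₁ ε₂ : ℝ) : Prop :=
  (1 - ε₁) * (V.card : ℝ) ^ 2 ≤
    (((V ×ˢ V).filter fun p =>
      ∃ i j α, p ∈ P.pairs i j α ∧ (P.pairBG i j α).dev2self ε₂).card : ℝ)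

/-- `P` is equitable. -/
def Decomp.isEquitable {V : Finset ℕ} {ι κ : Type} [Fintype κ]
    (P : Decomp V ι κ) (ε₁ ε₂ : ℝ) : Prop :=
  (∀ i j, (P.part i).card ≤ (P.part j).card + 1) ∧
  (1 - ε₁) * (V.card : ℝ) ^ 2 ≤
    (((V ×ˢ V).filter fun p =>
      ∃ i j α, p ∈ P.pairs i j α ∧
        (P.pairBG i j α).dev2 ε₂ (1 / (Fintype.card κ : ℝ))).card : ℝ)

/-- `P` is `dev_{2,3}(ε₁,ε₂)`-regular with respect to the triples `R`. -/
def Decomp.regWrt {V : Finset ℕ} {ι κ : Type} (P : Decomp V ι κ)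
    (R : Finset (ℕ × ℕ × ℕ)) (ε₁ ε₂ : ℝ) : Prop :=
  (1 - ε₁) * (V.card : ℝ) ^ 3 ≤
    (((V ×ˢ V ×ˢ V).filter fun p =>
      ∃ i j k α β γ, p ∈ (P.triadOf i j k α β γ).K3 ∧
        dev23 R (P.triadOf i j k α β γ) ε₁ ε₂).card : ℝ)

/-- The triad `G^{ijk}_{α,β,γ}` of `P` is `μ`-non-trivial. -/
def Decomp.nonTrivTriad {V : Finset ℕ} {t ℓ : ℕ} (P : Decomp V (Fin t) (Fin ℓ)) (μ : ℝ)
    (i j k : Fin t) (α β γ : Fin ℓ) : Prop :=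
  μ * (V.card : ℝ) / (t : ℝ) ≤ ((P.part i).card : ℝ) ∧
  μ * (V.card : ℝ) / (t : ℝ) ≤ ((P.part j).card : ℝ) ∧
  μ * (V.card : ℝ) / (t : ℝ) ≤ ((P.part k).card : ℝ) ∧
  μ * ((P.part i).card : ℝ) * ((P.part j).card : ℝ) / (ℓ : ℝ) ≤ ((P.pairs i j α).card : ℝ) ∧
  μ * ((P.part i).card : ℝ) * ((P.part k).card : ℝ) / (ℓ : ℝ) ≤ ((P.pairs i k β).card : ℝ) ∧
  μ * ((P.part j).card : ℝ) * ((P.part k).card : ℝ) / (ℓ : ℝ) ≤ ((P.pairs j k γ).card : ℝ)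

/-- `H` has a `dev_{2,3}(ε₁,ε₂)`-regular `(t,ℓ,ε₁,ε₂)`-decomposition. -/
def GoodDecomp (H : ThreeGraph) (t ℓ : ℕ) (ε₁ ε₂ : ℝ) : Prop :=
  ∃ P : Decomp H.verts (Fin t) (Fin ℓ), P.isReg ε₁ ε₂ ∧ P.regWrt H.obar ε₁ ε₂

def ThreeGraph.Iso (H₁ H₂ : ThreeGraph) : Prop :=
  ∃ f : ℕ → ℕ, Set.BijOn f ↑H₁.verts ↑H₂.verts ∧
    ∀ x ∈ H₁.verts, ∀ y ∈ H₁.verts, ∀ z ∈ H₁.verts,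
      (({x, y, z} : Finset ℕ) ∈ H₁.edges ↔ ({f x, f y, f z} : Finset ℕ) ∈ H₂.edges)

def ThreeGraph.induce (H : ThreeGraph) (W : Finset ℕ) : ThreeGraph where
  verts := H.verts ∩ W
  edges := H.edges.filter fun e => e ⊆ W
  edges_sub := by
    intro e he
    rw [Finset.mem_filter] at he
    obtain ⟨hsub, hcard⟩ := H.edges_sub e he.1
    exact ⟨fun x hx => Finset.mem_inter.mpr ⟨hsub hx, he.2 hx⟩, hcard⟩

/-- A hereditary property of 3-graphs. -/
def Hereditary (ℋ : Set ThreeGraph) : Prop :=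
  (∀ H₁ H₂ : ThreeGraph, ThreeGraph.Iso H₁ H₂ → H₁ ∈ ℋ → H₂ ∈ ℋ) ∧
  (∀ H ∈ ℋ, ∀ W : Finset ℕ, H.induce W ∈ ℋ)

/-- The statement `ψ(ε₁,ε₂,T,L,ℋ)`. -/
def psi (ε₁ : ℝ) (ε₂ : ℕ → ℝ) (T L : ℕ) (ℋ : Set ThreeGraph) : Prop :=
  ∃ n₀ : ℕ, ∀ H ∈ ℋ, n₀ ≤ H.verts.card →
    ∃ t ℓ : ℕ, 1 ≤ t ∧ t ≤ T ∧ 1 ≤ ℓ ∧ ℓ ≤ L ∧ GoodDecomp H t ℓ ε₁ (ε₂ ℓ)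

/-- `L_ℋ(ε₁,ε₂)`: minimal `L` such that `ψ(ε₁,ε₂,T,L,ℋ)` holds for some `T ≥ 1`. -/
noncomputable def Lfun (ℋ : Set ThreeGraph) (ε₁ : ℝ) (ε₂ : ℕ → ℝ) : ℕ :=
  sInf {L : ℕ | ∃ T : ℕ, 1 ≤ T ∧ psi ε₁ ε₂ T L ℋ}

def InZeroOne (f : ℕ → ℝ) : Prop := ∀ x, 0 < f x ∧ f x ≤ 1

/-- "For all sufficiently small `ε₁ > 0` and all `ε₂` tending to `0` sufficiently fast, `Φ`". -/
def SmallEps (Φ : ℝ → (ℕ → ℝ) → Prop) : Prop :=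
  ∃ e₁ : ℝ, 0 < e₁ ∧ ∀ ε₁ : ℝ, 0 < ε₁ → ε₁ < e₁ →
    ∃ δ : ℕ → ℝ, InZeroOne δ ∧
      ∀ ε₂ : ℕ → ℝ, InZeroOne ε₂ → (∀ x, ε₂ x ≤ δ x) → Φ ε₁ ε₂

/-- The `VC₂`-dimension of `H` is at least `k`. -/
def ThreeGraph.VC2AtLeast (H : ThreeGraph) (k : ℕ) : Prop :=
  ∃ a b : Fin k → ℕ, ∃ c : Finset (Fin k × Fin k) → ℕ,
    (∀ i, a i ∈ H.verts) ∧ (∀ i, b i ∈ H.verts) ∧ (∀ S, c S ∈ H.verts) ∧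
    ∀ (i j : Fin k) (S : Finset (Fin k × Fin k)),
      (({a i, b j, c S} : Finset ℕ) ∈ H.edges ↔ (i, j) ∈ S)

/-- `K₃[A,B,C]`: the triples meeting each of `A`, `B`, `C`. -/
def K3Parts (A B C : Finset ℕ) : Finset (Finset ℕ) :=
  (A ×ˢ B ×ˢ C).image fun p => ({p.1, p.2.1, p.2.2} : Finset ℕ)

/-- Neighborhood of `u` in the pair-set `W`, inside ambient set `V`. -/
def Nbhd (V : Finset ℕ) (W : Finset (ℕ × ℕ)) (u : ℕ) : Finset ℕ :=
  V.filter fun v => (u, v) ∈ W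

/-- An edge-colored bigraph `(U,V;E₀,E₁,E₂)`. -/
structure ECBigraph where
  left : Finset ℕ
  right : Finset ℕ
  E0 : Finset (ℕ × ℕ)
  E1 : Finset (ℕ × ℕ)
  E2 : Finset (ℕ × ℕ)
  disj01 : Disjoint E0 E1
  disj02 : Disjoint E0 E2
  disj12 : Disjoint E1 E2
  cover : E0 ∪ E1 ∪ E2 = left ×ˢ right

/-- `G` contains an `E₀/E₁`-copy of `U_bg(k)`. -/
def ECBigraph.CopyUbg (G : ECBigraph) (k : ℕ) : Prop :=
  ∃ u : Finset (Fin k) → ℕ, ∃ v : Fin k → ℕ,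
    (∀ S, u S ∈ G.left) ∧ (∀ i, v i ∈ G.right) ∧
    ∀ (S : Finset (Fin k)) (i : Fin k),
      (i ∈ S → (u S, v i) ∈ G.E1) ∧ (i ∉ S → (u S, v i) ∈ G.E0)

/-- `G` contains an `E₀/E₁`-copy of the bigraph `R`. -/
def ECBigraph.Copy01 (G : ECBigraph) (R : Bigraph) : Prop :=
  ∃ u v : ℕ → ℕ,
    (∀ a ∈ R.left, u a ∈ G.left) ∧ (∀ b ∈ R.right, v b ∈ G.right) ∧
    ∀ a ∈ R.left, ∀ b ∈ R.right,
      ((a, b) ∈ R.edges → (u a, v b) ∈ G.E1) ∧ ((a, b) ∉ R.edges → (u a, v b) ∈ G.E0)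

/-- `K₂[A,B]`: the crossing (unordered) pairs. -/
def pairsAB (A B : Finset ℕ) : Finset (Finset ℕ) :=
  (A ×ˢ B).image fun p => ({p.1, p.2} : Finset ℕ)

/-- A bipartite `U`-colored graph `Γ = (A ∪ B, (P_u)_{u ∈ U})`. -/
structure BipColored (U : Finset ℕ) where
  A : Finset ℕ
  B : Finset ℕ
  disjAB : Disjoint A B
  P : ℕ → Finset (Finset ℕ)
  P_disj : ∀ u ∈ U, ∀ u' ∈ U, u ≠ u' → Disjoint (P u) (P u')
  P_cover : U.biUnion P = pairsAB A B

/-- The bipartite graph `(A ∪ B, P_u)` of a color, as a bigraph (ordered pairs `P̄_u`). -/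
def BipColored.colorBG {U : Finset ℕ} (Γ : BipColored U) (u : ℕ) : Bigraph where
  left := Γ.A
  right := Γ.B
  edges := (Γ.A ×ˢ Γ.B).filter fun p => ({p.1, p.2} : Finset ℕ) ∈ Γ.P u
  edges_sub := Finset.filter_subset _ _

/-- `H` is an `(n,Γ)`-blowup of `G` with the explicit family `Cfam` of new vertex classes. -/
def IsBlowupWith (G : Bigraph) (n : ℕ) (Γ : BipColored G.left) (Cfam : ℕ → Finset ℕ)
    (H : ThreeGraph) : Prop :=
  (∀ v ∈ G.right, (Cfam v).card = n) ∧
  (∀ v ∈ G.right, ∀ v' ∈ G.right, v ≠ v' → Disjoint (Cfam v) (Cfam v')) ∧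
  (∀ v ∈ G.right, Disjoint (Cfam v) (Γ.A ∪ Γ.B)) ∧
  H.verts = Γ.A ∪ Γ.B ∪ G.right.biUnion Cfam ∧
  ∀ u ∈ G.left, ∀ v ∈ G.right, ∀ e ∈ Γ.P u, ∀ z ∈ Cfam v,
    (((u, v) ∈ G.edges → insert z e ∈ H.edges) ∧ ((u, v) ∉ G.edges → insert z e ∉ H.edges))

def IsBlowup (G : Bigraph) (n : ℕ) (Γ : BipColored G.left) (H : ThreeGraph) : Prop :=
  ∃ Cfam : ℕ → Finset ℕ, IsBlowupWith G n Γ Cfam H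

def ThreeGraph.ContainsInduced (H H' : ThreeGraph) : Prop :=
  ∃ W : Finset ℕ, ThreeGraph.Iso (H.induce W) H'

/-- The `G`-dimension of `H` is at least `n`. -/
def GDimAtLeast (G : Bigraph) (H : ThreeGraph) (n : ℕ) : Prop :=
  ∀ Γ : BipColored G.left, Γ.A.card = n → Γ.B.card = n →
    ∃ H' : ThreeGraph, IsBlowup G n Γ H' ∧ H.ContainsInduced H'

/-- `G ∈ B_ℋ`: `G` is irreducible and `ℋ` has infinite `G`-dimension. -/
def InBH (ℋ : Set ThreeGraph) (G : Bigraph) : Prop :=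
  G.Irreducible ∧ ∀ m : ℕ, ∃ H ∈ ℋ, GDimAtLeast G H m

/-- An encoding of the bigraph `R` in `(H,P)`, where `Rtrip = Ē(H)`. -/
def Encoding {V : Finset ℕ} {t ℓ : ℕ} (R : Bigraph) (Rtrip : Finset (ℕ × ℕ × ℕ))
    (P : Decomp V (Fin t) (Fin ℓ)) (ε₂ : ℝ) : Prop :=
  ∃ j₀ k₀ : Fin t, j₀ ≠ k₀ ∧
    ∃ f : ℕ → Fin ℓ, ∃ g : ℕ → Fin t × Fin ℓ × Fin ℓ,
      (∀ u ∈ R.left, (P.pairBG j₀ k₀ (f u)).dev2 ε₂ (1 / (ℓ : ℝ))) ∧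
      (∀ v ∈ R.right,
        (P.pairBG (g v).1 j₀ (g v).2.1).dev2 ε₂ (1 / (ℓ : ℝ)) ∧
        (P.pairBG (g v).1 k₀ (g v).2.2).dev2 ε₂ (1 / (ℓ : ℝ))) ∧
      ∀ u ∈ R.left, ∀ v ∈ R.right,
        (((u, v) ∈ R.edges →
          ((P.triadOf (g v).1 j₀ k₀ (g v).2.1 (g v).2.2 (f u)).K3.card : ℝ) / 2 ≤
            ((Rtrip ∩ (P.triadOf (g v).1 j₀ k₀ (g v).2.1 (g v).2.2 (f u)).K3).card : ℝ)) ∧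
         ((u, v) ∉ R.edges →
          ((Rtrip ∩ (P.triadOf (g v).1 j₀ k₀ (g v).2.1 (g v).2.2 (f u)).K3).card : ℝ) <
            ((P.triadOf (g v).1 j₀ k₀ (g v).2.1 (g v).2.2 (f u)).K3.card : ℝ) / 2))

def encodeSet (S : Finset ℕ) : ℕ := ∑ i ∈ S, 2 ^ i

/-- The bigraph `U_bg(k)` realized on `ℕ`, with subsets of `[k]` encoded in binary. -/
def Ubg (k : ℕ) : Bigraph where
  left := ((Finset.range k).powerset).image encodeSet
  right := Finset.range k
  edges := ((Finset.range k).powerset).biUnion fun S => S.image fun i => (encodeSet S, i)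
  edges_sub := by
    intro p hp
    simp only [Finset.mem_biUnion, Finset.mem_image, Finset.mem_powerset] at hp
    obtain ⟨S, hS, i, hi, rfl⟩ := hp
    refine Finset.mem_product.mpr ⟨?_, ?_⟩
    · exact Finset.mem_image.mpr ⟨S, Finset.mem_powerset.mpr hS, rfl⟩
    · exact hS hi

/-- The cell with label `i` of the partition of `V` induced by the labelling `c`. -/
noncomputable def cellOf {α ι : Type} (V : Finset α) (c : α → ι) (i : ι) : Finset α :=
  V.filter fun y => c y = i

/-- The indicator function of a binary relation. -/
noncomputable def ind {α : Type} (f : α → α → Prop) (x y : α) : ℝ := if f x y then 1 else 0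

/-- The average of `f` on a rectangle. -/
noncomputable def rectAvg {α : Type} (f : α → α → ℝ) (X Y : Finset α) : ℝ :=
  (∑ x ∈ X, ∑ y ∈ Y, f x y) / ((#X : ℝ) * (#Y : ℝ))

/-- The fourth-order deviation of `f` on a rectangle. -/
noncomputable def rectDev {α : Type} (f : α → α → ℝ) (X Y : Finset α) : ℝ :=
  ∑ x₀ ∈ X, ∑ x₁ ∈ X, ∑ y₀ ∈ Y, ∑ y₁ ∈ Y,
    (f x₀ y₀ - rectAvg f X Y) * (f x₀ y₁ - rectAvg f X Y) *
      (f x₁ y₀ - rectAvg f X Y) * (f x₁ y₁ - rectAvg f X Y)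

/-- The deviation on the rectangle is at most an `ε`-fraction of the trivial bound. -/
def RectReg {α : Type} (ε : ℝ) (f : α → α → ℝ) (X Y : Finset α) : Prop :=
  rectDev f X Y ≤ ε * (#X : ℝ) ^ 2 * (#Y : ℝ) ^ 2

/-- The projection of `f` to functions constant on products of cells. -/
noncomputable def cellAvg {α ι : Type} (V : Finset α) (c : α → ι) (f : α → α → ℝ) (x y : α) : ℝ :=
  rectAvg f (cellOf V c (c x)) (cellOf V c (c y))

noncomputable def energy {α ι κ : Type} [Fintype κ] (V : Finset α) (f : κ → α → α → Prop)
    (c : α → ι) : ℝ :=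
  ∑ a, ∑ x ∈ V, ∑ y ∈ V, cellAvg V c (ind (f a)) x y ^ 2

/-- The pairs of `V` lying in a product of cells that is irregular for some relation. -/
noncomputable def badPairs {α ι κ : Type} (ε : ℝ) (V : Finset α) (f : κ → α → α → Prop)
    (c : α → ι) : Finset (α × α) :=
  (V ×ˢ V).filter fun p =>
    ∃ a, ¬ RectReg ε (ind (f a)) (cellOf V c (c p.1)) (cellOf V c (c p.2))

lemma ind_nonneg {α : Type} (f : α → α → Prop) (x y : α) : 0 ≤ ind f x y := by
  unfold ind; split_ifs <;> norm_num

lemma ind_le_one {α : Type} (f : α → α → Prop) (x y : α) : ind f x y ≤ 1 := by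
  unfold ind; split_ifs <;> norm_num

lemma rectAvg_nonneg {α : Type} (f : α → α → Prop) (X Y : Finset α) :
    0 ≤ rectAvg (ind f) X Y := by
  unfold rectAvg
  have : 0 ≤ ∑ x ∈ X, ∑ y ∈ Y, ind f x y :=
    sum_nonneg fun x _ => sum_nonneg fun y _ => ind_nonneg f x y
  positivity

lemma rectAvg_le_one {α : Type} (f : α → α → Prop) (X Y : Finset α) :
    rectAvg (ind f) X Y ≤ 1 := by
  unfold rectAvg
  apply div_le_one_of_le₀ _ (by positivity)
  calc ∑ x ∈ X, ∑ y ∈ Y, ind f x y ≤ ∑ x ∈ X, ∑ y ∈ Y, (1 : ℝ) :=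
        sum_le_sum fun x _ => sum_le_sum fun y _ => ind_le_one f x y
    _ = _ := by simp

lemma sum_eq_card_mul_rectAvg {α : Type} (f : α → α → ℝ) (X Y : Finset α) :
    ∑ x ∈ X, ∑ y ∈ Y, f x y = (#X : ℝ) * (#Y : ℝ) * rectAvg f X Y := by
  unfold rectAvg
  rcases X.eq_empty_or_nonempty with rfl | hX
  · simp
  rcases Y.eq_empty_or_nonempty with rfl | hY
  · simp
  have h1 : (0 : ℝ) < #X := by exact_mod_cast hX.card_pos
  have h2 : (0 : ℝ) < #Y := by exact_mod_cast hY.card_pos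
  field_simp

lemma sum_cells {α ι : Type} [Fintype ι] (V : Finset α) (c : α → ι) (F : α → ℝ) :
    ∑ x ∈ V, F x = ∑ i, ∑ x ∈ cellOf V c i, F x :=
  (sum_fiberwise V c F).symm

lemma mem_cellOf {α ι : Type} {V : Finset α} {c : α → ι} {i : ι} {x : α} :
    x ∈ cellOf V c i ↔ x ∈ V ∧ c x = i := by simp [cellOf]

lemma sum_sum_cells {α ι : Type} [Fintype ι] (V : Finset α) (c : α → ι) (F : α → α → ℝ) :
    ∑ x ∈ V, ∑ y ∈ V, F x y =
      ∑ i, ∑ j, ∑ x ∈ cellOf V c i, ∑ y ∈ cellOf V c j, F x y := by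
  rw [sum_cells V c]
  refine sum_congr rfl fun i _ => ?_
  rw [sum_comm (s := univ)]
  exact sum_congr rfl fun x _ => sum_cells V c _

lemma sum_mul_cellAvg {α ι : Type} [Fintype ι] (V : Finset α) (c : α → ι) (f : α → α → ℝ)
    (h : ι → ι → ℝ) :
    ∑ x ∈ V, ∑ y ∈ V, f x y * h (c x) (c y) =
      ∑ x ∈ V, ∑ y ∈ V, cellAvg V c f x y * h (c x) (c y) := by
  rw [sum_sum_cells V c, sum_sum_cells V c]
  refine sum_congr rfl fun i _ => sum_congr rfl fun j _ => ?_
  have h1 : ∑ x ∈ cellOf V c i, ∑ y ∈ cellOf V c j, f x y * h (c x) (c y) =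
      (∑ x ∈ cellOf V c i, ∑ y ∈ cellOf V c j, f x y) * h i j := by
    rw [sum_mul]
    refine sum_congr rfl fun x hx => ?_
    rw [sum_mul]
    refine sum_congr rfl fun y hy => ?_
    rw [(mem_cellOf.1 hx).2, (mem_cellOf.1 hy).2]
  have h2 : ∑ x ∈ cellOf V c i, ∑ y ∈ cellOf V c j, cellAvg V c f x y * h (c x) (c y) =
      ∑ x ∈ cellOf V c i, ∑ y ∈ cellOf V c j,
        rectAvg f (cellOf V c i) (cellOf V c j) * h i j := by
    refine sum_congr rfl fun x hx => sum_congr rfl fun y hy => ?_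
    rw [cellAvg, (mem_cellOf.1 hx).2, (mem_cellOf.1 hy).2]
  rw [h1, h2, sum_eq_card_mul_rectAvg]
  simp
  ring

lemma sum_cellAvg_sub_sq {α ι ι' : Type} [Fintype ι] [Fintype ι'] (V : Finset α) (c : α → ι)
    (c' : α → ι') (π : ι' → ι) (hπ : ∀ x, π (c' x) = c x) (f : α → α → ℝ) :
    ∑ x ∈ V, ∑ y ∈ V, (cellAvg V c' f x y - cellAvg V c f x y) ^ 2 =
      ∑ x ∈ V, ∑ y ∈ V, cellAvg V c' f x y ^ 2 - ∑ x ∈ V, ∑ y ∈ V, cellAvg V c f x y ^ 2 := by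
  have e1 := sum_mul_cellAvg V c' f
    (fun i j => rectAvg f (cellOf V c (π i)) (cellOf V c (π j)))
  have e2 := sum_mul_cellAvg V c f (fun i j => rectAvg f (cellOf V c i) (cellOf V c j))
  simp only [hπ] at e1
  have e3 : ∑ x ∈ V, ∑ y ∈ V, cellAvg V c' f x y * cellAvg V c f x y =
      ∑ x ∈ V, ∑ y ∈ V, cellAvg V c f x y ^ 2 := by
    simp only [sq]
    exact e1.symm.trans e2
  have e4 : ∑ x ∈ V, ∑ y ∈ V, (cellAvg V c' f x y - cellAvg V c f x y) ^ 2 =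
      ∑ x ∈ V, ∑ y ∈ V, cellAvg V c' f x y ^ 2
        - 2 * ∑ x ∈ V, ∑ y ∈ V, cellAvg V c' f x y * cellAvg V c f x y
        + ∑ x ∈ V, ∑ y ∈ V, cellAvg V c f x y ^ 2 := by
    simp only [mul_sum, ← sum_sub_distrib, ← sum_add_distrib]
    refine sum_congr rfl fun x _ => sum_congr rfl fun y _ => ?_
    ring
  rw [e4, e3]
  ring

lemma exists_correlating_pair {α : Type} {ε : ℝ} {f : α → α → ℝ}
    {X Y : Finset α} (h : ¬ RectReg ε f X Y) :
    ∃ u ∈ X, ∃ w ∈ Y, ε * ((#X : ℝ) * (#Y : ℝ)) <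
      ∑ x ∈ X, ∑ y ∈ Y, (f x y - rectAvg f X Y) *
        ((f x w - rectAvg f X Y) * (f u y - rectAvg f X Y) * (f u w - rectAvg f X Y)) := by
  by_contra! hcon
  apply h
  unfold RectReg rectDev
  calc _ = ∑ u ∈ X, ∑ w ∈ Y, ∑ x ∈ X, ∑ y ∈ Y, (f x y - rectAvg f X Y) *
        ((f x w - rectAvg f X Y) * (f u y - rectAvg f X Y) * (f u w - rectAvg f X Y)) := by
        rw [sum_comm]
        refine sum_congr rfl fun u _ => ?_
        rw [sum_comm (s := Y) (t := X)]
        refine sum_congr rfl fun x _ => ?_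
        rw [sum_comm]
        refine sum_congr rfl fun w _ => sum_congr rfl fun y _ => ?_
        ring
    _ ≤ ∑ u ∈ X, ∑ w ∈ Y, ε * ((#X : ℝ) * (#Y : ℝ)) :=
        sum_le_sum fun u hu => sum_le_sum fun w hw => hcon u hu w hw
    _ = _ := by simp; ring

lemma exists_energy_increment {α ι κ : Type} [Fintype κ] [Fintype ι] (V : Finset α)
    (f : κ → α → α → Prop) (c : α → ι) {ε : ℝ} (hε : 0 < ε)
    (hbad : ε * (#V : ℝ) ^ 2 < #(badPairs ε V f c)) :
    ∃ c' : α → ι × (ι × ι → Bool × Bool),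
      energy V f c + ε ^ 3 * (#V : ℝ) ^ 2 ≤ energy V f c' := by
  set B : ι × ι → Prop := fun p => ∃ a, ¬ RectReg ε (ind (f a)) (cellOf V c p.1) (cellOf V c p.2)
    with hB
  have key : ∀ p : {p : ι × ι // B p}, ∃ (a : κ) (u w : α),
      ε * ((#(cellOf V c p.1.1) : ℝ) * (#(cellOf V c p.1.2) : ℝ)) <
      ∑ x ∈ cellOf V c p.1.1, ∑ y ∈ cellOf V c p.1.2,
        (ind (f a) x y - rectAvg (ind (f a)) (cellOf V c p.1.1) (cellOf V c p.1.2)) *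
        ((ind (f a) x w - rectAvg (ind (f a)) (cellOf V c p.1.1) (cellOf V c p.1.2)) *
        (ind (f a) u y - rectAvg (ind (f a)) (cellOf V c p.1.1) (cellOf V c p.1.2)) *
        (ind (f a) u w - rectAvg (ind (f a)) (cellOf V c p.1.1) (cellOf V c p.1.2))) := by
    rintro ⟨p, a, ha⟩
    obtain ⟨u, _, w, _, h⟩ := exists_correlating_pair ha
    exact ⟨a, u, w, h⟩
  choose A u w key using key
  let c' : α → ι × (ι × ι → Bool × Bool) := fun x => (c x, fun p =>
    if h : B p then (decide (f (A ⟨p, h⟩) x (w ⟨p, h⟩)), decide (f (A ⟨p, h⟩) (u ⟨p, h⟩) x))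
    else (false, false))
  let d : κ → ι × ι → ℝ := fun a p => rectAvg (ind (f a)) (cellOf V c p.1) (cellOf V c p.2)
  let K : κ → (ι × (ι × ι → Bool × Bool)) → (ι × (ι × ι → Bool × Bool)) → ℝ := fun a s t =>
    if h : B (s.1, t.1) then
      if a = A ⟨_, h⟩ then
        ((if (s.2 (s.1, t.1)).1 then 1 else 0) - d a (s.1, t.1)) *
        ((if (t.2 (s.1, t.1)).2 then 1 else 0) - d a (s.1, t.1)) *
        (ind (f a) (u ⟨_, h⟩) (w ⟨_, h⟩) - d a (s.1, t.1))
      else 0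
    else 0
  refine ⟨c', ?_⟩
  have hd0 : ∀ a p, 0 ≤ d a p := fun a p => rectAvg_nonneg _ _ _
  have hd1 : ∀ a p, d a p ≤ 1 := fun a p => rectAvg_le_one _ _ _
  have hK : ∀ x y (h : B (c x, c y)) a, K a (c' x) (c' y) =
      if a = A ⟨_, h⟩ then (ind (f a) x (w ⟨_, h⟩) - d a (c x, c y)) *
        (ind (f a) (u ⟨_, h⟩) y - d a (c x, c y)) *
        (ind (f a) (u ⟨_, h⟩) (w ⟨_, h⟩) - d a (c x, c y)) else 0 := by
    intro x y h a
    simp only [K, c', dif_pos h]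
    by_cases h1 : a = A ⟨_, h⟩
    · simp only [if_pos h1, decide_eq_true_eq, ind]
      rw [h1]
    · simp only [if_neg h1]
  have hK0 : ∀ x y, ¬ B (c x, c y) → ∀ a, K a (c' x) (c' y) = 0 := by
    intro x y h a
    simp only [K, c', dif_neg h]
  have hsub1 : ∀ a x y p, |ind (f a) x y - d a p| ≤ 1 := by
    intro a x y p
    rw [abs_le]
    constructor <;> linarith [ind_nonneg (f a) x y, ind_le_one (f a) x y, hd0 a p, hd1 a p]
  have hKsq : ∀ x y, ∑ a, K a (c' x) (c' y) ^ 2 ≤ if B (c x, c y) then 1 else 0 := by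
    intro x y
    split_ifs with h
    · simp only [hK x y h, ite_pow]
      simp only [ne_eq, OfNat.ofNat_ne_zero, not_false_eq_true, zero_pow, sum_ite_eq', mem_univ,
        if_true]
      rw [sq_le_one_iff_abs_le_one, abs_mul, abs_mul]
      exact mul_le_one₀ (mul_le_one₀ (hsub1 _ _ _ _) (abs_nonneg _) (hsub1 _ _ _ _))
        (abs_nonneg _) (hsub1 _ _ _ _)
    · simp [hK0 x y h]
  have hbadcard : (#(badPairs ε V f c) : ℝ) =
      ∑ x ∈ V, ∑ y ∈ V, if B (c x, c y) then (1 : ℝ) else 0 := by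
    rw [badPairs, card_filter, sum_product]
    push_cast
    rfl
  have hlow : ε * (#(badPairs ε V f c) : ℝ) ≤
      ∑ a, ∑ x ∈ V, ∑ y ∈ V,
        (ind (f a) x y - cellAvg V c (ind (f a)) x y) * K a (c' x) (c' y) := by
    have e1 : ∑ a, ∑ x ∈ V, ∑ y ∈ V,
        (ind (f a) x y - cellAvg V c (ind (f a)) x y) * K a (c' x) (c' y) =
        ∑ x ∈ V, ∑ y ∈ V, ∑ a,
        (ind (f a) x y - cellAvg V c (ind (f a)) x y) * K a (c' x) (c' y) := by
      rw [sum_comm]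
      exact sum_congr rfl fun x _ => sum_comm
    rw [e1, hbadcard, sum_sum_cells V c, sum_sum_cells V c]
    simp only [mul_sum]
    refine sum_le_sum fun i _ => sum_le_sum fun j _ => ?_
    by_cases h : B (i, j)
    · have e2 : ∑ x ∈ cellOf V c i, ∑ y ∈ cellOf V c j, ε * (if B (c x, c y) then (1 : ℝ) else 0)
          = ε * ((#(cellOf V c i) : ℝ) * (#(cellOf V c j) : ℝ)) := by
        rw [sum_congr rfl fun x hx => sum_congr rfl fun y hy => by
          rw [(mem_cellOf.1 hx).2, (mem_cellOf.1 hy).2, if_pos h]]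
        simp
        ring
      rw [e2]
      refine (key ⟨_, h⟩).le.trans (le_of_eq ?_)
      refine sum_congr rfl fun x hx => sum_congr rfl fun y hy => ?_
      obtain ⟨_, rfl⟩ := mem_cellOf.1 hx
      obtain ⟨_, rfl⟩ := mem_cellOf.1 hy
      simp only [hK x y h, mul_ite, mul_zero, sum_ite_eq', mem_univ, if_true]
      rfl
    · refine le_of_eq ?_
      refine sum_congr rfl fun x hx => sum_congr rfl fun y hy => ?_
      obtain ⟨_, rfl⟩ := mem_cellOf.1 hx
      obtain ⟨_, rfl⟩ := mem_cellOf.1 hy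
      simp [hK0 x y h, if_neg h]
  have hswap : ∀ a, ∑ x ∈ V, ∑ y ∈ V,
        (ind (f a) x y - cellAvg V c (ind (f a)) x y) * K a (c' x) (c' y) =
      ∑ x ∈ V, ∑ y ∈ V,
        (cellAvg V c' (ind (f a)) x y - cellAvg V c (ind (f a)) x y) * K a (c' x) (c' y) := by
    intro a
    have := sum_mul_cellAvg V c' (ind (f a)) (K a)
    simp only [sub_mul, sum_sub_distrib, this]
  have hup : ∑ a, ∑ x ∈ V, ∑ y ∈ V,
        (cellAvg V c' (ind (f a)) x y - cellAvg V c (ind (f a)) x y) * K a (c' x) (c' y) ≤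
      1 / (2 * ε) * (∑ a, ∑ x ∈ V, ∑ y ∈ V,
        (cellAvg V c' (ind (f a)) x y - cellAvg V c (ind (f a)) x y) ^ 2) +
      ε / 2 * (#(badPairs ε V f c) : ℝ) := by
    have e1 : ∑ a, ∑ x ∈ V, ∑ y ∈ V, K a (c' x) (c' y) ^ 2 ≤ (#(badPairs ε V f c) : ℝ) := by
      rw [hbadcard, sum_comm]
      refine sum_le_sum fun x _ => ?_
      rw [sum_comm]
      exact sum_le_sum fun y _ => hKsq x y
    have e2 : ∑ a, ∑ x ∈ V, ∑ y ∈ V,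
        (cellAvg V c' (ind (f a)) x y - cellAvg V c (ind (f a)) x y) * K a (c' x) (c' y) ≤
        1 / (2 * ε) * (∑ a, ∑ x ∈ V, ∑ y ∈ V,
        (cellAvg V c' (ind (f a)) x y - cellAvg V c (ind (f a)) x y) ^ 2) +
        ε / 2 * ∑ a, ∑ x ∈ V, ∑ y ∈ V, K a (c' x) (c' y) ^ 2 := by
      simp only [mul_sum, ← sum_add_distrib]
      refine sum_le_sum fun a _ => sum_le_sum fun x _ => sum_le_sum fun y _ => ?_
      generalize cellAvg V c' (ind (f a)) x y - cellAvg V c (ind (f a)) x y = s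
      generalize K a (c' x) (c' y) = t
      have : 0 ≤ (s - ε * t) ^ 2 / (2 * ε) := by positivity
      have e : (s - ε * t) ^ 2 / (2 * ε) = 1 / (2 * ε) * s ^ 2 + ε / 2 * t ^ 2 - s * t := by
        field_simp
        ring
      linarith
    have := mul_le_mul_of_nonneg_left e1 (by positivity : 0 ≤ ε / 2)
    linarith
  have hpyth : ∑ a, ∑ x ∈ V, ∑ y ∈ V,
        (cellAvg V c' (ind (f a)) x y - cellAvg V c (ind (f a)) x y) ^ 2 =
      energy V f c' - energy V f c := by
    unfold energy
    rw [← sum_sub_distrib]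
    exact sum_congr rfl fun a _ => sum_cellAvg_sub_sq V c c' Prod.fst (fun x => rfl) _
  rw [sum_congr rfl fun a _ => hswap a] at hlow
  rw [hpyth] at hup
  have h1 := hlow.trans hup
  have h2 : ε / 2 * (#(badPairs ε V f c) : ℝ) ≤ 1 / (2 * ε) * (energy V f c' - energy V f c) := by
    linarith
  have h3 : ε ^ 2 * (#(badPairs ε V f c) : ℝ) ≤ energy V f c' - energy V f c := by
    have := mul_le_mul_of_nonneg_left h2 (by positivity : 0 ≤ 2 * ε)
    have e : 2 * ε * (1 / (2 * ε) * (energy V f c' - energy V f c)) =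
        energy V f c' - energy V f c := by field_simp
    nlinarith
  have h4 := mul_le_mul_of_nonneg_left hbad.le (by positivity : 0 ≤ ε ^ 2)
  nlinarith

lemma energy_le {α ι κ : Type} [Fintype κ] (V : Finset α) (f : κ → α → α → Prop) (c : α → ι) :
    energy V f c ≤ Fintype.card κ * (#V : ℝ) ^ 2 := by
  unfold energy
  calc _ ≤ ∑ a : κ, ∑ x ∈ V, ∑ y ∈ V, (1 : ℝ) := by
        refine sum_le_sum fun a _ => sum_le_sum fun x _ => sum_le_sum fun y _ => ?_
        exact pow_le_one₀ (rectAvg_nonneg _ _ _) (rectAvg_le_one _ _ _)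
    _ = _ := by simp only [sum_const, card_univ, nsmul_eq_mul, mul_one]; ring

lemma badPairs_congr {α ι ι' κ : Type} (ε : ℝ) (V : Finset α) (f : κ → α → α → Prop)
    (c : α → ι) (c' : α → ι') (h : ∀ x, cellOf V c (c x) = cellOf V c' (c' x)) :
    badPairs ε V f c = badPairs ε V f c' := by
  simp only [badPairs, h]

/-- Szemerédi regularity for finitely many relations at once. -/
theorem exists_regular_partition (α κ : Type) [Fintype κ] {ε : ℝ} (hε : 0 < ε) :
    ∃ T : ℕ, ∀ (V : Finset α) (f : κ → α → α → Prop), ∃ c : α → Fin T,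
      (#(badPairs ε V f c) : ℝ) ≤ ε * (#V : ℝ) ^ 2 := by
  have step : ∀ n : ℕ, ∃ (ι : Type) (_ : Fintype ι), ∀ (V : Finset α) (f : κ → α → α → Prop),
      ∃ c : α → ι, (#(badPairs ε V f c) : ℝ) ≤ ε * (#V : ℝ) ^ 2 ∨
        n * (ε ^ 3 * (#V : ℝ) ^ 2) ≤ energy V f c := by
    intro n
    induction n with
    | zero =>
      refine ⟨Unit, inferInstance, fun V f => ⟨fun _ => (), Or.inr ?_⟩⟩
      simp only [Nat.cast_zero, zero_mul]
      exact sum_nonneg fun a _ => sum_nonneg fun x _ => sum_nonneg fun y _ => sq_nonneg _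
    | succ n ih =>
      obtain ⟨ι, _, h⟩ := ih
      refine ⟨ι × (ι × ι → Bool × Bool), inferInstance, fun V f => ?_⟩
      obtain ⟨c, hc⟩ := h V f
      by_cases hg : (#(badPairs ε V f c) : ℝ) ≤ ε * (#V : ℝ) ^ 2
      · refine ⟨fun x => (c x, fun _ => (false, false)), Or.inl ?_⟩
        rwa [badPairs_congr ε V f _ c]
        simp [cellOf]
      · obtain ⟨c', hc'⟩ := exists_energy_increment V f c hε (not_le.1 hg)
        refine ⟨c', Or.inr ?_⟩
        have := hc.resolve_left hg
        push_cast
        linarith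
  obtain ⟨n, hn⟩ := exists_nat_gt ((Fintype.card κ : ℝ) / ε ^ 3)
  obtain ⟨ι, _, h⟩ := step n
  refine ⟨Fintype.card ι, fun V f => ?_⟩
  obtain ⟨c, hc⟩ := h V f
  have hg : (#(badPairs ε V f c) : ℝ) ≤ ε * (#V : ℝ) ^ 2 := by
    rcases hc with hc | hc
    · exact hc
    rcases V.eq_empty_or_nonempty with rfl | hV
    · simp [badPairs]
    exfalso
    have hN : (0 : ℝ) < #V := by exact_mod_cast hV.card_pos
    have h1 := hc.trans (energy_le V f c)
    rw [← mul_assoc] at h1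
    have h2 := le_of_mul_le_mul_right h1 (by positivity)
    rw [div_lt_iff₀ (by positivity)] at hn
    linarith
  refine ⟨fun x => Fintype.equivFin ι (c x), ?_⟩
  rwa [badPairs_congr ε V f _ c]
  simp [cellOf]

/-- Cauchy-Schwarz against a function bounded by one. -/
lemma sq_sum_mul_le {α : Type} (s : Finset α) (u a : α → ℝ) (hu : ∀ x ∈ s, |u x| ≤ 1) :
    (∑ x ∈ s, u x * a x) ^ 2 ≤ #s * ∑ x ∈ s, a x ^ 2 := by
  refine (sum_mul_sq_le_sq_mul_sq s u a).trans ?_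
  refine mul_le_mul_of_nonneg_right ?_ (sum_nonneg fun x _ => sq_nonneg _)
  calc ∑ x ∈ s, u x ^ 2 ≤ ∑ x ∈ s, (1 : ℝ) :=
        sum_le_sum fun x hx => (sq_le_one_iff_abs_le_one _).2 (hu x hx)
    _ = #s := by simp

/-- The cut norm of `g` on the rectangle is at most `η` times its area. -/
def CutLe {α : Type} (η : ℝ) (g : α → α → ℝ) (X Y : Finset α) : Prop :=
  ∀ u v : α → ℝ, (∀ x ∈ X, |u x| ≤ 1) → (∀ y ∈ Y, |v y| ≤ 1) →
    |∑ x ∈ X, ∑ y ∈ Y, g x y * (u x * v y)| ≤ η * (#X * #Y)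

lemma RectReg.cutLe {α : Type} {η : ℝ} (hη : 0 ≤ η) {f : α → α → ℝ} {X Y : Finset α}
    (h : RectReg (η ^ 4) f X Y) : CutLe η (fun x y => f x y - rectAvg f X Y) X Y := by
  intro u v hu hv
  set g := fun x y => f x y - rectAvg f X Y with hg
  have h1 : (∑ x ∈ X, ∑ y ∈ Y, g x y * (u x * v y)) ^ 2 ≤
      #X * ∑ p ∈ Y ×ˢ Y, (v p.1 * v p.2) * ∑ x ∈ X, g x p.1 * g x p.2 := by
    have e : ∑ x ∈ X, ∑ y ∈ Y, g x y * (u x * v y) = ∑ x ∈ X, u x * ∑ y ∈ Y, g x y * v y := by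
      refine sum_congr rfl fun x _ => ?_
      rw [mul_sum]
      exact sum_congr rfl fun y _ => by ring
    rw [e]
    refine (sq_sum_mul_le X u _ hu).trans (le_of_eq ?_)
    congr 1
    simp only [mul_sum]
    rw [sum_comm]
    refine sum_congr rfl fun x _ => ?_
    rw [sq, sum_mul_sum, sum_product]
    exact sum_congr rfl fun y _ => sum_congr rfl fun y' _ => by ring
  have h2 : (∑ p ∈ Y ×ˢ Y, (v p.1 * v p.2) * ∑ x ∈ X, g x p.1 * g x p.2) ^ 2 ≤
      #Y ^ 2 * rectDev f X Y := by
    refine (sq_sum_mul_le (Y ×ˢ Y) (fun p => v p.1 * v p.2) _ ?_).trans (le_of_eq ?_)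
    · intro p hp
      rw [mem_product] at hp
      rw [abs_mul]
      exact mul_le_one₀ (hv _ hp.1) (abs_nonneg _) (hv _ hp.2)
    · rw [card_product]
      push_cast
      rw [sq (#Y : ℝ)]
      congr 1
      unfold rectDev
      simp only [sq, sum_mul_sum]
      rw [sum_comm]
      refine sum_congr rfl fun x _ => ?_
      rw [sum_comm]
      refine sum_congr rfl fun x' _ => ?_
      rw [sum_product]
      refine sum_congr rfl fun y _ => sum_congr rfl fun y' _ => ?_
      simp only [hg]
      ring
  have h3 : (∑ x ∈ X, ∑ y ∈ Y, g x y * (u x * v y)) ^ 4 ≤ (η * (#X * #Y)) ^ 4 := by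
    set S := ∑ x ∈ X, ∑ y ∈ Y, g x y * (u x * v y)
    set R := ∑ p ∈ Y ×ˢ Y, (v p.1 * v p.2) * ∑ x ∈ X, g x p.1 * g x p.2
    have h4 : (S ^ 2) ^ 2 ≤ (#X * R) ^ 2 := pow_le_pow_left₀ (sq_nonneg _) h1 2
    have h5 : (#X : ℝ) ^ 2 * R ^ 2 ≤ #X ^ 2 * (#Y ^ 2 * (η ^ 4 * (#X : ℝ) ^ 2 * (#Y : ℝ) ^ 2)) :=
      mul_le_mul_of_nonneg_left (h2.trans (mul_le_mul_of_nonneg_left h (by positivity)))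
        (by positivity)
    calc S ^ 4 = (S ^ 2) ^ 2 := by ring
      _ ≤ (#X * R) ^ 2 := h4
      _ = (#X : ℝ) ^ 2 * R ^ 2 := by ring
      _ ≤ _ := h5
      _ = _ := by ring
  rw [← (by decide : Even 4).pow_abs] at h3
  exact le_of_pow_le_pow_left₀ (by norm_num) (by positivity) h3

lemma sum_piFinset_update {I α : Type} [Fintype I] [DecidableEq I] (X : I → Finset α) (i : I)
    (F : (I → α) → ℝ) :
    ∑ x ∈ Fintype.piFinset X, ∑ a ∈ X i, F (Function.update x i a) =
      #(X i) * ∑ x ∈ Fintype.piFinset X, F x := by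
  have h : ∑ p ∈ Fintype.piFinset X ×ˢ X i, F (Function.update p.1 i p.2) =
      ∑ p ∈ Fintype.piFinset X ×ˢ X i, F p.1 := by
    refine sum_nbij' (fun p => (Function.update p.1 i p.2, p.1 i))
      (fun p => (Function.update p.1 i p.2, p.1 i)) ?_ ?_ ?_ ?_ ?_
    · rintro ⟨x, a⟩ hp
      simp only [mem_product, Fintype.mem_piFinset] at hp ⊢
      refine ⟨fun j => ?_, hp.1 i⟩
      by_cases hj : j = i
      · subst hj; simpa using hp.2
      · simpa [hj] using hp.1 j
    · rintro ⟨x, a⟩ hp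
      simp only [mem_product, Fintype.mem_piFinset] at hp ⊢
      refine ⟨fun j => ?_, hp.1 i⟩
      by_cases hj : j = i
      · subst hj; simpa using hp.2
      · simpa [hj] using hp.1 j
    · rintro ⟨x, a⟩ hp; simp
    · rintro ⟨x, a⟩ hp; simp
    · rintro ⟨x, a⟩ hp; simp
  rw [sum_product, sum_product] at h
  rw [h]
  simp [mul_sum]

lemma abs_sum_piFinset_le {I α : Type} [Fintype I] [DecidableEq I] (X : I → Finset α)
    {i j : I} (hij : i ≠ j)
    {η : ℝ} {g : α → α → ℝ} (hg : CutLe η g (X i) (X j)) (u v : (I → α) → ℝ)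
    (hu : ∀ x a, u (Function.update x j a) = u x) (hv : ∀ x a, v (Function.update x i a) = v x)
    (hu1 : ∀ x ∈ Fintype.piFinset X, |u x| ≤ 1) (hv1 : ∀ x ∈ Fintype.piFinset X, |v x| ≤ 1) :
    |∑ x ∈ Fintype.piFinset X, g (x i) (x j) * (u x * v x)| ≤ η * ∏ k, (#(X k) : ℝ) := by
  by_cases hne : (Fintype.piFinset X).Nonempty
  swap
  · rw [not_nonempty_iff_eq_empty.1 hne, sum_empty, abs_zero, ← Nat.cast_prod,
      ← Fintype.card_piFinset, not_nonempty_iff_eq_empty.1 hne]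
    simp
  obtain ⟨x₀, hx₀⟩ := hne
  rw [Fintype.mem_piFinset] at hx₀
  have hi : (0 : ℝ) < #(X i) := by exact_mod_cast card_pos.2 ⟨_, hx₀ i⟩
  have hj : (0 : ℝ) < #(X j) := by exact_mod_cast card_pos.2 ⟨_, hx₀ j⟩
  have hup : ∀ x ∈ Fintype.piFinset X, ∀ k, ∀ a ∈ X k,
      Function.update x k a ∈ Fintype.piFinset X := by
    intro x hx k a ha
    rw [Fintype.mem_piFinset] at hx ⊢
    intro l
    by_cases hl : l = k
    · subst hl; simpa using ha
    · simpa [hl] using hx l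
  set F : (I → α) → ℝ := fun x => g (x i) (x j) * (u x * v x) with hF
  have e : #(X i) * (#(X j) * ∑ x ∈ Fintype.piFinset X, F x) =
      ∑ x ∈ Fintype.piFinset X, ∑ a ∈ X i, ∑ b ∈ X j,
        g a b * (u (Function.update x i a) * v (Function.update x j b)) := by
    rw [← sum_piFinset_update X j, ← sum_piFinset_update X i]
    refine sum_congr rfl fun x _ => sum_congr rfl fun a _ => sum_congr rfl fun b _ => ?_
    simp only [hF, Function.update_self, hu]
    rw [Function.update_of_ne hij, Function.update_self, Function.update_comm hij, hv]
  have h1 : |(#(X i) : ℝ) * (#(X j) * ∑ x ∈ Fintype.piFinset X, F x)| ≤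
      ∑ x ∈ Fintype.piFinset X, η * (#(X i) * #(X j)) := by
    rw [e]
    refine (abs_sum_le_sum_abs _ _).trans (sum_le_sum fun x hx => ?_)
    exact hg _ _ (fun a ha => hu1 _ (hup x hx i a ha)) (fun b hb => hv1 _ (hup x hx j b hb))
  rw [sum_const, nsmul_eq_mul, Fintype.card_piFinset, abs_mul, abs_mul, abs_of_pos hi,
    abs_of_pos hj] at h1
  push_cast at h1
  have h2 : (#(X i) * #(X j) : ℝ) * |∑ x ∈ Fintype.piFinset X, F x| ≤
      (#(X i) * #(X j) : ℝ) * (η * ∏ k, (#(X k) : ℝ)) := by linarith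
  exact le_of_mul_le_mul_left h2 (by positivity)

/-- A weighted counting lemma for patterns of regular pairs. -/
theorem counting {I α : Type} [Fintype I] [DecidableEq I] (X : I → Finset α) (f : I × I → α → α → ℝ)
    (d : I × I → ℝ) {η : ℝ} (W : (I → α) → ℝ) (hW : ∀ x ∈ Fintype.piFinset X, |W x| ≤ 1)
    (S : Finset (I × I)) (hne : ∀ e ∈ S, e.1 ≠ e.2) (hanti : ∀ e ∈ S, (e.2, e.1) ∉ S)
    (hf0 : ∀ e ∈ S, ∀ x y, 0 ≤ f e x y) (hf1 : ∀ e ∈ S, ∀ x y, f e x y ≤ 1)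
    (hd0 : ∀ e ∈ S, 0 ≤ d e) (hd1 : ∀ e ∈ S, d e ≤ 1)
    (hcut : ∀ e ∈ S, CutLe η (fun x y => f e x y - d e) (X e.1) (X e.2))
    (hind : ∀ e ∈ S, (∀ x a, W (Function.update x e.1 a) = W x) ∨
      (∀ x a, W (Function.update x e.2 a) = W x)) :
    |∑ x ∈ Fintype.piFinset X, W x * ∏ e ∈ S, f e (x e.1) (x e.2) -
      (∏ e ∈ S, d e) * ∑ x ∈ Fintype.piFinset X, W x| ≤ #S * (η * ∏ k, (#(X k) : ℝ)) := by
  induction S using Finset.induction_on with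
  | empty => simp
  | insert e S he ih =>
    have ih := ih (fun e h => hne e (mem_insert_of_mem h))
      (fun e h h' => hanti e (mem_insert_of_mem h) (mem_insert_of_mem h'))
      (fun e h => hf0 e (mem_insert_of_mem h)) (fun e h => hf1 e (mem_insert_of_mem h))
      (fun e h => hd0 e (mem_insert_of_mem h)) (fun e h => hd1 e (mem_insert_of_mem h))
      (fun e h => hcut e (mem_insert_of_mem h)) (fun e h => hind e (mem_insert_of_mem h))
    have heI := mem_insert_self e S
    obtain ⟨i, j⟩ := e
    have hij : i ≠ j := hne _ heI
    set A : (I → α) → ℝ := fun x => ∏ e ∈ S with e.1 ≠ j ∧ e.2 ≠ j, f e (x e.1) (x e.2) with hA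
    set B : (I → α) → ℝ := fun x => ∏ e ∈ S with ¬ (e.1 ≠ j ∧ e.2 ≠ j), f e (x e.1) (x e.2)
      with hB
    have hAB : ∀ x, ∏ e ∈ S, f e (x e.1) (x e.2) = A x * B x := fun x =>
      (prod_filter_mul_prod_filter_not S _ _).symm
    have hAj : ∀ x a, A (Function.update x j a) = A x := by
      intro x a
      refine prod_congr rfl fun e h => ?_
      obtain ⟨_, h1, h2⟩ := mem_filter.1 h
      rw [Function.update_of_ne h1, Function.update_of_ne h2]
    have hBi : ∀ x a, B (Function.update x i a) = B x := by
      intro x a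
      refine prod_congr rfl fun e h => ?_
      obtain ⟨h0, h1⟩ := mem_filter.1 h
      have h2 : e.1 ≠ i := by
        intro h2
        have h3 : e.2 ≠ j := by
          intro h3
          exact he (by rw [← h2, ← h3]; exact h0)
        have h4 : e.1 = j := by
          by_contra h4; exact h1 ⟨h4, h3⟩
        exact hij (h2.symm.trans h4)
      have h3 : e.2 ≠ i := by
        intro h3
        have h4 : e.1 ≠ j := by
          intro h4
          refine hanti _ heI (mem_insert_of_mem ?_)
          show (j, i) ∈ S
          rw [← h3, ← h4]; exact h0
        have h5 : e.2 = j := by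
          by_contra h5; exact h1 ⟨h4, h5⟩
        exact hij (h3.symm.trans h5)
      rw [Function.update_of_ne h2, Function.update_of_ne h3]
    have habs : ∀ (S' : Finset (I × I)), S' ⊆ S → ∀ x : I → α,
        |∏ e ∈ S', f e (x e.1) (x e.2)| ≤ 1 := by
      intro S' hS' x
      rw [abs_prod]
      refine prod_le_one (fun _ _ => abs_nonneg _) fun e h => ?_
      rw [abs_of_nonneg (hf0 e (mem_insert_of_mem (hS' h)) _ _)]
      exact hf1 e (mem_insert_of_mem (hS' h)) _ _
    have hA1 : ∀ x, |A x| ≤ 1 := habs _ (filter_subset _ _)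
    have hB1 : ∀ x, |B x| ≤ 1 := habs _ (filter_subset _ _)
    have main : |∑ x ∈ Fintype.piFinset X,
        (f (i, j) (x i) (x j) - d (i, j)) * (W x * (A x * B x))| ≤ η * ∏ k, (#(X k) : ℝ) := by
      rcases hind _ heI with hi | hj
      · have := abs_sum_piFinset_le X hij (hcut _ heI) A (fun x => W x * B x) hAj
          (fun x a => by rw [hi, hBi]) (fun x _ => hA1 x) (fun x hx => by
            rw [abs_mul]; exact mul_le_one₀ (hW x hx) (abs_nonneg _) (hB1 x))
        convert this using 4
        ring
      · have := abs_sum_piFinset_le X hij (hcut _ heI) (fun x => W x * A x) B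
          (fun x a => by rw [hj, hAj]) hBi (fun x hx => by
            rw [abs_mul]; exact mul_le_one₀ (hW x hx) (abs_nonneg _) (hA1 x)) (fun x _ => hB1 x)
        convert this using 4
        ring
    have e1 : ∑ x ∈ Fintype.piFinset X, W x * ∏ e ∈ insert (i, j) S, f e (x e.1) (x e.2) -
        (∏ e ∈ insert (i, j) S, d e) * ∑ x ∈ Fintype.piFinset X, W x =
        ∑ x ∈ Fintype.piFinset X,
          (f (i, j) (x i) (x j) - d (i, j)) * (W x * (A x * B x)) +
        d (i, j) * (∑ x ∈ Fintype.piFinset X, W x * ∏ e ∈ S, f e (x e.1) (x e.2) -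
          (∏ e ∈ S, d e) * ∑ x ∈ Fintype.piFinset X, W x) := by
      have e2 : ∑ x ∈ Fintype.piFinset X, W x * ∏ e ∈ insert (i, j) S, f e (x e.1) (x e.2) =
          ∑ x ∈ Fintype.piFinset X, (f (i, j) (x i) (x j) - d (i, j)) * (W x * (A x * B x)) +
          d (i, j) * ∑ x ∈ Fintype.piFinset X, W x * ∏ e ∈ S, f e (x e.1) (x e.2) := by
        rw [mul_sum, ← sum_add_distrib]
        refine sum_congr rfl fun x _ => ?_
        rw [prod_insert he, hAB]
        ring
      rw [e2, prod_insert he]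
      ring
    rw [e1, card_insert_of_notMem he]
    refine (abs_add_le _ _).trans ?_
    rw [abs_mul, abs_of_nonneg (hd0 _ heI)]
    have h3 := mul_le_of_le_one_left (abs_nonneg (∑ x ∈ Fintype.piFinset X,
      W x * ∏ e ∈ S, f e (x e.1) (x e.2) -
          (∏ e ∈ S, d e) * ∑ x ∈ Fintype.piFinset X, W x)) (hd1 _ heI)
    push_cast
    linarith

lemma sum_piFinset_succ {α : Type} {n : ℕ} (X : Fin (n + 1) → Finset α)
    (F : (Fin (n + 1) → α) → ℝ) :
    ∑ x ∈ Fintype.piFinset X, F x =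
      ∑ a ∈ X 0, ∑ y ∈ Fintype.piFinset (fun i => X i.succ), F (Fin.cons a y) := by
  rw [← sum_product']
  refine sum_nbij' (fun x => (x 0, fun i => x i.succ)) (fun p => Fin.cons p.1 p.2) ?_ ?_ ?_ ?_ ?_
  · intro x hx
    rw [Fintype.mem_piFinset] at hx
    simp [Fintype.mem_piFinset, hx]
  · rintro ⟨a, y⟩ hp
    simp only [mem_product, Fintype.mem_piFinset] at hp ⊢
    exact fun i => Fin.cases hp.1 hp.2 i
  · intro x _
    exact Fin.cons_self_tail x
  · rintro ⟨a, y⟩ _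
    simp
  · intro x _
    congr 1
    exact (Fin.cons_self_tail x).symm

/-- A bipartite pattern of labels that are all dense and regular on a rectangle occurs there. -/
lemma exists_bipartite_pattern {α κ I J : Type} [Fintype I] [Fintype J] (lab : α → α → κ)
    (X Y : Finset α) (hX : X.Nonempty) (hY : Y.Nonempty) (target : I → J → κ) {τ η : ℝ}
    (hτ : 0 ≤ τ)
    (hdense : ∀ i j, τ ≤ rectAvg (ind fun x y => lab x y = target i j) X Y)
    (hcut : ∀ i j, CutLe η (fun x y => ind (fun x y => lab x y = target i j) x y -
      rectAvg (ind fun x y => lab x y = target i j) X Y) X Y)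
    (hsmall : (Fintype.card I * Fintype.card J : ℕ) * η <
      τ ^ (Fintype.card I * Fintype.card J)) :
    ∃ (x : I → α) (y : J → α), (∀ i, x i ∈ X) ∧ (∀ j, y j ∈ Y) ∧
      ∀ i j, lab (x i) (y j) = target i j := by
  let Z : I ⊕ J → Finset α := Sum.elim (fun _ => X) (fun _ => Y)
  let emb : I × J ↪ (I ⊕ J) × (I ⊕ J) := ⟨fun p => (Sum.inl p.1, Sum.inr p.2), by
    rintro ⟨a, b⟩ ⟨c, d⟩ h; simpa using h⟩
  let S : Finset ((I ⊕ J) × (I ⊕ J)) := univ.map emb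
  let f : (I ⊕ J) × (I ⊕ J) → α → α → ℝ := fun e => match e with
    | (Sum.inl i, Sum.inr j) => ind fun x y => lab x y = target i j
    | _ => fun _ _ => 0
  let d : (I ⊕ J) × (I ⊕ J) → ℝ := fun e => match e with
    | (Sum.inl i, Sum.inr j) => rectAvg (ind fun x y => lab x y = target i j) X Y
    | _ => 0
  have hS : ∀ e ∈ S, ∃ i j, e = (Sum.inl i, Sum.inr j) := by
    intro e he
    obtain ⟨⟨i, j⟩, _, rfl⟩ := mem_map.1 he
    exact ⟨i, j, rfl⟩
  by_contra hcon
  push Not at hcon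
  have hc := counting Z f d (η := η) (fun _ => 1) (by simp) S
    (by intro e he; obtain ⟨i, j, rfl⟩ := hS e he; simp)
    (by
      intro e he he'
      obtain ⟨i, j, rfl⟩ := hS e he
      obtain ⟨i', j', h⟩ := hS _ he'
      simp at h)
    (by intro e he x y; obtain ⟨i, j, rfl⟩ := hS e he; exact ind_nonneg _ _ _)
    (by intro e he x y; obtain ⟨i, j, rfl⟩ := hS e he; exact ind_le_one _ _ _)
    (by intro e he; obtain ⟨i, j, rfl⟩ := hS e he; exact rectAvg_nonneg _ _ _)
    (by intro e he; obtain ⟨i, j, rfl⟩ := hS e he; exact rectAvg_le_one _ _ _)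
    (by intro e he; obtain ⟨i, j, rfl⟩ := hS e he; exact hcut i j)
    (fun _ _ => Or.inl fun _ _ => rfl)
  have hzero : ∀ x ∈ Fintype.piFinset Z, ∏ e ∈ S, f e (x e.1) (x e.2) = 0 := by
    intro x hx
    rw [Fintype.mem_piFinset] at hx
    obtain ⟨i, j, hij⟩ := hcon (fun i => x (Sum.inl i)) (fun j => x (Sum.inr j))
      (fun i => hx (Sum.inl i)) (fun j => hx (Sum.inr j))
    refine prod_eq_zero (i := (Sum.inl i, Sum.inr j))
      (mem_map.2 ⟨(i, j), mem_univ _, rfl⟩) ?_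
    simp only [f, ind, if_neg hij]
  have hZ : (0 : ℝ) < ∏ k, (#(Z k) : ℝ) := by
    refine prod_pos fun k _ => ?_
    rcases k with i | j
    · exact_mod_cast hX.card_pos
    · exact_mod_cast hY.card_pos
  have hScard : #S = Fintype.card I * Fintype.card J := by
    rw [card_map, card_univ, Fintype.card_prod]
  have hd : τ ^ (Fintype.card I * Fintype.card J) ≤ ∏ e ∈ S, d e := by
    rw [← hScard, ← prod_const]
    refine prod_le_prod (fun _ _ => hτ) fun e he => ?_
    obtain ⟨i, j, rfl⟩ := hS e he
    exact hdense i j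
  rw [sum_congr rfl fun x hx => by rw [hzero x hx, mul_zero]] at hc
  simp only [sum_const_zero, zero_sub, abs_neg, sum_const, nsmul_eq_mul, mul_one,
    Fintype.card_piFinset] at hc
  push_cast at hc
  rw [← mul_assoc, hScard] at hc
  have h1 := (le_abs_self _).trans hc
  have h2 := le_of_mul_le_mul_right h1 hZ
  linarith

/-- The type of a pair over a tuple of points. -/
noncomputable def tp {α : Type} {s : ℕ} (E : α → α → α → Prop) (z : Fin s → α) (x y : α) :
    Finset (Fin s) :=
  univ.filter fun i => E x y (z i)

/-- No `VC₂`-shattering of size `k` inside `V`. -/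
def NoShatter {α : Type} (k : ℕ) (V : Finset α) (E : α → α → α → Prop) : Prop :=
  ∀ (a b : Fin k → α) (c : Finset (Fin k × Fin k) → α), (∀ i, a i ∈ V) → (∀ i, b i ∈ V) →
    (∀ Q, c Q ∈ V) → ¬ ∀ i j Q, (E (c Q) (b j) (a i) ↔ (i, j) ∈ Q)

lemma sum_choose_le (s k : ℕ) : ∑ i ∈ Iic k, s.choose i ≤ (s + 1) ^ k := by
  rw [add_pow]
  simp only [one_pow, mul_one]
  rw [← Nat.range_succ_eq_Iic]
  refine sum_le_sum fun i hi => ?_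
  have h1 : 1 ≤ k.choose i := Nat.choose_pos (by simpa [Nat.lt_succ_iff] using hi)
  calc s.choose i ≤ s ^ i := Nat.choose_le_pow _ _
    _ ≤ s ^ i * k.choose i := Nat.le_mul_of_pos_right _ h1

/-- On a regular rectangle, only polynomially many types are dense. -/
theorem card_dense_types_le {α : Type} {s k : ℕ} {V : Finset α} {E : α → α → α → Prop}
    (hE : NoShatter (k + 1) V E) (z : Fin s → α) (hz : ∀ i, z i ∈ V) {X Y : Finset α}
    (hXV : X ⊆ V) (hYV : Y ⊆ V) (hX : X.Nonempty) (hY : Y.Nonempty) {τ η : ℝ} (hτ : 0 ≤ τ)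
    (hcut : ∀ S, CutLe η (fun x y => ind (fun x y => tp E z x y = S) x y -
      rectAvg (ind fun x y => tp E z x y = S) X Y) X Y)
    (hsmall : (2 ^ ((k + 1) * (k + 1)) * (k + 1) : ℕ) * η <
      τ ^ (2 ^ ((k + 1) * (k + 1)) * (k + 1))) :
    #(univ.filter fun S => τ ≤ rectAvg (ind fun x y => tp E z x y = S) X Y) ≤ (s + 1) ^ k := by
  set 𝓕 : Finset (Finset (Fin s)) :=
    univ.filter fun S => τ ≤ rectAvg (ind fun x y => tp E z x y = S) X Y with h𝓕
  have hvc : 𝓕.vcDim ≤ k := by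
    refine Finset.sup_le fun A hA => ?_
    by_contra! hcard
    obtain ⟨A', hA', hcard'⟩ := exists_subset_card_eq (n := k + 1) hcard
    have hsh : 𝓕.Shatters A' := (mem_shatterer.1 hA).mono_right hA'
    let e := A'.orderEmbOfFin hcard'
    have htarget : ∀ (Q : Finset (Fin (k + 1) × Fin (k + 1))) (j : Fin (k + 1)),
        ∃ u ∈ 𝓕, ∀ i, e i ∈ u ↔ (i, j) ∈ Q := by
      intro Q j
      obtain ⟨u, hu, h⟩ := hsh (t := (univ.filter fun i => (i, j) ∈ Q).map e.toEmbedding) (by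
        intro a ha
        obtain ⟨i, _, rfl⟩ := mem_map.1 ha
        exact orderEmbOfFin_mem _ _ _)
      refine ⟨u, hu, fun i => ?_⟩
      have h1 : e i ∈ A' ∩ u ↔ e i ∈ u := by
        rw [mem_inter]
        exact and_iff_right (orderEmbOfFin_mem _ _ _)
      rw [← h1, h, mem_map]
      constructor
      · rintro ⟨i', hi', h'⟩
        have : i' = i := e.injective h'
        subst this
        exact (mem_filter.1 hi').2
      · intro hi
        exact ⟨i, mem_filter.2 ⟨mem_univ _, hi⟩, rfl⟩
    choose u hu hui using htarget
    obtain ⟨x, y, hx, hy, hxy⟩ := exists_bipartite_pattern (tp E z) X Y hX hY u hτ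
      (fun Q j => (mem_filter.1 (hu Q j)).2) (fun Q j => hcut (u Q j)) (by simpa using hsmall)
    refine hE (fun i => z (e i)) y x (fun i => hz _) (fun i => hYV (hy i)) (fun Q => hXV (hx Q)) ?_
    intro i j Q
    rw [← hui Q j i, ← hxy Q j]
    simp [tp]
  calc #𝓕 ≤ #𝓕.shatterer := card_le_card_shatterer 𝓕
    _ ≤ ∑ i ∈ Iic 𝓕.vcDim, (Fintype.card (Fin s)).choose i := card_shatterer_le_sum_vcDim
    _ ≤ ∑ i ∈ Iic k, s.choose i := by
        rw [Fintype.card_fin]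
        exact sum_le_sum_of_subset (Iic_subset_Iic.2 hvc)
    _ ≤ (s + 1) ^ k := sum_choose_le s k

/-- The pairs of a rectangle whose type agrees with `S` below `i`. -/
noncomputable def atom {α : Type} {s : ℕ} (E : α → α → α → Prop) (z : Fin s → α) (X Y : Finset α)
    (i : ℕ) (S : Finset (Fin s)) : Finset (α × α) :=
  (X ×ˢ Y).filter fun p => ∀ j : Fin s, j.val < i → (E p.1 p.2 (z j) ↔ j ∈ S)

/-- The majority value of the `i`-th relation on an atom. -/
def Maj {α : Type} {s : ℕ} (E : α → α → α → Prop) (z : Fin s → α) (X Y : Finset α)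
    (i : Fin s) (S : Finset (Fin s)) : Prop :=
  #(atom E z X Y i S) ≤ 2 * #((atom E z X Y i S).filter fun p => E p.1 p.2 (z i))

/-- The majority prediction of the `i`-th relation fails at a pair. -/
def Wrong {α ι : Type} {s : ℕ} (E : α → α → α → Prop) (V : Finset α) (c : α → ι) (z : Fin s → α)
    (i : Fin s) (x y : α) : Prop :=
  ¬ (E x y (z i) ↔ Maj E z (cellOf V c (c x)) (cellOf V c (c y)) i (tp E z x y))

lemma two_mul_card_atom_succ_le {α : Type} {s : ℕ} (E : α → α → α → Prop) (z : Fin s → α)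
    (X Y : Finset α) (i : Fin s) (x y : α) (h : ¬ (E x y (z i) ↔ Maj E z X Y i (tp E z x y))) :
    2 * #(atom E z X Y (i + 1) (tp E z x y)) ≤ #(atom E z X Y i (tp E z x y)) := by
  have e : atom E z X Y (i + 1) (tp E z x y) =
      (atom E z X Y i (tp E z x y)).filter fun p => (E p.1 p.2 (z i) ↔ E x y (z i)) := by
    ext p
    simp only [atom, mem_filter, tp, mem_univ, true_and, and_assoc]
    refine and_congr_right fun _ => ⟨fun h => ⟨fun j hj => h j (by omega), h i (by omega)⟩, ?_⟩
    rintro ⟨h1, h2⟩ j hj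
    rcases Nat.lt_succ_iff_lt_or_eq.1 hj with h3 | h3
    · exact h1 j h3
    · rw [Fin.ext h3]; exact h2
  rw [e]
  unfold Maj at h
  have hc := card_filter_add_card_filter_not (s := atom E z X Y i (tp E z x y))
    (fun p => E p.1 p.2 (z i))
  by_cases hx : E x y (z i)
  · simp only [hx, true_iff, iff_true] at h ⊢
    omega
  · simp only [hx, false_iff, iff_false, not_not] at h ⊢
    omega

lemma atom_succ_subset {α : Type} {s : ℕ} (E : α → α → α → Prop) (z : Fin s → α)
    (X Y : Finset α) (i : ℕ) (S : Finset (Fin s)) :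
    atom E z X Y (i + 1) S ⊆ atom E z X Y i S := by
  intro p hp
  simp only [atom, mem_filter] at hp ⊢
  exact ⟨hp.1, fun j hj => hp.2 j (by omega)⟩

lemma two_pow_card_wrong_mul_le {α : Type} {s : ℕ} (E : α → α → α → Prop) (z : Fin s → α)
    (X Y : Finset α) (x y : α) (i : ℕ) (hi : i ≤ s) :
    2 ^ #(univ.filter fun j : Fin s => j.val < i ∧
      ¬ (E x y (z j) ↔ Maj E z X Y j (tp E z x y))) * #(atom E z X Y i (tp E z x y)) ≤
      #X * #Y := by
  induction i with
  | zero =>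
    simp only [not_lt_zero, false_and, filter_false, card_empty, pow_zero, one_mul]
    rw [← card_product]
    exact card_le_card (filter_subset _ _)
  | succ i ih =>
    have ih := ih (by omega)
    set p : Fin s → Prop := fun j => ¬ (E x y (z j) ↔ Maj E z X Y j (tp E z x y)) with hp
    let i' : Fin s := ⟨i, by omega⟩
    by_cases hw : p i'
    · have e : (univ.filter fun j : Fin s => j.val < i + 1 ∧ p j) =
          insert i' (univ.filter fun j : Fin s => j.val < i ∧ p j) := by
        ext j
        simp only [mem_filter, mem_univ, true_and, mem_insert]
        constructor
        · rintro ⟨h1, h2⟩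
          rcases Nat.lt_succ_iff_lt_or_eq.1 h1 with h3 | h3
          · exact Or.inr ⟨h3, h2⟩
          · exact Or.inl (Fin.ext h3)
        · rintro (rfl | ⟨h1, h2⟩)
          · exact ⟨Nat.lt_succ_self _, hw⟩
          · exact ⟨by omega, h2⟩
      rw [e, card_insert_of_notMem (by simp [i'])]
      have := two_mul_card_atom_succ_le E z X Y i' x y hw
      calc _ = 2 ^ #(univ.filter fun j : Fin s => j.val < i ∧ p j) *
            (2 * #(atom E z X Y (i + 1) (tp E z x y))) := by ring
        _ ≤ _ := Nat.mul_le_mul_left _ this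
        _ ≤ _ := ih
    · have e : (univ.filter fun j : Fin s => j.val < i + 1 ∧ p j) =
          univ.filter fun j : Fin s => j.val < i ∧ p j := by
        ext j
        simp only [mem_filter, mem_univ, true_and]
        refine ⟨fun ⟨h1, h2⟩ => ⟨?_, h2⟩, fun ⟨h1, h2⟩ => ⟨by omega, h2⟩⟩
        rcases Nat.lt_succ_iff_lt_or_eq.1 h1 with h3 | h3
        · exact h3
        · exfalso; apply hw; rwa [← show j = i' from Fin.ext h3]
      rw [e]
      exact (Nat.mul_le_mul_left _ (card_le_card (atom_succ_subset E z X Y i _))).trans ih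

lemma card_atom_eq {α : Type} {s : ℕ} (E : α → α → α → Prop) (z : Fin s → α)
    (X Y : Finset α) (S : Finset (Fin s)) :
    (#(atom E z X Y s S) : ℝ) = #X * #Y * rectAvg (ind fun x y => tp E z x y = S) X Y := by
  rw [← sum_eq_card_mul_rectAvg, atom, card_filter, sum_product]
  push_cast
  refine sum_congr rfl fun x _ => sum_congr rfl fun y _ => ?_
  simp only [ind]
  congr 1
  rw [eq_iff_iff]
  constructor
  · intro h; ext j; simp [tp, h j j.2]
  · rintro rfl j _; simp [tp]

/-- The density, in the product of cells of a pair, of the pairs having the same type. -/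
noncomputable def typeDensity {α ι : Type} {s : ℕ} (E : α → α → α → Prop) (V : Finset α)
    (c : α → ι) (z : Fin s → α) (x y : α) : ℝ :=
  cellAvg V c (ind fun x' y' => tp E z x' y' = tp E z x y) x y

lemma card_wrong_le {α ι : Type} {s R : ℕ} (E : α → α → α → Prop) (V : Finset α)
    (c : α → ι) (z : Fin s → α) {x y : α} (hx : x ∈ V) (hy : y ∈ V)
    (h : ((2 : ℝ) ^ R)⁻¹ ≤ typeDensity E V c z x y) :
    #(univ.filter fun i => Wrong E V c z i x y) ≤ R := by
  set X := cellOf V c (c x)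
  set Y := cellOf V c (c y)
  have hX : (0 : ℝ) < #X := by exact_mod_cast card_pos.2 ⟨x, mem_cellOf.2 ⟨hx, rfl⟩⟩
  have hY : (0 : ℝ) < #Y := by exact_mod_cast card_pos.2 ⟨y, mem_cellOf.2 ⟨hy, rfl⟩⟩
  have h1 : 2 ^ #(univ.filter fun i => Wrong E V c z i x y) * #(atom E z X Y s (tp E z x y)) ≤
      #X * #Y := by
    have h0 := two_pow_card_wrong_mul_le E z X Y x y s le_rfl
    simp only [Fin.is_lt, true_and] at h0
    unfold Wrong
    convert h0
  have h2 : ((2 : ℝ) ^ #(univ.filter fun i => Wrong E V c z i x y)) *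
      (#X * #Y * typeDensity E V c z x y) ≤ #X * #Y := by
    have h3 := card_atom_eq E z X Y (tp E z x y)
    rw [typeDensity, cellAvg, ← h3]
    exact_mod_cast h1
  have h4 : ((2 : ℝ) ^ #(univ.filter fun i => Wrong E V c z i x y)) * ((2 : ℝ) ^ R)⁻¹ ≤ 1 := by
    have h5 := mul_le_mul_of_nonneg_left (mul_le_mul_of_nonneg_left h
      (by positivity : (0 : ℝ) ≤ #X * #Y))
      (by positivity : (0 : ℝ) ≤ (2 : ℝ) ^ #(univ.filter fun i => Wrong E V c z i x y))
    have h6 : (#X * #Y : ℝ) * (((2 : ℝ) ^ #(univ.filter fun i => Wrong E V c z i x y)) *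
      ((2 : ℝ) ^ R)⁻¹) ≤ #X * #Y * 1 := by linarith
    exact le_of_mul_le_mul_left h6 (by positivity)
  rw [mul_inv_le_iff₀ (by positivity), one_mul] at h4
  exact (pow_le_pow_iff_right₀ (by norm_num)).1 h4

/-- Few pairs have a type of low density. -/
lemma card_light_le {α ι : Type} [Fintype ι] {s D : ℕ} (E : α → α → α → Prop) (V : Finset α)
    (c : α → ι) (z : Fin s → α) {ε τ θ : ℝ} (hτ : 0 ≤ τ) (hθ : 0 ≤ θ)
    (hD : ∀ x ∈ V, ∀ y ∈ V, (x, y) ∉ badPairs ε V (fun S x y => tp E z x y = S) c →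
      #(univ.filter fun S => τ ≤ cellAvg V c (ind fun x y => tp E z x y = S) x y) ≤ D) :
    (#((V ×ˢ V).filter fun p => typeDensity E V c z p.1 p.2 < θ) : ℝ) ≤
      #(badPairs ε V (fun S x y => tp E z x y = S) c) + (2 ^ s * τ + D * θ) * (#V : ℝ) ^ 2 := by
  set f : Finset (Fin s) → α → α → Prop := fun S x y => tp E z x y = S with hf
  set avg : Finset (Fin s) → ι → ι → ℝ := fun S i j =>
    rectAvg (ind (f S)) (cellOf V c i) (cellOf V c j) with havg
  set h : Finset (Fin s) → ι → ι → ℝ := fun S i j =>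
    if (∃ a, ¬ RectReg ε (ind (f a)) (cellOf V c i) (cellOf V c j)) ∨ θ ≤ avg S i j then 0 else 1
    with hh
  have h1 : (#((V ×ˢ V).filter fun p => typeDensity E V c z p.1 p.2 < θ) : ℝ) ≤
      #(badPairs ε V f c) + ∑ S, ∑ x ∈ V, ∑ y ∈ V, ind (f S) x y * h S (c x) (c y) := by
    have e : ∑ S, ∑ x ∈ V, ∑ y ∈ V, ind (f S) x y * h S (c x) (c y) =
        ∑ x ∈ V, ∑ y ∈ V, h (tp E z x y) (c x) (c y) := by
      rw [sum_comm]
      refine sum_congr rfl fun x _ => ?_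
      rw [sum_comm]
      refine sum_congr rfl fun y _ => ?_
      simp [ind, hf]
    rw [e, badPairs, card_filter, card_filter, sum_product, sum_product]
    push_cast
    simp only [← sum_add_distrib]
    refine sum_le_sum fun x _ => sum_le_sum fun y _ => ?_
    have e2 : typeDensity E V c z x y = avg (tp E z x y) (c x) (c y) := rfl
    simp only [hh, e2]
    by_cases hb : ∃ a, ¬ RectReg ε (ind (f a)) (cellOf V c (c x)) (cellOf V c (c y))
    · rw [if_pos hb, if_pos (Or.inl hb)]
      split_ifs <;> norm_num
    · by_cases hl : avg (tp E z x y) (c x) (c y) < θ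
      · rw [if_pos hl, if_neg hb, if_neg (by rintro (h | h); exacts [hb h, not_le.2 hl h])]
        norm_num
      · rw [if_neg hl, if_neg hb, if_pos (Or.inr (not_lt.1 hl))]
        norm_num
  refine h1.trans (add_le_add_right ?_ _)
  rw [sum_congr rfl fun S _ => sum_mul_cellAvg V c (ind (f S)) (h S), sum_comm]
  have h2 : ∀ x ∈ V, ∀ y ∈ V, ∑ S, cellAvg V c (ind (f S)) x y * h S (c x) (c y) ≤
      2 ^ s * τ + D * θ := by
    intro x hx y hy
    by_cases hb : ∃ a, ¬ RectReg ε (ind (f a)) (cellOf V c (c x)) (cellOf V c (c y))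
    · have : ∀ S, h S (c x) (c y) = 0 := fun S => if_pos (Or.inl hb)
      simp only [this, mul_zero, sum_const_zero]
      positivity
    · have hg : (x, y) ∉ badPairs ε V f c := by
        simp only [badPairs, mem_filter, not_and]
        exact fun _ => hb
      have hD' := hD x hx y hy hg
      have h3 : ∀ S, cellAvg V c (ind (f S)) x y * h S (c x) (c y) ≤
          τ + if τ ≤ cellAvg V c (ind (f S)) x y then θ else 0 := by
        intro S
        have e2 : avg S (c x) (c y) = cellAvg V c (ind (f S)) x y := rfl
        have h0 : 0 ≤ cellAvg V c (ind (f S)) x y := rectAvg_nonneg _ _ _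
        simp only [hh, e2]
        split_ifs with h4 h5 h5 <;> first | linarith | skip
        · push Not at h4
          linarith [h4.2]
      refine (sum_le_sum fun S _ => h3 S).trans ?_
      rw [sum_add_distrib, ← sum_filter, sum_const, sum_const, card_univ, Fintype.card_finset,
        Fintype.card_fin, nsmul_eq_mul, nsmul_eq_mul]
      push_cast
      gcongr
  calc _ = ∑ x ∈ V, ∑ y ∈ V, ∑ S, cellAvg V c (ind (f S)) x y * h S (c x) (c y) :=
        sum_congr rfl fun x _ => sum_comm
    _ ≤ ∑ x ∈ V, ∑ y ∈ V, (2 ^ s * τ + D * θ) :=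
        sum_le_sum fun x hx => sum_le_sum fun y hy => h2 x hx y hy
    _ = _ := by simp only [sum_const, nsmul_eq_mul]; ring

/-- The majority predictions fail a bounded number of times on average. -/
lemma sum_card_wrong_le {α ι : Type} [Fintype ι] {s D R : ℕ} (E : α → α → α → Prop)
    (V : Finset α) (c : α → ι) (z : Fin s → α) {ε τ : ℝ} (hτ : 0 ≤ τ) (hε : s * ε ≤ 1)
    (hτs : s * (2 ^ s * τ) ≤ 1) (hR : s * (D * ((2 : ℝ) ^ R)⁻¹) ≤ 1)
    (hbad : (#(badPairs ε V (fun S x y => tp E z x y = S) c) : ℝ) ≤ ε * (#V : ℝ) ^ 2)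
    (hD : ∀ x ∈ V, ∀ y ∈ V, (x, y) ∉ badPairs ε V (fun S x y => tp E z x y = S) c →
      #(univ.filter fun S => τ ≤ cellAvg V c (ind fun x y => tp E z x y = S) x y) ≤ D) :
    ∑ i, (#((V ×ˢ V).filter fun p => Wrong E V c z i p.1 p.2) : ℝ) ≤ (R + 3) * (#V : ℝ) ^ 2 := by
  have h1 := card_light_le E V c z hτ (by positivity : 0 ≤ ((2 : ℝ) ^ R)⁻¹) hD
  have h2 : ∑ i, (#((V ×ˢ V).filter fun p => Wrong E V c z i p.1 p.2) : ℝ) =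
      ∑ p ∈ V ×ˢ V, (#(univ.filter fun i => Wrong E V c z i p.1 p.2) : ℝ) := by
    simp only [card_filter]
    push_cast
    exact sum_comm
  have h3 : ∀ p ∈ V ×ˢ V, (#(univ.filter fun i => Wrong E V c z i p.1 p.2) : ℝ) ≤
      R + s * if typeDensity E V c z p.1 p.2 < ((2 : ℝ) ^ R)⁻¹ then 1 else 0 := by
    intro p hp
    rw [mem_product] at hp
    split_ifs with h
    · have : (#(univ.filter fun i => Wrong E V c z i p.1 p.2) : ℝ) ≤ s := by
        exact_mod_cast (card_le_univ _).trans (Fintype.card_fin s).le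
      have hR0 : (0 : ℝ) ≤ R := by positivity
      linarith
    · rw [mul_zero, add_zero]
      exact_mod_cast card_wrong_le E V c z hp.1 hp.2 (not_lt.1 h)
  rw [h2]
  refine (sum_le_sum h3).trans ?_
  rw [sum_add_distrib, ← mul_sum, ← sum_filter, sum_const, sum_const, card_product,
    nsmul_eq_mul, nsmul_eq_mul]
  push_cast
  have h4 := mul_le_mul_of_nonneg_left (h1.trans (add_le_add_left hbad _))
    (by positivity : (0 : ℝ) ≤ s)
  have h5 := mul_le_mul_of_nonneg_right (add_le_add (add_le_add hε hτs) hR)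
    (by positivity : (0 : ℝ) ≤ (#V : ℝ) ^ 2)
  nlinarith

lemma mem_badPairs {α ι κ : Type} {ε : ℝ} {V : Finset α} {f : κ → α → α → Prop} {c : α → ι}
    {p : α × α} : p ∈ badPairs ε V f c ↔ p ∈ V ×ˢ V ∧
      ∃ a, ¬ RectReg ε (ind (f a)) (cellOf V c (c p.1)) (cellOf V c (c p.2)) := by
  simp only [badPairs, mem_filter]

lemma badPairs_subset {α ι κ : Type} {ε : ℝ} {V : Finset α} {f : κ → α → α → Prop} {c : α → ι} :
    badPairs ε V f c ⊆ V ×ˢ V := fun _ hp => (mem_badPairs.1 hp).1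

lemma cellOf_subset {α ι : Type} {V : Finset α} {c : α → ι} {i : ι} : cellOf V c i ⊆ V :=
  filter_subset _ _

lemma Maj_congr {α : Type} {s : ℕ} (E : α → α → α → Prop) (z : Fin s → α) (X Y : Finset α)
    (i : Fin s) {S S' : Finset (Fin s)} (h : ∀ j < i, j ∈ S ↔ j ∈ S') :
    Maj E z X Y i S ↔ Maj E z X Y i S' := by
  have e : atom E z X Y i S = atom E z X Y i S' := by
    unfold atom
    refine filter_congr fun p _ => forall_congr' fun j => ?_
    exact ⟨fun h1 h2 => (h1 h2).trans (h j h2), fun h1 h2 => (h1 h2).trans (h j h2).symm⟩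
  rw [Maj, Maj, e]

/-- Sets of at most `D` elements can be encoded by `D + 1` labels. -/
lemma exists_encoding (β : Type) [Inhabited β] (D : ℕ) :
    ∃ (enc : Finset β → β → Fin (D + 1)) (dec : Finset β → Fin (D + 1) → β),
      ∀ F, #F ≤ D → ∀ b ∈ F, dec F (enc F b) = b := by
  have h : ∀ F : Finset β, ∃ (e : β → Fin (D + 1)) (d : Fin (D + 1) → β),
      #F ≤ D → ∀ b ∈ F, d (e b) = b := by
    intro F
    by_cases hF : #F ≤ D
    · refine ⟨fun b => if h : b ∈ F then ⟨F.equivFin ⟨b, h⟩, by omega⟩ else 0,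
        fun n => if h : n.val < #F then F.equivFin.symm ⟨n, h⟩ else default, fun _ b hb => ?_⟩
      simp [hb]
    · exact ⟨fun _ => 0, fun _ => default, fun h => absurd h hF⟩
  choose enc dec h using h
  exact ⟨enc, dec, h⟩

lemma exists_good_coordinate {s : ℕ} (hs : 0 < s) {V : Finset ℕ} (hV : V.Nonempty)
    (w : Fin s → (Fin s → ℕ) → ℝ) {A : ℝ}
    (hw : ∀ z ∈ Fintype.piFinset (fun _ : Fin s => V), ∑ i, w i z ≤ A) :
    ∃ i, ∃ z ∈ Fintype.piFinset (fun _ : Fin s => V),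
      ∑ a ∈ V, w i (Function.update z i a) ≤ A / s * #V := by
  have hs' : (0 : ℝ) < s := by exact_mod_cast hs
  have hne : (univ : Finset (Fin s)).Nonempty := ⟨⟨0, hs⟩, mem_univ _⟩
  have hpi : (Fintype.piFinset (fun _ : Fin s => V)).Nonempty := by
    obtain ⟨v, hv⟩ := hV
    exact ⟨fun _ => v, by simpa using fun _ => hv⟩
  obtain ⟨i, _, hi⟩ := exists_le_of_sum_le (s := univ)
    (f := fun i => ∑ z ∈ Fintype.piFinset (fun _ : Fin s => V), w i z)
    (g := fun _ => ∑ z ∈ Fintype.piFinset (fun _ : Fin s => V), A / s) hne (by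
      rw [sum_comm]
      refine (sum_le_sum hw).trans (le_of_eq ?_)
      simp only [sum_const, nsmul_eq_mul, card_univ, Fintype.card_fin]
      field_simp)
  refine ⟨i, ?_⟩
  refine exists_le_of_sum_le hpi ?_
  rw [sum_piFinset_update (fun _ => V) i (w i)]
  refine (mul_le_mul_of_nonneg_left hi (by positivity)).trans (le_of_eq ?_)
  simp only [sum_const, nsmul_eq_mul]
  ring

/-- Parameters for `exists_low_complexity_approx`. -/
lemma exists_parameters (k j : ℕ) : ∃ τ η : ℝ, 0 < τ ∧ 0 < η ∧
    ((4 : ℝ) ^ j) * (2 ^ (4 ^ j) * τ) ≤ 1 ∧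
    ((4 : ℝ) ^ j) * ((2 ^ (4 ^ j) + ((4 : ℝ) ^ j + 1) ^ k) * τ) ≤ 1 ∧
    (4 : ℝ) ^ j * η ^ 4 ≤ 1 ∧
    ((2 ^ ((k + 1) * (k + 1)) * (k + 1) : ℕ) : ℝ) * η <
      τ ^ (2 ^ ((k + 1) * (k + 1)) * (k + 1)) := by
  set M := 2 ^ ((k + 1) * (k + 1)) * (k + 1) with hM
  set s : ℝ := (4 : ℝ) ^ j with hs
  have hs1 : 1 ≤ s := one_le_pow₀ (by norm_num)
  have h2 : (1 : ℝ) ≤ 2 ^ (4 ^ j) := one_le_pow₀ (by norm_num)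
  set B : ℝ := 2 ^ (4 ^ j) + (s + 1) ^ k with hB
  have hk : 0 < (s + 1) ^ k := by positivity
  have hB1 : 1 ≤ B := by linarith
  set τ : ℝ := 1 / (s * B) with hτ
  have hτ0 : 0 < τ := by positivity
  have hsB : s * (B * τ) = 1 := by rw [hτ]; field_simp
  have hτs : s * τ ≤ 1 := by
    rw [← hsB]
    exact mul_le_mul_of_nonneg_left (le_mul_of_one_le_left hτ0.le hB1) (by positivity)
  have hτ1 : τ ≤ 1 := by nlinarith
  have hM1 : M ≠ 0 := by positivity
  have hpow : τ ^ M ≤ τ := pow_le_of_le_one hτ0.le hτ1 hM1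
  set η : ℝ := τ ^ M / (M + 1) with hη
  have hη0 : 0 < η := by positivity
  have hητ : η ≤ τ :=
    (div_le_self (by positivity) (by linarith [(Nat.cast_nonneg M : (0:ℝ) ≤ M)])).trans hpow
  refine ⟨τ, η, hτ0, hη0, ?_, hsB.le, ?_, ?_⟩
  · rw [← hsB]
    have : (2 : ℝ) ^ (4 ^ j) ≤ B := by linarith
    gcongr
  · have : η ^ 4 ≤ η := pow_le_of_le_one hη0.le (hητ.trans hτ1) (by norm_num)
    nlinarith
  · rw [hη, ← mul_div_assoc, div_lt_iff₀ (by positivity)]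
    have : 0 < τ ^ M := by positivity
    nlinarith

/-- A ternary relation without large `VC₂`-patterns is approximated by a function of one pair
label of low complexity and two further pair labels. -/
theorem exists_low_complexity_approx (k j : ℕ) : ∃ (Q : Type) (_ : Fintype Q),
    ∀ (V : Finset ℕ) (E : ℕ → ℕ → ℕ → Prop), NoShatter (k + 1) V E →
      ∃ (a : ℕ → ℕ → Fin ((4 ^ j + 1) ^ k + 1)) (q : ℕ → ℕ → Q)
        (Φ : Fin ((4 ^ j + 1) ^ k + 1) → Q → Q → Prop),
        (#((V ×ˢ V ×ˢ V).filter fun p =>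
          ¬ (E p.1 p.2.1 p.2.2 ↔ Φ (a p.1 p.2.1) (q p.1 p.2.2) (q p.2.1 p.2.2))) : ℝ) ≤
          (2 * k + 8) / 2 ^ j * (#V : ℝ) ^ 3 := by
  obtain ⟨τ, η, hτ0, hη0, hτs, hτsD, hηs, hMη⟩ := exists_parameters k j
  set s := 4 ^ j with hs
  set D := (s + 1) ^ k with hD
  set R := (2 * j + 1) * (k + 1) with hR
  have hs0 : 0 < s := by positivity
  have hsR : (s : ℝ) = (4 : ℝ) ^ j := by rw [hs]; push_cast; rfl
  have hDR : (D : ℝ) = ((s : ℝ) + 1) ^ k := by rw [hD]; push_cast; rfl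
  rw [← hsR] at hτs hτsD hηs
  rw [← hDR] at hτsD
  obtain ⟨T, hT⟩ := exists_regular_partition ℕ (Finset (Fin s)) (ε := η ^ 4) (by positivity)
  obtain ⟨enc, dec, hdec⟩ := exists_encoding (Finset (Fin s)) D
  refine ⟨Fin T × ((Fin T × Fin T × Finset (Fin s)) → Bool) × Fin T, inferInstance,
    fun V E hE => ?_⟩
  choose c hc using fun z : Fin s → ℕ => hT V fun S x y => tp E z x y = S
  rcases V.eq_empty_or_nonempty with rfl | hV
  · exact ⟨fun _ _ => 0, fun _ _ => (c (fun _ => 0) 0, fun _ => false, c (fun _ => 0) 0),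
      fun _ _ _ => True, by simp⟩
  have hRD : (s : ℝ) * (D * ((2 : ℝ) ^ R)⁻¹) ≤ 1 := by
    have h1 : s + 1 ≤ 2 ^ (2 * j + 1) := by
      rw [hs, pow_succ, pow_mul]
      have : 1 ≤ (2 ^ 2) ^ j := Nat.one_le_pow _ _ (by norm_num)
      norm_num at this ⊢
    have h2 : s * D ≤ 2 ^ R := by
      calc s * D ≤ (s + 1) * (s + 1) ^ k := Nat.mul_le_mul_right _ (by omega)
        _ = (s + 1) ^ (k + 1) := by ring
        _ ≤ (2 ^ (2 * j + 1)) ^ (k + 1) := Nat.pow_le_pow_left h1 _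
        _ = 2 ^ R := by rw [hR, pow_mul]
    have h3 : (s : ℝ) * D ≤ 2 ^ R := by exact_mod_cast h2
    rw [← mul_assoc, mul_inv_le_iff₀ (by positivity), one_mul]
    exact h3
  have hdense : ∀ z ∈ Fintype.piFinset (fun _ : Fin s => V), ∀ x ∈ V, ∀ y ∈ V,
      (x, y) ∉ badPairs (η ^ 4) V (fun S x y => tp E z x y = S) (c z) →
      #(univ.filter fun S => τ ≤ cellAvg V (c z) (ind fun x y => tp E z x y = S) x y) ≤ D := by
    intro z hz x hx y hy hg
    rw [Fintype.mem_piFinset] at hz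
    refine card_dense_types_le hE z hz cellOf_subset cellOf_subset
      ⟨x, mem_cellOf.2 ⟨hx, rfl⟩⟩ ⟨y, mem_cellOf.2 ⟨hy, rfl⟩⟩ hτ0.le (fun S => ?_) hMη
    refine RectReg.cutLe hη0.le ?_
    by_contra hcon
    exact hg (mem_badPairs.2 ⟨mem_product.2 ⟨hx, hy⟩, S, hcon⟩)
  obtain ⟨i, z, hz, hsum⟩ := exists_good_coordinate hs0 hV
    (fun i z => (#((V ×ˢ V).filter fun p => Wrong E V (c z) z i p.1 p.2) : ℝ))
    (A := (R + 3) * (#V : ℝ) ^ 2) (fun z hz => sum_card_wrong_le E V (c z) z hτ0.le hηs hτs hRD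
      (hc z) (hdense z hz))
  let up : ℕ → Fin s → ℕ := fun a => Function.update z i a
  let F : Fin T → Fin T → Finset (Finset (Fin s)) := fun u v => univ.filter fun S =>
    τ ≤ rectAvg (ind fun x y => tp E z x y = S) (cellOf V (c z) u) (cellOf V (c z) v)
  refine ⟨fun x y => enc (F (c z x) (c z y)) (tp E z x y),
    fun x w => (c z x, fun t => decide (Maj E (up w) (cellOf V (c (up w)) t.1)
      (cellOf V (c (up w)) t.2.1) i t.2.2), c (up w) x),
    fun l q q' => q.2.1 (q.2.2, q'.2.2, dec (F q.1 q'.1) l) = true, ?_⟩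
  simp only [decide_eq_true_eq]
  set B := badPairs (η ^ 4) V (fun S x y => tp E z x y = S) (c z) with hB
  set Lt := (V ×ˢ V).filter fun p => typeDensity E V (c z) z p.1 p.2 < τ with hLt
  have hLcard := card_light_le E V (c z) z hτ0.le hτ0.le (hdense z hz)
  have hpt : ∀ x ∈ V, ∀ y ∈ V, ∀ w ∈ V,
      (if ¬ (E x y w ↔ Maj E (up w) (cellOf V (c (up w)) (c (up w) x))
        (cellOf V (c (up w)) (c (up w) y)) i
        (dec (F (c z x) (c z y)) (enc (F (c z x) (c z y)) (tp E z x y)))) then (1 : ℝ) else 0) ≤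
      (if (x, y) ∈ B then 1 else 0) + (if (x, y) ∈ Lt then 1 else 0) +
      (if Wrong E V (c (up w)) (up w) i x y then 1 else 0) := by
    intro x hx y hy w hw
    by_cases h1 : (x, y) ∈ B
    · rw [if_pos h1]; split_ifs <;> norm_num
    by_cases h2 : (x, y) ∈ Lt
    · rw [if_pos h2]; split_ifs <;> norm_num
    rw [if_neg h1, if_neg h2, zero_add, zero_add]
    have h3 : τ ≤ typeDensity E V (c z) z x y := by
      by_contra! h
      exact h2 (mem_filter.2 ⟨mem_product.2 ⟨hx, hy⟩, h⟩)
    rw [hdec (F (c z x) (c z y)) (hdense z hz x hx y hy h1) _ (mem_filter.2 ⟨mem_univ _, h3⟩)]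
    have h4 : Wrong E V (c (up w)) (up w) i x y ↔
        ¬ (E x y w ↔ Maj E (up w) (cellOf V (c (up w)) (c (up w) x))
        (cellOf V (c (up w)) (c (up w) y)) i (tp E z x y)) := by
      unfold Wrong
      rw [show up w i = w from Function.update_self _ _ _]
      rw [Maj_congr E (up w) _ _ i (S := tp E (up w) x y) (S' := tp E z x y)]
      intro l hl
      simp only [tp, mem_filter, mem_univ, true_and, up]
      rw [Function.update_of_ne hl.ne]
    exact le_of_eq (if_congr h4.symm rfl rfl)
  have hcount : (#((V ×ˢ V ×ˢ V).filter fun p =>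
      ¬ (E p.1 p.2.1 p.2.2 ↔ Maj E (up p.2.2) (cellOf V (c (up p.2.2)) (c (up p.2.2) p.1))
        (cellOf V (c (up p.2.2)) (c (up p.2.2) p.2.1)) i
        (dec (F (c z p.1) (c z p.2.1)) (enc (F (c z p.1) (c z p.2.1)) (tp E z p.1 p.2.1))))) : ℝ) ≤
      (#B + #Lt) * #V +
        ∑ w ∈ V, (#((V ×ˢ V).filter fun p => Wrong E V (c (up w)) (up w) i p.1 p.2) : ℝ) := by
    have hBc : (#B : ℝ) = ∑ x ∈ V, ∑ y ∈ V, if (x, y) ∈ B then (1 : ℝ) else 0 := by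
      have : B = (V ×ˢ V).filter (· ∈ B) := by
        rw [filter_mem_eq_inter, inter_eq_right.2 badPairs_subset]
      conv_lhs => rw [this]
      rw [card_filter, sum_product]
      push_cast
      rfl
    have hLc : (#Lt : ℝ) = ∑ x ∈ V, ∑ y ∈ V, if (x, y) ∈ Lt then (1 : ℝ) else 0 := by
      have : Lt = (V ×ˢ V).filter (· ∈ Lt) := by
        rw [filter_mem_eq_inter, inter_eq_right.2 (filter_subset _ _)]
      conv_lhs => rw [this]
      rw [card_filter, sum_product]
      push_cast
      rfl
    have hW : ∑ w ∈ V, (#((V ×ˢ V).filter fun p => Wrong E V (c (up w)) (up w) i p.1 p.2) : ℝ) =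
        ∑ x ∈ V, ∑ y ∈ V, ∑ w ∈ V, if Wrong E V (c (up w)) (up w) i x y then (1 : ℝ) else 0 := by
      simp only [card_filter, sum_product]
      push_cast
      rw [sum_comm]
      exact sum_congr rfl fun x _ => sum_comm
    rw [hW, hBc, hLc, card_filter, sum_product]
    simp only [sum_product]
    push_cast
    rw [← sum_add_distrib, sum_mul, ← sum_add_distrib]
    refine sum_le_sum fun x hx => ?_
    rw [← sum_add_distrib, sum_mul, ← sum_add_distrib]
    refine sum_le_sum fun y hy => ?_
    refine (sum_le_sum fun w hw => hpt x hx y hy w hw).trans (le_of_eq ?_)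
    rw [sum_add_distrib, sum_const, nsmul_eq_mul]
    ring
  refine hcount.trans ?_
  have hN : (0 : ℝ) < #V := by exact_mod_cast hV.card_pos
  have hsR0 : (0 : ℝ) < s := by exact_mod_cast hs0
  have hBs : (#B : ℝ) ≤ 1 / s * (#V : ℝ) ^ 2 := by
    refine (hc z).trans (mul_le_mul_of_nonneg_right ?_ (by positivity))
    rw [le_div_iff₀ hsR0]; linarith
  have hLs : (2 ^ s * τ + D * τ) * (#V : ℝ) ^ 2 ≤ 1 / s * (#V : ℝ) ^ 2 := by
    refine mul_le_mul_of_nonneg_right ?_ (by positivity)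
    rw [le_div_iff₀ hsR0]; linarith
  have hBL : ((#B + #Lt : ℝ)) * #V ≤ 3 / s * (#V : ℝ) ^ 3 := by
    have : (#B + #Lt : ℝ) ≤ 3 / s * (#V : ℝ) ^ 2 := by
      have e : (3 : ℝ) / s = 1 / s + 1 / s + 1 / s := by ring
      rw [e]
      linarith
    calc _ ≤ 3 / s * (#V : ℝ) ^ 2 * #V := mul_le_mul_of_nonneg_right this hN.le
      _ = _ := by ring
  have hfin : (R + 6 : ℝ) / s ≤ (2 * k + 8) / 2 ^ j := by
    rw [div_le_div_iff₀ hsR0 (by positivity), hsR, show (4 : ℝ) ^ j = 2 ^ j * 2 ^ j by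
      rw [← mul_pow]; norm_num, ← mul_assoc]
    refine mul_le_mul_of_nonneg_right ?_ (by positivity)
    have h1 : j + 1 ≤ 2 ^ j := Nat.lt_two_pow_self
    have h2 : R + 6 ≤ (2 * k + 8) * 2 ^ j := by
      rw [hR]; nlinarith
    exact_mod_cast h2
  calc _ ≤ 3 / s * (#V : ℝ) ^ 3 + (R + 3) * (#V : ℝ) ^ 2 / s * #V := add_le_add hBL hsum
    _ = (R + 6 : ℝ) / s * (#V : ℝ) ^ 3 := by ring
    _ ≤ _ := mul_le_mul_of_nonneg_right hfin (by positivity)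

/-- The indicator of a proposition. -/
noncomputable def ic (p : Prop) : ℝ := if p then 1 else 0

lemma ic_nonneg (p : Prop) : 0 ≤ ic p := by unfold ic; split_ifs <;> norm_num

lemma ic_le_one (p : Prop) : ic p ≤ 1 := by unfold ic; split_ifs <;> norm_num

lemma ic_of {p : Prop} (h : p) : ic p = 1 := if_pos h

lemma ic_not_of {p : Prop} (h : ¬ p) : ic p = 0 := if_neg h

lemma ic_congr {p q : Prop} (h : p ↔ q) : ic p = ic q := by unfold ic; exact if_congr h rfl rfl

lemma ic_ne_triangle (p q r : Prop) : ic (¬ (p ↔ r)) ≤ ic (¬ (p ↔ q)) + ic (¬ (q ↔ r)) := by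
  by_cases h1 : p ↔ q
  · rw [h1]; linarith [ic_nonneg (¬ (q ↔ q))]
  · rw [ic_of h1]; linarith [ic_le_one (¬ (p ↔ r)), ic_nonneg (¬ (q ↔ r))]

/-- Approximate counting of labelled triangles. -/
theorem triangle_count {α : Type} (X Y Z : Finset α) (f₁ f₂ f₃ : α → α → ℝ) (d₁ d₂ d₃ η : ℝ)
    (h₁ : ∀ x y, 0 ≤ f₁ x y ∧ f₁ x y ≤ 1) (h₂ : ∀ x y, 0 ≤ f₂ x y ∧ f₂ x y ≤ 1)
    (h₃ : ∀ x y, 0 ≤ f₃ x y ∧ f₃ x y ≤ 1)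
    (hd₁ : 0 ≤ d₁ ∧ d₁ ≤ 1) (hd₂ : 0 ≤ d₂ ∧ d₂ ≤ 1) (hd₃ : 0 ≤ d₃ ∧ d₃ ≤ 1)
    (hc₁ : CutLe η (fun x y => f₁ x y - d₁) X Y) (hc₂ : CutLe η (fun x y => f₂ x y - d₂) X Z)
    (hc₃ : CutLe η (fun x y => f₃ x y - d₃) Y Z) :
    |∑ x ∈ X, ∑ y ∈ Y, ∑ z ∈ Z, f₁ x y * f₂ x z * f₃ y z - d₁ * d₂ * d₃ * (#X * #Y * #Z)| ≤
      3 * (η * (#X * #Y * #Z)) := by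
  have h := counting (I := Fin 3) ![X, Y, Z]
    (fun e => if e = (0, 1) then f₁ else if e = (0, 2) then f₂ else f₃)
    (fun e => if e = (0, 1) then d₁ else if e = (0, 2) then d₂ else d₃) (η := η) (fun _ => 1)
    (by simp) {(0, 1), (0, 2), (1, 2)} (by decide) (by decide)
    (by intro e _; split_ifs <;> intros <;> simp [h₁, h₂, h₃])
    (by intro e _; split_ifs <;> intros <;> simp [h₁, h₂, h₃])
    (by intro e _; split_ifs <;> simp [hd₁, hd₂, hd₃])
    (by intro e _; split_ifs <;> simp [hd₁, hd₂, hd₃])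
    (by
      intro e he
      fin_cases he
      · simpa using hc₁
      · simpa using hc₂
      · simpa using hc₃)
    (by intro e _; simp)
  simp only [sum_piFinset_succ] at h
  simp [Fin.prod_univ_succ] at h
  simp only [mul_assoc] at h ⊢
  exact h

/-- The best prediction of `h` from `π` with respect to the weight `w`, fibre by fibre. -/
def MajBy {P Λ : Type} [Fintype P] (w : P → ℝ) (π : P → Λ) (h : P → Prop) (a : Λ) : Prop :=
  ∑ q, w q * ic (π q = a ∧ ¬ h q) ≤ ∑ q, w q * ic (π q = a ∧ h q)

lemma sum_majBy_le {P Λ : Type} [Fintype P] [Fintype Λ] (w : P → ℝ)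
    (π : P → Λ) (h : P → Prop) (m : Λ → Prop) :
    ∑ q, w q * ic (¬ (h q ↔ MajBy w π h (π q))) ≤ ∑ q, w q * ic (¬ (h q ↔ m (π q))) := by
  have key : ∀ m : Λ → Prop, ∑ q, w q * ic (¬ (h q ↔ m (π q))) =
      ∑ a, if m a then ∑ q, w q * ic (π q = a ∧ ¬ h q) else ∑ q, w q * ic (π q = a ∧ h q) := by
    intro m
    have e : ∀ a, (if m a then ∑ q, w q * ic (π q = a ∧ ¬ h q)
        else ∑ q, w q * ic (π q = a ∧ h q)) =
        ∑ q, w q * if π q = a then ic (¬ (h q ↔ m (π q))) else 0 := by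
      intro a
      split_ifs with hm <;> refine sum_congr rfl fun q _ => ?_
      · by_cases hq : π q = a
        · rw [if_pos hq, hq]; simp [hm]
        · rw [if_neg hq, ic_not_of (fun h => hq h.1)]
      · by_cases hq : π q = a
        · rw [if_pos hq, hq]; simp [hm]
        · rw [if_neg hq, ic_not_of (fun h => hq h.1)]
    simp only [e]
    rw [sum_comm]
    refine sum_congr rfl fun q _ => ?_
    rw [← mul_sum]
    simp
  rw [key, key]
  refine sum_le_sum fun a _ => ?_
  by_cases hM : MajBy w π h a
  · rw [if_pos hM]
    split_ifs with hm
    · exact le_rfl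
    · exact hM
  · rw [if_neg hM]
    split_ifs with hm
    · exact (not_le.1 hM).le
    · exact le_rfl

/-- The weight of a ternary relation on labels. -/
noncomputable def wt {P : Type} [Fintype P] (d₁ d₂ d₃ : P → ℝ) (F : P → P → P → Prop) : ℝ :=
  ∑ p, ∑ q, ∑ r, d₁ p * d₂ q * d₃ r * ic (F p q r)

lemma wt_triangle {P : Type} [Fintype P] {d₁ d₂ d₃ : P → ℝ} (h₁ : ∀ p, 0 ≤ d₁ p)
    (h₂ : ∀ p, 0 ≤ d₂ p) (h₃ : ∀ p, 0 ≤ d₃ p) (F G K : P → P → P → Prop) :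
    wt d₁ d₂ d₃ (fun p q r => ¬ (F p q r ↔ K p q r)) ≤
      wt d₁ d₂ d₃ (fun p q r => ¬ (F p q r ↔ G p q r)) +
        wt d₁ d₂ d₃ (fun p q r => ¬ (G p q r ↔ K p q r)) := by
  simp only [wt, ← sum_add_distrib, ← mul_add]
  refine sum_le_sum fun p _ => sum_le_sum fun q _ => sum_le_sum fun r _ => ?_
  exact mul_le_mul_of_nonneg_left (ic_ne_triangle _ _ _)
    (mul_nonneg (mul_nonneg (h₁ p) (h₂ q)) (h₃ r))

/-- If a relation on labels is close to relations measurable with respect to complementary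
parts of the labels, it is close to a relation of the first components only. -/
theorem exists_reduced_relation {Λ Q : Type} [Fintype Λ] [Fintype Q]
    {d₁ d₂ d₃ : Λ × Q × Q → ℝ} (h₁ : ∀ p, 0 ≤ d₁ p) (h₂ : ∀ p, 0 ≤ d₂ p) (h₃ : ∀ p, 0 ≤ d₃ p)
    (Φ : Λ → Q → Q → Prop) : ∃ g : Λ → Λ → Λ → Prop,
      wt d₁ d₂ d₃ (fun p q r => ¬ (Φ p.1 q.2.1 r.2.1 ↔ g p.1 q.1 r.1)) ≤
        2 * wt d₁ d₂ d₃ (fun p q r => ¬ (Φ p.1 q.2.1 r.2.1 ↔ Φ r.1 p.2.2 q.2.2)) +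
          wt d₁ d₂ d₃ (fun p q r => ¬ (Φ p.1 q.2.1 r.2.1 ↔ Φ q.1 p.2.1 r.2.2)) := by
  let G₁ : Λ → Q → Λ → Prop := fun a b c => MajBy d₃ (fun r => r.1) (fun r => Φ a b r.2.1) c
  let g : Λ → Λ → Λ → Prop := fun a b c => MajBy d₂ (fun q => q.1) (fun q => G₁ a q.2.1 c) b
  refine ⟨g, ?_⟩
  have e1 : wt d₁ d₂ d₃ (fun p q r => ¬ (Φ p.1 q.2.1 r.2.1 ↔ G₁ p.1 q.2.1 r.1)) ≤
      wt d₁ d₂ d₃ (fun p q r => ¬ (Φ p.1 q.2.1 r.2.1 ↔ Φ r.1 p.2.2 q.2.2)) := by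
    refine sum_le_sum fun p _ => sum_le_sum fun q _ => ?_
    simp only [mul_assoc, ← mul_sum]
    exact mul_le_mul_of_nonneg_left (mul_le_mul_of_nonneg_left
      (sum_majBy_le d₃ (fun r => r.1) (fun r => Φ p.1 q.2.1 r.2.1)
        (fun a => Φ a p.2.2 q.2.2)) (h₂ q)) (h₁ p)
  have e2 : wt d₁ d₂ d₃ (fun p q r => ¬ (G₁ p.1 q.2.1 r.1 ↔ g p.1 q.1 r.1)) ≤
      wt d₁ d₂ d₃ (fun p q r => ¬ (G₁ p.1 q.2.1 r.1 ↔ Φ q.1 p.2.1 r.2.2)) := by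
    refine sum_le_sum fun p _ => ?_
    refine sum_comm.trans_le (le_of_le_of_eq (sum_le_sum fun r _ => ?_) sum_comm)
    beta_reduce
    have e : ∀ F : Λ × Q × Q → ℝ, ∑ q, d₁ p * d₂ q * d₃ r * F q =
        d₁ p * d₃ r * ∑ q, d₂ q * F q := by
      intro F
      rw [mul_sum]
      exact sum_congr rfl fun q _ => by ring
    rw [e, e]
    exact mul_le_mul_of_nonneg_left
      (sum_majBy_le d₂ (fun q => q.1) (fun q => G₁ p.1 q.2.1 r.1)
        (fun b => Φ b p.2.1 r.2.2)) (mul_nonneg (h₁ p) (h₃ r))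
  have t1 := wt_triangle h₁ h₂ h₃ (fun p q r => Φ p.1 q.2.1 r.2.1)
    (fun p q r => G₁ p.1 q.2.1 r.1) (fun p q r => g p.1 q.1 r.1)
  have t2 := wt_triangle h₁ h₂ h₃ (fun p q r => G₁ p.1 q.2.1 r.1)
    (fun p q r => Φ p.1 q.2.1 r.2.1) (fun p q r => Φ q.1 p.2.1 r.2.2)
  have t3 : wt d₁ d₂ d₃ (fun p q r => ¬ (G₁ p.1 q.2.1 r.1 ↔ Φ p.1 q.2.1 r.2.1)) =
      wt d₁ d₂ d₃ (fun p q r => ¬ (Φ p.1 q.2.1 r.2.1 ↔ G₁ p.1 q.2.1 r.1)) := by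
    simp only [iff_comm]
  linarith

lemma sum_sum_sum_cells {α ι : Type} [Fintype ι] (V : Finset α) (c : α → ι) (F : α → α → α → ℝ) :
    ∑ x ∈ V, ∑ y ∈ V, ∑ z ∈ V, F x y z = ∑ i, ∑ j, ∑ k,
      ∑ x ∈ cellOf V c i, ∑ y ∈ cellOf V c j, ∑ z ∈ cellOf V c k, F x y z := by
  rw [sum_cells V c]
  refine sum_congr rfl fun i _ => ?_
  have h : ∀ x ∈ cellOf V c i, ∑ y ∈ V, ∑ z ∈ V, F x y z =
      ∑ j, ∑ k, ∑ y ∈ cellOf V c j, ∑ z ∈ cellOf V c k, F x y z :=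
    fun x _ => sum_sum_cells V c (F x)
  rw [sum_congr rfl h, sum_comm]
  exact sum_congr rfl fun j _ => sum_comm

/-- Counting labelled triples in a regular cell by the product of the label densities. -/
theorem abs_sum_sub_wt_le {α P : Type} [Fintype P] {X Y Z : Finset α} (lab : α → α → P) {η : ℝ}
    (h₁ : ∀ p, CutLe η (fun x y => ind (fun x y => lab x y = p) x y -
      rectAvg (ind fun x y => lab x y = p) X Y) X Y)
    (h₂ : ∀ p, CutLe η (fun x y => ind (fun x y => lab x y = p) x y -
      rectAvg (ind fun x y => lab x y = p) X Z) X Z)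
    (h₃ : ∀ p, CutLe η (fun x y => ind (fun x y => lab x y = p) x y -
      rectAvg (ind fun x y => lab x y = p) Y Z) Y Z) (S : P → P → P → Prop) :
    |∑ x ∈ X, ∑ y ∈ Y, ∑ z ∈ Z, ic (S (lab x y) (lab x z) (lab y z)) -
      wt (fun p => rectAvg (ind fun x y => lab x y = p) X Y)
        (fun p => rectAvg (ind fun x y => lab x y = p) X Z)
        (fun p => rectAvg (ind fun x y => lab x y = p) Y Z) S * (#X * #Y * #Z)| ≤
      (Fintype.card P : ℝ) ^ 3 * (3 * (η * (#X * #Y * #Z))) := by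
  have e : ∑ x ∈ X, ∑ y ∈ Y, ∑ z ∈ Z, ic (S (lab x y) (lab x z) (lab y z)) =
      ∑ p, ∑ q, ∑ r, ic (S p q r) * ∑ x ∈ X, ∑ y ∈ Y, ∑ z ∈ Z,
        ind (fun x y => lab x y = p) x y * ind (fun x y => lab x y = q) x z *
          ind (fun x y => lab x y = r) y z := by
    simp only [mul_sum]
    have e1 : ∀ x y z, ic (S (lab x y) (lab x z) (lab y z)) = ∑ p, ∑ q, ∑ r,
        ic (S p q r) * (ind (fun x y => lab x y = p) x y * ind (fun x y => lab x y = q) x z *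
          ind (fun x y => lab x y = r) y z) := by
      intro x y z
      simp [ind]
    simp only [e1]
    have e3 : ∀ F : α → α → α → P → ℝ, ∑ x ∈ X, ∑ y ∈ Y, ∑ z ∈ Z, ∑ p, F x y z p =
        ∑ p, ∑ x ∈ X, ∑ y ∈ Y, ∑ z ∈ Z, F x y z p := by
      intro F
      symm
      rw [sum_comm]
      refine sum_congr rfl fun x _ => ?_
      rw [sum_comm]
      exact sum_congr rfl fun y _ => sum_comm
    rw [e3]
    refine sum_congr rfl fun p _ => ?_
    rw [e3]
    refine sum_congr rfl fun q _ => ?_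
    rw [e3]
  rw [e, wt]
  simp only [sum_mul, ← sum_sub_distrib]
  have hb : ∀ p q r : P, |ic (S p q r) * ∑ x ∈ X, ∑ y ∈ Y, ∑ z ∈ Z,
        ind (fun x y => lab x y = p) x y * ind (fun x y => lab x y = q) x z *
          ind (fun x y => lab x y = r) y z -
      rectAvg (ind fun x y => lab x y = p) X Y * rectAvg (ind fun x y => lab x y = q) X Z *
        rectAvg (ind fun x y => lab x y = r) Y Z * ic (S p q r) * (#X * #Y * #Z)| ≤
      3 * (η * (#X * #Y * #Z)) := by
    intro p q r
    have h := triangle_count X Y Z _ _ _ _ _ _ η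
      (fun x y => ⟨ind_nonneg _ x y, ind_le_one _ x y⟩)
      (fun x y => ⟨ind_nonneg _ x y, ind_le_one _ x y⟩)
      (fun x y => ⟨ind_nonneg _ x y, ind_le_one _ x y⟩)
      ⟨rectAvg_nonneg _ _ _, rectAvg_le_one _ _ _⟩ ⟨rectAvg_nonneg _ _ _, rectAvg_le_one _ _ _⟩
      ⟨rectAvg_nonneg _ _ _, rectAvg_le_one _ _ _⟩ (h₁ p) (h₂ q) (h₃ r)
    refine le_trans (le_of_eq ?_) ((mul_le_of_le_one_left (abs_nonneg _)
      (ic_le_one (S p q r))).trans h)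
    conv_rhs => rw [← abs_of_nonneg (ic_nonneg (S p q r)), ← abs_mul]
    congr 1
    ring
  refine (abs_sum_le_sum_abs _ _).trans ?_
  calc _ ≤ ∑ p : P, ∑ q : P, ∑ r : P, 3 * (η * (#X * #Y * #Z)) := by
        refine sum_le_sum fun p _ => (abs_sum_le_sum_abs _ _).trans ?_
        refine sum_le_sum fun q _ => (abs_sum_le_sum_abs _ _).trans ?_
        exact sum_le_sum fun r _ => hb p q r
    _ = _ := by
        simp only [sum_const, card_univ, nsmul_eq_mul]
        ring

/-- Reduction of a relation on labels to the first components, inside a regular cell. -/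
lemma exists_reduced_relation_cell {α Λ Q : Type} [Fintype Λ] [Fintype Q] {X Y Z : Finset α}
    (lab : α → α → Λ × Q × Q) {η : ℝ}
    (h₁ : ∀ p, CutLe η (fun x y => ind (fun x y => lab x y = p) x y -
      rectAvg (ind fun x y => lab x y = p) X Y) X Y)
    (h₂ : ∀ p, CutLe η (fun x y => ind (fun x y => lab x y = p) x y -
      rectAvg (ind fun x y => lab x y = p) X Z) X Z)
    (h₃ : ∀ p, CutLe η (fun x y => ind (fun x y => lab x y = p) x y -
      rectAvg (ind fun x y => lab x y = p) Y Z) Y Z) (Φ : Λ → Q → Q → Prop) :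
    ∃ g : Λ → Λ → Λ → Prop,
      ∑ x ∈ X, ∑ y ∈ Y, ∑ z ∈ Z, ic (¬ (Φ (lab x y).1 (lab x z).2.1 (lab y z).2.1 ↔
          g (lab x y).1 (lab x z).1 (lab y z).1)) ≤
        2 * ∑ x ∈ X, ∑ y ∈ Y, ∑ z ∈ Z, ic (¬ (Φ (lab x y).1 (lab x z).2.1 (lab y z).2.1 ↔
          Φ (lab y z).1 (lab x y).2.2 (lab x z).2.2)) +
        ∑ x ∈ X, ∑ y ∈ Y, ∑ z ∈ Z, ic (¬ (Φ (lab x y).1 (lab x z).2.1 (lab y z).2.1 ↔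
          Φ (lab x z).1 (lab x y).2.1 (lab y z).2.2)) +
        12 * (Fintype.card (Λ × Q × Q) : ℝ) ^ 3 * η * (#X * #Y * #Z) := by
  obtain ⟨g, hg⟩ := exists_reduced_relation
    (d₁ := fun p => rectAvg (ind fun x y => lab x y = p) X Y)
    (d₂ := fun p => rectAvg (ind fun x y => lab x y = p) X Z)
    (d₃ := fun p => rectAvg (ind fun x y => lab x y = p) Y Z)
    (fun _ => rectAvg_nonneg _ _ _) (fun _ => rectAvg_nonneg _ _ _)
    (fun _ => rectAvg_nonneg _ _ _) Φ
  refine ⟨g, ?_⟩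
  have a1 := abs_le.1 (abs_sum_sub_wt_le lab h₁ h₂ h₃
    (fun p q r => ¬ (Φ p.1 q.2.1 r.2.1 ↔ g p.1 q.1 r.1)))
  have a2 := abs_le.1 (abs_sum_sub_wt_le lab h₁ h₂ h₃
    (fun p q r => ¬ (Φ p.1 q.2.1 r.2.1 ↔ Φ r.1 p.2.2 q.2.2)))
  have a3 := abs_le.1 (abs_sum_sub_wt_le lab h₁ h₂ h₃
    (fun p q r => ¬ (Φ p.1 q.2.1 r.2.1 ↔ Φ q.1 p.2.1 r.2.2)))
  have hn : (0 : ℝ) ≤ #X * #Y * #Z := by positivity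
  have := mul_le_mul_of_nonneg_right hg hn
  rw [add_mul, mul_assoc 2] at this
  linarith [a1.2, a2.1, a3.1]

lemma RectReg.mono {α : Type} {ε ε' : ℝ} (h : ε ≤ ε') {f : α → α → ℝ} {X Y : Finset α}
    (hr : RectReg ε f X Y) : RectReg ε' f X Y :=
  hr.trans (by gcongr)

lemma sum_ic_eq_card {α : Type} (V : Finset α) (F : α → α → α → Prop)
    [DecidablePred fun p : α × α × α => F p.1 p.2.1 p.2.2] :
    ∑ x ∈ V, ∑ y ∈ V, ∑ z ∈ V, ic (F x y z) =
      (#((V ×ˢ V ×ˢ V).filter fun p => F p.1 p.2.1 p.2.2) : ℝ) := by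
  rw [card_filter, sum_product]
  simp only [sum_product]
  push_cast
  refine sum_congr rfl fun x _ => sum_congr rfl fun y _ => sum_congr rfl fun z _ => ?_
  by_cases h : F x y z <;> simp [ic, h]

lemma sum_ic_mem {α : Type} {V : Finset α} {B : Finset (α × α)} (hB : B ⊆ V ×ˢ V) :
    ∑ x ∈ V, ∑ y ∈ V, ic ((x, y) ∈ B) = (#B : ℝ) := by
  have : B = (V ×ˢ V).filter (· ∈ B) := by
    rw [filter_mem_eq_inter, inter_eq_right.2 hB]
  conv_rhs => rw [this]
  rw [card_filter, sum_product]
  push_cast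
  refine sum_congr rfl fun x _ => sum_congr rfl fun y _ => ?_
  by_cases h : (x, y) ∈ B <;> simp [ic, h]

/-- Reduction of a relation on labels to the first components over a regular partition. -/
lemma exists_reduced_relation_partition {α ι Λ Q : Type} [Fintype ι] [Fintype Λ] [Fintype Q]
    {V : Finset α} (c : α → ι) (lab : α → α → Λ × Q × Q) {η : ℝ} (hη : 0 ≤ η)
    {B : Finset (α × α)} (hBV : B ⊆ V ×ˢ V)
    (hB : ∀ x ∈ V, ∀ y ∈ V, (x, y) ∉ B → ∀ p,
      RectReg (η ^ 4) (ind fun x y => lab x y = p) (cellOf V c (c x)) (cellOf V c (c y)))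
    (Φ : Λ → Q → Q → Prop) :
    ∃ g : ι → ι → ι → Λ → Λ → Λ → Prop,
      ∑ x ∈ V, ∑ y ∈ V, ∑ z ∈ V, ic (¬ (Φ (lab x y).1 (lab x z).2.1 (lab y z).2.1 ↔
          g (c x) (c y) (c z) (lab x y).1 (lab x z).1 (lab y z).1)) ≤
        2 * ∑ x ∈ V, ∑ y ∈ V, ∑ z ∈ V, ic (¬ (Φ (lab x y).1 (lab x z).2.1 (lab y z).2.1 ↔
          Φ (lab y z).1 (lab x y).2.2 (lab x z).2.2)) +
        ∑ x ∈ V, ∑ y ∈ V, ∑ z ∈ V, ic (¬ (Φ (lab x y).1 (lab x z).2.1 (lab y z).2.1 ↔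
          Φ (lab x z).1 (lab x y).2.1 (lab y z).2.2)) +
        12 * (Fintype.card (Λ × Q × Q) : ℝ) ^ 3 * η * (#V : ℝ) ^ 3 + 3 * (#B * #V) := by
  have hcell : ∀ i j k, ∃ g : Λ → Λ → Λ → Prop,
      ∑ x ∈ cellOf V c i, ∑ y ∈ cellOf V c j, ∑ z ∈ cellOf V c k,
        ic (¬ (Φ (lab x y).1 (lab x z).2.1 (lab y z).2.1 ↔
          g (lab x y).1 (lab x z).1 (lab y z).1)) ≤
      ∑ x ∈ cellOf V c i, ∑ y ∈ cellOf V c j, ∑ z ∈ cellOf V c k,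
        (2 * ic (¬ (Φ (lab x y).1 (lab x z).2.1 (lab y z).2.1 ↔
          Φ (lab y z).1 (lab x y).2.2 (lab x z).2.2)) +
        ic (¬ (Φ (lab x y).1 (lab x z).2.1 (lab y z).2.1 ↔
          Φ (lab x z).1 (lab x y).2.1 (lab y z).2.2)) +
        12 * (Fintype.card (Λ × Q × Q) : ℝ) ^ 3 * η +
        (ic ((x, y) ∈ B) + ic ((x, z) ∈ B) + ic ((y, z) ∈ B))) := by
    intro i j k
    by_cases hgood : ∃ x ∈ cellOf V c i, ∃ y ∈ cellOf V c j, ∃ z ∈ cellOf V c k,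
        (x, y) ∉ B ∧ (x, z) ∉ B ∧ (y, z) ∉ B
    · obtain ⟨x, hx, y, hy, z, hz, h1, h2, h3⟩ := hgood
      rw [mem_cellOf] at hx hy hz
      have g1 := hB x hx.1 y hy.1 h1
      have g2 := hB x hx.1 z hz.1 h2
      have g3 := hB y hy.1 z hz.1 h3
      rw [hx.2, hy.2] at g1
      rw [hx.2, hz.2] at g2
      rw [hy.2, hz.2] at g3
      obtain ⟨g, hg⟩ := exists_reduced_relation_cell lab (fun p => (g1 p).cutLe hη)
        (fun p => (g2 p).cutLe hη) (fun p => (g3 p).cutLe hη) Φ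
      refine ⟨g, hg.trans ?_⟩
      simp only [sum_add_distrib, ← mul_sum]
      have e' : ∀ (X Y Z : Finset α) (a : ℝ), ∑ x ∈ X, ∑ y ∈ Y, ∑ z ∈ Z, a =
          a * (#X * #Y * #Z) := by
        intro X Y Z a; simp; ring
      rw [e']
      have n1 : ∀ (X Y Z : Finset α) (F : α → α → α → Prop),
          0 ≤ ∑ x ∈ X, ∑ y ∈ Y, ∑ z ∈ Z, ic (F x y z) := fun X Y Z F =>
        sum_nonneg fun _ _ => sum_nonneg fun _ _ => sum_nonneg fun _ _ => ic_nonneg _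
      have m1 := n1 (cellOf V c i) (cellOf V c j) (cellOf V c k) fun x y _ => (x, y) ∈ B
      have m2 := n1 (cellOf V c i) (cellOf V c j) (cellOf V c k) fun x _ z => (x, z) ∈ B
      have m3 := n1 (cellOf V c i) (cellOf V c j) (cellOf V c k) fun _ y z => (y, z) ∈ B
      linarith
    · push Not at hgood
      refine ⟨fun _ _ _ => True, sum_le_sum fun x hx => sum_le_sum fun y hy =>
        sum_le_sum fun z hz => ?_⟩
      have hh := hgood x hx y hy z hz
      refine (ic_le_one _).trans ?_
      have hp : (0 : ℝ) ≤ 12 * (Fintype.card (Λ × Q × Q) : ℝ) ^ 3 * η := by positivity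
      have h1 := ic_nonneg ((x, y) ∈ B)
      have h2 := ic_nonneg ((x, z) ∈ B)
      have h3 := ic_nonneg ((y, z) ∈ B)
      have h4 : 1 ≤ ic ((x, y) ∈ B) + ic ((x, z) ∈ B) + ic ((y, z) ∈ B) := by
        by_cases b1 : (x, y) ∈ B
        · rw [ic_of b1]; linarith
        by_cases b2 : (x, z) ∈ B
        · rw [ic_of b2]; linarith
        rw [ic_of (hh b1 b2)]; linarith
      have h5 := ic_nonneg (¬ (Φ (lab x y).1 (lab x z).2.1 (lab y z).2.1 ↔
          Φ (lab y z).1 (lab x y).2.2 (lab x z).2.2))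
      have h6 := ic_nonneg (¬ (Φ (lab x y).1 (lab x z).2.1 (lab y z).2.1 ↔
          Φ (lab x z).1 (lab x y).2.1 (lab y z).2.2))
      linarith
  choose g hg using hcell
  refine ⟨g, ?_⟩
  have h1 : ∑ x ∈ V, ∑ y ∈ V, ∑ z ∈ V, ic (¬ (Φ (lab x y).1 (lab x z).2.1 (lab y z).2.1 ↔
          g (c x) (c y) (c z) (lab x y).1 (lab x z).1 (lab y z).1)) ≤
      ∑ x ∈ V, ∑ y ∈ V, ∑ z ∈ V,
        (2 * ic (¬ (Φ (lab x y).1 (lab x z).2.1 (lab y z).2.1 ↔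
          Φ (lab y z).1 (lab x y).2.2 (lab x z).2.2)) +
        ic (¬ (Φ (lab x y).1 (lab x z).2.1 (lab y z).2.1 ↔
          Φ (lab x z).1 (lab x y).2.1 (lab y z).2.2)) +
        12 * (Fintype.card (Λ × Q × Q) : ℝ) ^ 3 * η +
        (ic ((x, y) ∈ B) + ic ((x, z) ∈ B) + ic ((y, z) ∈ B))) := by
    rw [sum_sum_sum_cells V c, sum_sum_sum_cells V c]
    refine sum_le_sum fun i _ => sum_le_sum fun j _ => sum_le_sum fun k _ => ?_
    refine le_trans (le_of_eq ?_) (hg i j k)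
    refine sum_congr rfl fun x hx => sum_congr rfl fun y hy => sum_congr rfl fun z hz => ?_
    rw [(mem_cellOf.1 hx).2, (mem_cellOf.1 hy).2, (mem_cellOf.1 hz).2]
  refine h1.trans (le_of_eq ?_)
  simp only [sum_add_distrib, ← mul_sum]
  have b1 : ∑ x ∈ V, ∑ y ∈ V, ∑ z ∈ V, ic ((x, y) ∈ B) = #B * #V := by
    simp only [sum_const, nsmul_eq_mul, ← mul_sum]
    rw [sum_ic_mem hBV, mul_comm]
  have b2 : ∑ x ∈ V, ∑ y ∈ V, ∑ z ∈ V, ic ((x, z) ∈ B) = #B * #V := by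
    simp only [sum_const, nsmul_eq_mul, ← mul_sum]
    rw [sum_ic_mem hBV, mul_comm]
  have b3 : ∑ x ∈ V, ∑ y ∈ V, ∑ z ∈ V, ic ((y, z) ∈ B) = #B * #V := by
    rw [sum_ic_mem hBV, sum_const, nsmul_eq_mul, mul_comm]
  rw [b1, b2, b3]
  simp only [sum_const, nsmul_eq_mul]
  ring

/-- A symmetric ternary relation without large `VC₂`-patterns is approximated by a function of
the cells of a vertex partition and of a pair labelling with few labels, regular to an arbitrary
prescribed precision. -/
theorem exists_regular_approx (k j : ℕ) {ε : ℝ} (hε : 0 < ε) : ∃ T : ℕ,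
    ∀ (V : Finset ℕ) (E : ℕ → ℕ → ℕ → Prop), NoShatter (k + 1) V E →
      (∀ x y z, E x y z ↔ E x z y) → (∀ x y z, E x y z ↔ E y z x) →
      ∃ (c : ℕ → Fin T) (a : ℕ → ℕ → Fin ((4 ^ j + 1) ^ k + 1))
        (g : Fin T → Fin T → Fin T → Fin ((4 ^ j + 1) ^ k + 1) →
          Fin ((4 ^ j + 1) ^ k + 1) → Fin ((4 ^ j + 1) ^ k + 1) → Prop),
        (#(badPairs ε V (fun l x y => a x y = l) c) : ℝ) ≤ ε * (#V : ℝ) ^ 2 ∧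
        ∑ x ∈ V, ∑ y ∈ V, ∑ z ∈ V,
          ic (¬ (E x y z ↔ g (c x) (c y) (c z) (a x y) (a x z) (a y z))) ≤
          8 * ((2 * k + 8) / 2 ^ j) * (#V : ℝ) ^ 3 := by
  obtain ⟨Q, _, hQ⟩ := exists_low_complexity_approx k j
  set Λ := Fin ((4 ^ j + 1) ^ k + 1)
  set μ : ℝ := (2 * k + 8) / 2 ^ j with hμ
  have hμ0 : 0 < μ := by positivity
  set N : ℝ := (Fintype.card (Λ × Q × Q) : ℝ) ^ 3 with hN
  have hN0 : 0 ≤ N := by positivity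
  set η : ℝ := μ / (24 * (N + 1)) with hη
  have hη0 : 0 < η := by positivity
  have hηN : 12 * N * η ≤ μ / 2 := by
    rw [hη, ← mul_div_assoc, div_le_iff₀ (by positivity)]
    nlinarith
  set ε' := min ε (min (η ^ 4) (μ / 6)) with hε'
  have hε'0 : 0 < ε' := by positivity
  have hε'1 : ε' ≤ ε := min_le_left _ _
  have hε'2 : ε' ≤ η ^ 4 := (min_le_right _ _).trans (min_le_left _ _)
  have hε'3 : ε' ≤ μ / 6 := (min_le_right _ _).trans (min_le_right _ _)
  obtain ⟨T, hT⟩ := exists_regular_partition ℕ ((Λ × Q × Q) ⊕ Λ) hε'0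
  refine ⟨T, fun V E hE hs1 hs2 => ?_⟩
  obtain ⟨a, q, Φ, hΦ⟩ := hQ V E hE
  let lab : ℕ → ℕ → Λ × Q × Q := fun x y => (a x y, q x y, q y x)
  obtain ⟨c, hc⟩ := hT V fun l x y => Sum.elim (fun p => lab x y = p) (fun p => a x y = p) l
  set B := badPairs ε' V (fun l x y => Sum.elim (fun p => lab x y = p) (fun p => a x y = p) l) c
    with hB
  have hgood : ∀ x ∈ V, ∀ y ∈ V, (x, y) ∉ B → ∀ p,
      RectReg (η ^ 4) (ind fun x y => lab x y = p) (cellOf V c (c x)) (cellOf V c (c y)) := by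
    intro x hx y hy hxy p
    by_contra hcon
    exact hxy (mem_badPairs.2 ⟨mem_product.2 ⟨hx, hy⟩, Sum.inl p,
      fun h => hcon (h.mono hε'2)⟩)
  obtain ⟨g, hg⟩ := exists_reduced_relation_partition c lab hη0.le badPairs_subset hgood Φ
  refine ⟨c, a, g, ?_, ?_⟩
  · refine le_trans ?_ (hc.trans (by gcongr))
    have : badPairs ε V (fun l x y => a x y = l) c ⊆ B := by
      intro p hp
      obtain ⟨hp, l, hl⟩ := mem_badPairs.1 hp
      exact mem_badPairs.2 ⟨hp, Sum.inr l, fun h => hl (h.mono hε'1)⟩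
    exact_mod_cast card_le_card this
  · have hΦ := (sum_ic_eq_card V fun x y z =>
      ¬ (E x y z ↔ Φ (a x y) (q x z) (q y z))).trans_le hΦ
    have e2 : ∑ x ∈ V, ∑ y ∈ V, ∑ z ∈ V, ic (¬ (E x y z ↔ Φ (a x z) (q x y) (q z y))) =
        ∑ x ∈ V, ∑ y ∈ V, ∑ z ∈ V, ic (¬ (E x y z ↔ Φ (a x y) (q x z) (q y z))) := by
      refine sum_congr rfl fun x _ => ?_
      rw [sum_comm]
      exact sum_congr rfl fun y _ => sum_congr rfl fun z _ => ic_congr (by rw [hs1])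
    have e3 : ∑ x ∈ V, ∑ y ∈ V, ∑ z ∈ V, ic (¬ (E x y z ↔ Φ (a y z) (q y x) (q z x))) =
        ∑ x ∈ V, ∑ y ∈ V, ∑ z ∈ V, ic (¬ (E x y z ↔ Φ (a x y) (q x z) (q y z))) := by
      rw [sum_comm]
      refine sum_congr rfl fun x _ => ?_
      rw [sum_comm]
      exact sum_congr rfl fun y _ => sum_congr rfl fun z _ => ic_congr (by rw [hs2])
    have t : ∀ F G K : ℕ → ℕ → ℕ → Prop,
        ∑ x ∈ V, ∑ y ∈ V, ∑ z ∈ V, ic (¬ (F x y z ↔ K x y z)) ≤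
        ∑ x ∈ V, ∑ y ∈ V, ∑ z ∈ V, ic (¬ (F x y z ↔ G x y z)) +
        ∑ x ∈ V, ∑ y ∈ V, ∑ z ∈ V, ic (¬ (G x y z ↔ K x y z)) := by
      intro F G K
      simp only [← sum_add_distrib]
      exact sum_le_sum fun x _ => sum_le_sum fun y _ => sum_le_sum fun z _ =>
        ic_ne_triangle _ _ _
    have t1 := t E (fun x y z => Φ (a x y) (q x z) (q y z))
      (fun x y z => g (c x) (c y) (c z) (a x y) (a x z) (a y z))
    have t2 := t (fun x y z => Φ (a x y) (q x z) (q y z)) E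
      (fun x y z => Φ (a x z) (q x y) (q z y))
    have t3 := t (fun x y z => Φ (a x y) (q x z) (q y z)) E
      (fun x y z => Φ (a y z) (q y x) (q z x))
    have hsymm : ∑ x ∈ V, ∑ y ∈ V, ∑ z ∈ V, ic (¬ (Φ (a x y) (q x z) (q y z) ↔ E x y z)) =
        ∑ x ∈ V, ∑ y ∈ V, ∑ z ∈ V, ic (¬ (E x y z ↔ Φ (a x y) (q x z) (q y z))) := by
      simp only [iff_comm]
    rw [hsymm, e2] at t2
    rw [hsymm, e3] at t3
    have hBc : 3 * (#B * #V : ℝ) ≤ μ / 2 * (#V : ℝ) ^ 3 := by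
      have h1 : (#B : ℝ) ≤ μ / 6 * (#V : ℝ) ^ 2 := hc.trans (by gcongr)
      have h2 := mul_le_mul_of_nonneg_right h1 (Nat.cast_nonneg (#V) : (0 : ℝ) ≤ #V)
      calc 3 * (#B * #V : ℝ) ≤ 3 * (μ / 6 * (#V : ℝ) ^ 2 * #V) := by linarith
        _ = _ := by ring
    have hNV : 12 * N * η * (#V : ℝ) ^ 3 ≤ μ / 2 * (#V : ℝ) ^ 3 := by gcongr
    simp only [lab] at hg
    linarith

lemma rectAvg_congr {α : Type} {f f' : α → α → ℝ} {X Y : Finset α}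
    (h : ∀ x ∈ X, ∀ y ∈ Y, f x y = f' x y) : rectAvg f X Y = rectAvg f' X Y := by
  unfold rectAvg
  rw [sum_congr rfl fun x hx => sum_congr rfl fun y hy => h x hx y hy]

lemma rectDev_congr {α : Type} {f f' : α → α → ℝ} {X Y : Finset α}
    (h : ∀ x ∈ X, ∀ y ∈ Y, f x y = f' x y) : rectDev f X Y = rectDev f' X Y := by
  unfold rectDev
  rw [rectAvg_congr h]
  refine sum_congr rfl fun x hx => sum_congr rfl fun x' hx' => sum_congr rfl fun y hy =>
    sum_congr rfl fun y' hy' => ?_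
  rw [h x hx y hy, h x hx y' hy', h x' hx' y hy, h x' hx' y' hy']

/-- Membership in a set of pairs, as a function. -/
noncomputable def memInd {α : Type} (S : Finset (α × α)) (x y : α) : ℝ :=
  ind (fun x y => (x, y) ∈ S) x y

lemma memInd_of {α : Type} {S : Finset (α × α)} {x y : α} (h : (x, y) ∈ S) : memInd S x y = 1 :=
  if_pos h

lemma memInd_not_of {α : Type} {S : Finset (α × α)} {x y : α} (h : (x, y) ∉ S) :
    memInd S x y = 0 := if_neg h

lemma Bigraph.density_eq (B : Bigraph) : B.density = rectAvg (memInd B.edges) B.left B.right := by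
  have h : B.edges = (B.left ×ˢ B.right).filter (· ∈ B.edges) := by
    rw [filter_mem_eq_inter, inter_eq_right.2 B.edges_sub]
  have h' : (#B.edges : ℝ) = ∑ x ∈ B.left, ∑ y ∈ B.right, memInd B.edges x y := by
    conv_lhs => rw [h]
    rw [card_filter, sum_product]
    push_cast
    refine sum_congr rfl fun x _ => sum_congr rfl fun y _ => ?_
    by_cases hxy : (x, y) ∈ B.edges <;> simp [memInd, ind, hxy]
  rw [Bigraph.density, rectAvg, h']

lemma Bigraph.gfun_eq (B : Bigraph) (x y : ℕ) :
    B.gfun x y = memInd B.edges x y - rectAvg (memInd B.edges) B.left B.right := by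
  rw [← B.density_eq]
  by_cases hxy : (x, y) ∈ B.edges <;> simp [memInd, ind, hxy, Bigraph.gfun]

lemma Bigraph.devSum_eq (B : Bigraph) : B.devSum = rectDev (memInd B.edges) B.left B.right := by
  simp only [Bigraph.devSum, rectDev, Bigraph.gfun_eq]

lemma Bigraph.dev2self_iff (B : Bigraph) {ε : ℝ} (hε : 0 ≤ ε) :
    B.dev2self ε ↔ RectReg ε (memInd B.edges) B.left B.right := by
  simp [Bigraph.dev2self, Bigraph.dev2, RectReg, Bigraph.devSum_eq, hε]

lemma sum_product₃ {α : Type} (X Y Z : Finset α) (F : α × α × α → ℝ) :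
    ∑ p ∈ X ×ˢ Y ×ˢ Z, F p = ∑ x ∈ X, ∑ y ∈ Y, ∑ z ∈ Z, F (x, y, z) := by
  simp only [sum_product]

lemma abs_hFun_le (R : Finset (ℕ × ℕ × ℕ)) (G : Triad) (x y z : ℕ) :
    |hFun R G x y z| ≤ memInd G.EXY x y * memInd G.EYZ y z * memInd G.EXZ x z := by
  by_cases h : (x, y, z) ∈ G.K3
  · have h' := h
    simp only [Triad.K3, mem_filter] at h'
    rw [memInd_of h'.2.1, memInd_of h'.2.2.1, memInd_of h'.2.2.2]
    have h0 : 0 ≤ relDensity R G := by unfold relDensity; positivity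
    have h1 : relDensity R G ≤ 1 := by
      unfold relDensity
      exact div_le_one_of_le₀ (by exact_mod_cast card_le_card inter_subset_right) (by positivity)
    unfold hFun
    rw [if_pos h, abs_le]
    split_ifs <;> constructor <;> linarith
  · rw [hFun, if_neg h, abs_zero]
    have n : ∀ (S : Finset (ℕ × ℕ)) x y, 0 ≤ memInd S x y := fun S x y => ind_nonneg _ x y
    exact mul_nonneg (mul_nonneg (n _ _ _) (n _ _ _)) (n _ _ _)

lemma sum_abs_hFun_le (R : Finset (ℕ × ℕ × ℕ)) (G : Triad) {ν : ℝ}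
    (h : (#(R ∩ G.K3) : ℝ) ≤ ν * #G.K3 ∨ (#(G.K3 \ R) : ℝ) ≤ ν * #G.K3) :
    ∑ x ∈ G.X, ∑ y ∈ G.Y, ∑ z ∈ G.Z, |hFun R G x y z| ≤ 2 * ν * #G.K3 := by
  have e : ∑ x ∈ G.X, ∑ y ∈ G.Y, ∑ z ∈ G.Z, |hFun R G x y z| =
      ∑ p ∈ G.K3, |hFun R G p.1 p.2.1 p.2.2| := by
    rw [← sum_product₃ G.X G.Y G.Z fun p => |hFun R G p.1 p.2.1 p.2.2|]
    refine (sum_subset (filter_subset _ _) fun p _ hp => ?_).symm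
    have hp' : (p.1, p.2.1, p.2.2) ∉ G.K3 := hp
    have : hFun R G p.1 p.2.1 p.2.2 = 0 := by rw [hFun, if_neg hp']
    rw [this, abs_zero]
  set d := relDensity R G with hd
  have h0 : 0 ≤ d := by rw [hd]; unfold relDensity; positivity
  have h1 : d ≤ 1 := by
    rw [hd]; unfold relDensity
    exact div_le_one_of_le₀ (by exact_mod_cast card_le_card inter_subset_right) (by positivity)
  have e2 : ∑ p ∈ G.K3, |hFun R G p.1 p.2.1 p.2.2| =
      #(R ∩ G.K3) * (1 - d) + #(G.K3 \ R) * d := by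
    rw [← sum_inter_add_sum_sdiff G.K3 R, inter_comm R]
    congr 1
    · rw [← nsmul_eq_mul, ← sum_const]
      refine sum_congr rfl fun p hp => ?_
      rw [mem_inter] at hp
      rw [hFun, if_pos hp.1, if_pos hp.2, abs_of_nonneg (by linarith)]
    · rw [← nsmul_eq_mul, ← sum_const]
      refine sum_congr rfl fun p hp => ?_
      rw [mem_sdiff] at hp
      rw [hFun, if_pos hp.1, if_neg hp.2, abs_neg, abs_of_nonneg h0]
  have hn : (#(R ∩ G.K3) : ℝ) + #(G.K3 \ R) = #G.K3 := by
    rw [inter_comm]; exact_mod_cast card_inter_add_card_sdiff G.K3 R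
  have hdn : d * #G.K3 = #(R ∩ G.K3) := by
    rcases G.K3.eq_empty_or_nonempty with h | h
    · simp [h]
    · have : (0 : ℝ) < #G.K3 := by exact_mod_cast h.card_pos
      rw [hd, relDensity]; field_simp
  have hd' : (1 - d) * #G.K3 = #(G.K3 \ R) := by linarith
  rw [e, e2]
  have hK : (0 : ℝ) ≤ #G.K3 := by positivity
  rcases h with h | h
  · have : (#(G.K3 \ R) : ℝ) * d = #(R ∩ G.K3) * (1 - d) := by rw [← hd', ← hdn]; ring
    rw [this]
    nlinarith [mul_nonneg (Nat.cast_nonneg (#(R ∩ G.K3)) : (0 : ℝ) ≤ _) h0]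
  · have : (#(R ∩ G.K3) : ℝ) * (1 - d) = #(G.K3 \ R) * d := by rw [← hd', ← hdn]; ring
    rw [this]
    nlinarith [mul_nonneg (Nat.cast_nonneg (#(G.K3 \ R)) : (0 : ℝ) ≤ _) (sub_nonneg.2 h1)]

lemma card_K3_le (G : Triad) {η : ℝ}
    (h₁ : CutLe η (fun x y => memInd G.EXY x y - rectAvg (memInd G.EXY) G.X G.Y) G.X G.Y)
    (h₂ : CutLe η (fun x y => memInd G.EXZ x y - rectAvg (memInd G.EXZ) G.X G.Z) G.X G.Z)
    (h₃ : CutLe η (fun x y => memInd G.EYZ x y - rectAvg (memInd G.EYZ) G.Y G.Z) G.Y G.Z) :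
    (#G.K3 : ℝ) ≤ (rectAvg (memInd G.EXY) G.X G.Y * rectAvg (memInd G.EXZ) G.X G.Z *
      rectAvg (memInd G.EYZ) G.Y G.Z + 3 * η) * (#G.X * #G.Y * #G.Z) := by
  have h := triangle_count G.X G.Y G.Z (memInd G.EXY) (memInd G.EXZ) (memInd G.EYZ)
      (rectAvg (memInd G.EXY) G.X G.Y) (rectAvg (memInd G.EXZ) G.X G.Z)
      (rectAvg (memInd G.EYZ) G.Y G.Z) η
      (fun x y => ⟨ind_nonneg _ x y, ind_le_one _ x y⟩)
      (fun x y => ⟨ind_nonneg _ x y, ind_le_one _ x y⟩)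
      (fun x y => ⟨ind_nonneg _ x y, ind_le_one _ x y⟩)
      ⟨rectAvg_nonneg _ _ _, rectAvg_le_one _ _ _⟩ ⟨rectAvg_nonneg _ _ _, rectAvg_le_one _ _ _⟩
      ⟨rectAvg_nonneg _ _ _, rectAvg_le_one _ _ _⟩ h₁ h₂ h₃
  have e : (#G.K3 : ℝ) = ∑ x ∈ G.X, ∑ y ∈ G.Y, ∑ z ∈ G.Z,
      memInd G.EXY x y * memInd G.EXZ x z * memInd G.EYZ y z := by
    rw [Triad.K3, card_filter]
    push_cast
    rw [sum_product₃]
    refine sum_congr rfl fun x _ => sum_congr rfl fun y _ => sum_congr rfl fun z _ => ?_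
    by_cases a1 : (x, y) ∈ G.EXY <;> by_cases a2 : (x, z) ∈ G.EXZ <;>
      by_cases a3 : (y, z) ∈ G.EYZ <;> simp [memInd, ind, a1, a2, a3]
  rw [e]
  have := (abs_le.1 h).2
  linarith

lemma abs_hFun_le_one (R : Finset (ℕ × ℕ × ℕ)) (G : Triad) (x y z : ℕ) : |hFun R G x y z| ≤ 1 := by
  refine (abs_hFun_le R G x y z).trans ?_
  have n : ∀ (S : Finset (ℕ × ℕ)) x y, 0 ≤ memInd S x y := fun S x y => ind_nonneg _ x y
  have o : ∀ (S : Finset (ℕ × ℕ)) x y, memInd S x y ≤ 1 := fun S x y => ind_le_one _ x y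
  exact mul_le_one₀ (mul_le_one₀ (o _ _ _) (n _ _ _) (o _ _ _)) (n _ _ _) (o _ _ _)

lemma prod_hFun_le (R : Finset (ℕ × ℕ × ℕ)) (G : Triad) (u₀ u₁ w₀ w₁ z₀ z₁ : ℕ) :
    hFun R G u₀ w₀ z₀ * hFun R G u₀ w₀ z₁ * hFun R G u₀ w₁ z₀ * hFun R G u₀ w₁ z₁ *
      hFun R G u₁ w₀ z₀ * hFun R G u₁ w₀ z₁ * hFun R G u₁ w₁ z₀ * hFun R G u₁ w₁ z₁ ≤
    |hFun R G u₀ w₀ z₀| * (memInd G.EXY u₀ w₁ * memInd G.EXY u₁ w₀ * memInd G.EXY u₁ w₁ *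
      memInd G.EXZ u₀ z₁ * memInd G.EXZ u₁ z₀ * memInd G.EXZ u₁ z₁ *
      memInd G.EYZ w₀ z₁ * memInd G.EYZ w₁ z₀ * memInd G.EYZ w₁ z₁) := by
  refine (le_abs_self _).trans ?_
  simp only [abs_mul]
  have n : ∀ (S : Finset (ℕ × ℕ)) x y, 0 ≤ memInd S x y := fun S x y => ind_nonneg _ x y
  have o := abs_hFun_le_one R G
  have p := fun x y z => abs_nonneg (hFun R G x y z)
  have t := abs_hFun_le R G
  calc _ = |hFun R G u₀ w₀ z₀| * ((|hFun R G u₀ w₁ z₁| * |hFun R G u₁ w₀ z₁| *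
        |hFun R G u₁ w₁ z₀|) * (|hFun R G u₀ w₀ z₁| * |hFun R G u₀ w₁ z₀| *
        |hFun R G u₁ w₀ z₀| * |hFun R G u₁ w₁ z₁|)) := by ring
    _ ≤ |hFun R G u₀ w₀ z₀| * (((memInd G.EXY u₀ w₁ * memInd G.EYZ w₁ z₁ * memInd G.EXZ u₀ z₁) *
        (memInd G.EXY u₁ w₀ * memInd G.EYZ w₀ z₁ * memInd G.EXZ u₁ z₁) *
        (memInd G.EXY u₁ w₁ * memInd G.EYZ w₁ z₀ * memInd G.EXZ u₁ z₀)) * (1 * 1 * 1 * 1)) := by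
        have m : ∀ {a b c d : ℝ}, 0 ≤ a → 0 ≤ c → a ≤ b → c ≤ d → a * c ≤ b * d :=
          fun ha hc hab hcd => mul_le_mul hab hcd hc (ha.trans hab)
        refine m (p _ _ _) ?_ le_rfl (m ?_ ?_
          (m ?_ (p _ _ _) (m (p _ _ _) (p _ _ _) (t _ _ _) (t _ _ _)) (t _ _ _))
          (m ?_ (p _ _ _) (m ?_ (p _ _ _) (m (p _ _ _) (p _ _ _) (o _ _ _) (o _ _ _))
            (o _ _ _)) (o _ _ _))) <;> positivity
    _ = _ := by ring

lemma octahedron (R : Finset (ℕ × ℕ × ℕ)) (G : Triad) {η : ℝ} {d₁ d₂ d₃ : ℝ}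
    (hd₁ : 0 ≤ d₁ ∧ d₁ ≤ 1) (hd₂ : 0 ≤ d₂ ∧ d₂ ≤ 1) (hd₃ : 0 ≤ d₃ ∧ d₃ ≤ 1)
    (h₁ : CutLe η (fun x y => memInd G.EXY x y - d₁) G.X G.Y)
    (h₂ : CutLe η (fun x y => memInd G.EXZ x y - d₂) G.X G.Z)
    (h₃ : CutLe η (fun x y => memInd G.EYZ x y - d₃) G.Y G.Z) :
    devSum3 R G ≤ (d₁ * d₂ * d₃) ^ 3 * ((#G.X * #G.Y * #G.Z) *
      ∑ x ∈ G.X, ∑ y ∈ G.Y, ∑ z ∈ G.Z, |hFun R G x y z|) +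
      9 * (η * (#G.X * #G.Y * #G.Z) ^ 2) := by
  have h := counting (I := Fin 6) ![G.X, G.X, G.Y, G.Y, G.Z, G.Z]
    (fun e => if e.1 < 2 then (if e.2 < 4 then memInd G.EXY else memInd G.EXZ) else memInd G.EYZ)
    (fun e => if e.1 < 2 then (if e.2 < 4 then d₁ else d₂) else d₃) (η := η)
    (fun x => |hFun R G (x 0) (x 2) (x 4)|)
    (by
      intro x _
      rw [abs_abs]; exact abs_hFun_le_one R G _ _ _)
    {(0, 3), (1, 2), (1, 3), (0, 5), (1, 4), (1, 5), (2, 5), (3, 4), (3, 5)} (by decide) (by decide)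
    (by intro e _ x y; split_ifs <;> exact ind_nonneg _ x y)
    (by intro e _ x y; split_ifs <;> exact ind_le_one _ x y)
    (by intro e _; split_ifs <;> simp [hd₁, hd₂, hd₃])
    (by intro e _; split_ifs <;> simp [hd₁, hd₂, hd₃])
    (by
      intro e he
      fin_cases he
      · simpa using h₁
      · simpa using h₁
      · simpa using h₁
      · simpa using h₂
      · simpa using h₂
      · simpa using h₂
      · simpa using h₃
      · simpa using h₃
      · simpa using h₃)
    (by
      intro e he
      have : ∀ (x : Fin 6 → ℕ) (i : Fin 6) (a : ℕ), i = 1 ∨ i = 3 ∨ i = 5 →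
          |hFun R G (Function.update x i a 0) (Function.update x i a 2)
            (Function.update x i a 4)| = |hFun R G (x 0) (x 2) (x 4)| := by
        rintro x i a (rfl | rfl | rfl) <;> simp
      have he' : (e.1 = 1 ∨ e.1 = 3 ∨ e.1 = 5) ∨ (e.2 = 1 ∨ e.2 = 3 ∨ e.2 = 5) := by
        revert e; decide
      exact he'.imp (fun h x a => this x _ a h) fun h x a => this x _ a h)
  simp only [sum_piFinset_succ] at h
  simp [Fin.prod_univ_succ] at h
  have h' : |∑ u₀ ∈ G.X, ∑ u₁ ∈ G.X, ∑ w₀ ∈ G.Y, ∑ w₁ ∈ G.Y, ∑ z₀ ∈ G.Z, ∑ z₁ ∈ G.Z,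
        |hFun R G u₀ w₀ z₀| * (memInd G.EXY u₀ w₁ * (memInd G.EXY u₁ w₀ * (memInd G.EXY u₁ w₁ *
          (memInd G.EXZ u₀ z₁ * (memInd G.EXZ u₁ z₀ * (memInd G.EXZ u₁ z₁ *
          (memInd G.EYZ w₀ z₁ * (memInd G.EYZ w₁ z₀ * memInd G.EYZ w₁ z₁)))))))) -
        d₁ * (d₁ * (d₁ * (d₂ * (d₂ * (d₂ * (d₃ * (d₃ * d₃))))))) *
        ∑ u₀ ∈ G.X, ∑ u₁ ∈ G.X, ∑ w₀ ∈ G.Y, ∑ w₁ ∈ G.Y, ∑ z₀ ∈ G.Z, ∑ z₁ ∈ G.Z,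
          (|hFun R G u₀ w₀ z₀|)| ≤
      9 * (η * (#G.X * (#G.X * (#G.Y * (#G.Y * (#G.Z * #G.Z)))))) := h
  have e : ∑ u₀ ∈ G.X, ∑ u₁ ∈ G.X, ∑ w₀ ∈ G.Y, ∑ w₁ ∈ G.Y, ∑ z₀ ∈ G.Z, ∑ z₁ ∈ G.Z,
      |hFun R G u₀ w₀ z₀| = (#G.X * #G.Y * #G.Z : ℝ) *
      ∑ x ∈ G.X, ∑ y ∈ G.Y, ∑ z ∈ G.Z, |hFun R G x y z| := by
    simp only [sum_const, nsmul_eq_mul, mul_sum]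
    refine sum_congr rfl fun x _ => sum_congr rfl fun y _ => sum_congr rfl fun z _ => by ring
  rw [e] at h'
  have le : devSum3 R G ≤ _ := sum_le_sum fun u₀ _ => sum_le_sum fun u₁ _ => sum_le_sum fun w₀ _ =>
    sum_le_sum fun w₁ _ => sum_le_sum fun z₀ _ => sum_le_sum fun z₁ _ =>
      prod_hFun_le R G u₀ u₁ w₀ w₁ z₀ z₁
  simp only [mul_assoc] at le h' ⊢
  have := (abs_le.1 h').2
  refine le.trans ?_
  nlinarith [this]

lemma Bigraph.density_mem (B : Bigraph) : 0 ≤ B.density ∧ B.density ≤ 1 := by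
  rw [B.density_eq]
  exact ⟨rectAvg_nonneg _ _ _, rectAvg_le_one _ _ _⟩

lemma Bigraph.cutLe (B : Bigraph) {η : ℝ} (hη : 0 ≤ η) (h : B.dev2self (η ^ 4)) :
    CutLe η (fun x y => memInd B.edges x y - B.density) B.left B.right := by
  rw [B.density_eq]
  exact RectReg.cutLe hη ((B.dev2self_iff (by positivity)).1 h)

/-- Dense regular triads on which the relation is nearly homogeneous are `dev_{2,3}`-regular. -/
lemma dev23_of_homogeneous (R : Finset (ℕ × ℕ × ℕ)) (G : Triad) {ε₁ ε₂ η τ ν : ℝ}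
    (hη : 0 ≤ η) (hτ : 0 < τ) (hν : 0 ≤ ν) (hν' : 4 * ν ≤ ε₁)
    (hητ : 2 * (6 * ν + 9) * η ≤ ε₁ * τ ^ 12)
    (h₁ : G.bXY.dev2self (η ^ 4)) (h₂ : G.bXZ.dev2self (η ^ 4)) (h₃ : G.bYZ.dev2self (η ^ 4))
    (k₁ : G.bXY.dev2self ε₂) (k₂ : G.bXZ.dev2self ε₂) (k₃ : G.bYZ.dev2self ε₂)
    (t₁ : τ ≤ G.bXY.density) (t₂ : τ ≤ G.bXZ.density) (t₃ : τ ≤ G.bYZ.density)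
    (hom : (#(R ∩ G.K3) : ℝ) ≤ ν * #G.K3 ∨ (#(G.K3 \ R) : ℝ) ≤ ν * #G.K3) :
    dev23 R G ε₁ ε₂ := by
  refine ⟨_, _, _, hτ.trans_le t₁, hτ.trans_le t₃, hτ.trans_le t₂, k₁, k₂, k₃, ?_⟩
  have c₁ := G.bXY.cutLe hη h₁
  have c₂ := G.bXZ.cutLe hη h₂
  have c₃ := G.bYZ.cutLe hη h₃
  have o := octahedron R G G.bXY.density_mem G.bXZ.density_mem G.bYZ.density_mem c₁ c₂ c₃
  have s := sum_abs_hFun_le R G hom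
  have e₁ := G.bXY.density_eq
  have e₂ := G.bXZ.density_eq
  have e₃ := G.bYZ.density_eq
  have m₁ := G.bXY.density_mem
  have m₂ := G.bXZ.density_mem
  have m₃ := G.bYZ.density_mem
  rw [e₁] at c₁
  rw [e₂] at c₂
  rw [e₃] at c₃
  have k := card_K3_le G c₁ c₂ c₃
  change (#G.K3 : ℝ) ≤ (rectAvg (memInd G.bXY.edges) G.bXY.left G.bXY.right *
    rectAvg (memInd G.bXZ.edges) G.bXZ.left G.bXZ.right *
    rectAvg (memInd G.bYZ.edges) G.bYZ.left G.bYZ.right + 3 * η) * _ at k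
  rw [← e₁, ← e₂, ← e₃] at k
  set a := G.bXY.density
  set b := G.bXZ.density
  set c := G.bYZ.density
  set M : ℝ := #G.X * #G.Y * #G.Z
  have hM : 0 ≤ M := by positivity
  have hD : τ ^ 3 ≤ a * b * c := by
    calc τ ^ 3 = τ * τ * τ := by ring
      _ ≤ a * b * c := by
        have hτ0 := hτ.le
        gcongr
        exacts [mul_nonneg m₁.1 m₂.1, m₁.1]
  have hD1 : a * b * c ≤ 1 := mul_le_one₀ (mul_le_one₀ m₁.2 m₂.1 m₂.2) m₃.1 m₃.2
  set D := a * b * c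
  have hD0 : 0 ≤ D := (by positivity : (0 : ℝ) ≤ τ ^ 3).trans hD
  have hD12 : τ ^ 12 ≤ D ^ 4 := by
    calc τ ^ 12 = (τ ^ 3) ^ 4 := by ring
      _ ≤ D ^ 4 := by gcongr
  have hε : 0 ≤ ε₁ := by linarith
  have s' : M * ∑ x ∈ G.X, ∑ y ∈ G.Y, ∑ z ∈ G.Z, |hFun R G x y z| ≤
      2 * ν * (D + 3 * η) * M ^ 2 := by
    calc _ ≤ M * (2 * ν * ((D + 3 * η) * M)) := by
          refine mul_le_mul_of_nonneg_left (s.trans ?_) hM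
          exact mul_le_mul_of_nonneg_left k (by positivity)
      _ = _ := by ring
  have f : D ^ 3 * (2 * ν * (D + 3 * η)) + 9 * η ≤ ε₁ * D ^ 4 := by
    have : D ^ 3 * (6 * ν * η) ≤ 1 * (6 * ν * η) := by
      gcongr
      exact pow_le_one₀ hD0 hD1
    have h4 : 0 ≤ D ^ 4 := by positivity
    nlinarith [mul_le_mul_of_nonneg_left hD12 hε, mul_le_mul_of_nonneg_right hν' h4]
  calc devSum3 R G ≤ _ := o
    _ ≤ D ^ 3 * (2 * ν * (D + 3 * η) * M ^ 2) + 9 * (η * M ^ 2) := by gcongr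
    _ = (D ^ 3 * (2 * ν * (D + 3 * η)) + 9 * η) * M ^ 2 := by ring
    _ ≤ ε₁ * D ^ 4 * M ^ 2 := by gcongr
    _ = _ := by simp only [D, M]; ring

/-- The decomposition given by a colouring of the vertices and a colouring of the pairs. -/
noncomputable def decompOf (V : Finset ℕ) {ι κ : Type} (c : ℕ → ι) (a : ℕ → ℕ → κ) :
    Decomp V ι κ where
  part i := cellOf V c i
  part_sub _ := cellOf_subset
  part_disj _ _ hij := disjoint_left.2 fun _ hx hx' =>
    hij ((mem_cellOf.1 hx).2.symm.trans (mem_cellOf.1 hx').2)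
  part_cover x hx := ⟨c x, mem_cellOf.2 ⟨hx, rfl⟩⟩
  pairs i j l := (cellOf V c i ×ˢ cellOf V c j).filter fun p => a p.1 p.2 = l
  pairs_sub _ _ _ := filter_subset _ _
  pairs_disj _ _ _ _ hl := disjoint_left.2 fun _ hp hp' =>
    hl ((mem_filter.1 hp).2.symm.trans (mem_filter.1 hp').2)
  pairs_cover _ _ p hp := ⟨a p.1 p.2, mem_filter.2 ⟨hp, rfl⟩⟩

section
variable {V : Finset ℕ} {ι κ : Type} {c : ℕ → ι} {a : ℕ → ℕ → κ}

lemma mem_pairs_decompOf {i j : ι} {l : κ} {x y : ℕ} :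
    (x, y) ∈ (decompOf V c a).pairs i j l ↔
      x ∈ cellOf V c i ∧ y ∈ cellOf V c j ∧ a x y = l := by
  simp only [decompOf, mem_filter, mem_product, and_assoc]

lemma K3_decompOf (i j k : ι) (α β γ : κ) :
    ((decompOf V c a).triadOf i j k α β γ).K3 = (V ×ˢ V ×ˢ V).filter fun p =>
      (c p.1, c p.2.1, c p.2.2, a p.1 p.2.1, a p.1 p.2.2, a p.2.1 p.2.2) = (i, j, k, α, β, γ) := by
  ext ⟨x, y, z⟩
  simp only [Triad.K3, Decomp.triadOf, mem_filter, mem_product, mem_pairs_decompOf, Prod.mk.injEq]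
  simp only [decompOf, mem_cellOf]
  tauto

lemma memInd_pairBG_decompOf {i j : ι} {x y : ℕ} (hx : x ∈ cellOf V c i) (hy : y ∈ cellOf V c j)
    (l : κ) : memInd ((decompOf V c a).pairBG i j l).edges x y =
      ind (fun x y => a x y = l) x y := by
  by_cases hl : a x y = l
  · have : (x, y) ∈ ((decompOf V c a).pairBG i j l).edges := mem_pairs_decompOf.2 ⟨hx, hy, hl⟩
    rw [memInd_of this]; simp [ind, hl]
  · have : (x, y) ∉ ((decompOf V c a).pairBG i j l).edges :=
      fun h => hl (mem_pairs_decompOf.1 h).2.2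
    rw [memInd_not_of this]; simp [ind, hl]

lemma dev2self_decompOf {ε ε' : ℝ} (hε : 0 ≤ ε) (hε' : ε ≤ ε') {x y : ℕ} (hx : x ∈ V) (hy : y ∈ V)
    (h : (x, y) ∉ badPairs ε V (fun l x y => a x y = l) c) (l : κ) :
    ((decompOf V c a).pairBG (c x) (c y) l).dev2self ε' := by
  rw [Bigraph.dev2self_iff _ (hε.trans hε')]
  have h' : RectReg ε (ind fun x y => a x y = l) (cellOf V c (c x)) (cellOf V c (c y)) := by
    by_contra hcon
    exact h (mem_badPairs.2 ⟨mem_product.2 ⟨hx, hy⟩, l, hcon⟩)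
  have h2 := h'.mono hε'
  unfold RectReg at h2 ⊢
  refine le_of_eq_of_le (rectDev_congr fun u hu w hw => memInd_pairBG_decompOf hu hw l) h2

lemma isReg_decompOf {ε ε₁ ε' : ℝ} (hε : 0 ≤ ε) (hε' : ε ≤ ε') (hε₁ : ε ≤ ε₁)
    (h : (#(badPairs ε V (fun l x y => a x y = l) c) : ℝ) ≤ ε * #V ^ 2) :
    (decompOf V c a).isReg ε₁ ε' := by
  unfold Decomp.isReg
  have hsub : (V ×ˢ V) \ badPairs ε V (fun l x y => a x y = l) c ⊆ (V ×ˢ V).filter fun p =>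
      ∃ i j α, p ∈ (decompOf V c a).pairs i j α ∧
        ((decompOf V c a).pairBG i j α).dev2self ε' := by
    rintro ⟨x, y⟩ hp
    rw [mem_sdiff, mem_product] at hp
    refine mem_filter.2 ⟨mem_product.2 hp.1, c x, c y, a x y, mem_pairs_decompOf.2
      ⟨mem_cellOf.2 ⟨hp.1.1, rfl⟩, mem_cellOf.2 ⟨hp.1.2, rfl⟩, rfl⟩,
      dev2self_decompOf hε hε' hp.1.1 hp.1.2 hp.2 _⟩
  have h1 : (#((V ×ˢ V) \ badPairs ε V (fun l x y => a x y = l) c) : ℝ) =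
      #V ^ 2 - #(badPairs ε V (fun l x y => a x y = l) c) := by
    rw [cast_card_sdiff badPairs_subset, card_product]; push_cast; ring
  have h2 : (0 : ℝ) ≤ #V ^ 2 := by positivity
  refine le_trans ?_ (Nat.cast_le.2 (card_le_card hsub))
  rw [h1]
  nlinarith

lemma sum_ic_light_le [Fintype ι] [Fintype κ] (τ : ℝ) (hτ : 0 ≤ τ) :
    ∑ x ∈ V, ∑ y ∈ V, ic (((decompOf V c a).pairBG (c x) (c y) (a x y)).density < τ) ≤
      Fintype.card κ * τ * #V ^ 2 := by
  have key : ∀ i j, ∑ x ∈ cellOf V c i, ∑ y ∈ cellOf V c j,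
      ic (((decompOf V c a).pairBG (c x) (c y) (a x y)).density < τ) ≤
      ∑ x ∈ cellOf V c i, ∑ y ∈ cellOf V c j, Fintype.card κ * τ := by
    intro i j
    calc _ = ∑ x ∈ cellOf V c i, ∑ y ∈ cellOf V c j,
          ∑ l, ic (((decompOf V c a).pairBG i j l).density < τ) *
            memInd ((decompOf V c a).pairBG i j l).edges x y := by
          refine sum_congr rfl fun x hx => sum_congr rfl fun y hy => ?_
          rw [(mem_cellOf.1 hx).2, (mem_cellOf.1 hy).2, sum_eq_single (a x y)]
          · rw [memInd_pairBG_decompOf hx hy]; simp [ind]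
          · intro l _ hl
            rw [memInd_pairBG_decompOf hx hy]; simp [ind, hl.symm]
          · simp
      _ = ∑ l, ic (((decompOf V c a).pairBG i j l).density < τ) *
          ∑ x ∈ cellOf V c i, ∑ y ∈ cellOf V c j,
            memInd ((decompOf V c a).pairBG i j l).edges x y := by
          simp only [mul_sum]
          exact (sum_congr rfl fun x _ => sum_comm).trans sum_comm
      _ ≤ ∑ l : κ, τ * (#(cellOf V c i) * #(cellOf V c j)) := by
          refine sum_le_sum fun l _ => ?_
          have e := ((decompOf V c a).pairBG i j l).density_eq
          rw [sum_eq_card_mul_rectAvg]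
          change _ = rectAvg _ (cellOf V c i) (cellOf V c j) at e
          rw [← e]
          by_cases h : ((decompOf V c a).pairBG i j l).density < τ
          · rw [ic_of h, one_mul, mul_comm]
            exact mul_le_mul_of_nonneg_right h.le (by positivity)
          · rw [ic_not_of h, zero_mul]; positivity
      _ = _ := by simp; ring
  calc _ = _ := sum_sum_cells V c _
    _ ≤ _ := sum_le_sum fun i _ => sum_le_sum fun j _ => key i j
    _ = ∑ x ∈ V, ∑ y ∈ V, Fintype.card κ * τ := (sum_sum_cells V c _).symm
    _ = _ := by simp; ring

lemma sum_ic_inhomogeneous_le [Fintype ι] [Fintype κ] (R : Finset (ℕ × ℕ × ℕ)) (ν : ℝ)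
    (g : ι → ι → ι → κ → κ → κ → Prop) :
    ν * ∑ x ∈ V, ∑ y ∈ V, ∑ z ∈ V, ic (¬ ((#(R ∩ ((decompOf V c a).triadOf (c x) (c y) (c z)
        (a x y) (a x z) (a y z)).K3) : ℝ) ≤
          ν * #((decompOf V c a).triadOf (c x) (c y) (c z) (a x y) (a x z) (a y z)).K3 ∨
        (#(((decompOf V c a).triadOf (c x) (c y) (c z) (a x y) (a x z) (a y z)).K3 \ R) : ℝ) ≤
          ν * #((decompOf V c a).triadOf (c x) (c y) (c z) (a x y) (a x z) (a y z)).K3)) ≤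
    ∑ x ∈ V, ∑ y ∈ V, ∑ z ∈ V, ic (¬ ((x, y, z) ∈ R ↔
      g (c x) (c y) (c z) (a x y) (a x z) (a y z))) := by
  set key : ℕ × ℕ × ℕ → ι × ι × ι × κ × κ × κ := fun p =>
    (c p.1, c p.2.1, c p.2.2, a p.1 p.2.1, a p.1 p.2.2, a p.2.1 p.2.2) with hkey
  set K : ι × ι × ι × κ × κ × κ → Finset (ℕ × ℕ × ℕ) := fun q =>
    ((decompOf V c a).triadOf q.1 q.2.1 q.2.2.1 q.2.2.2.1 q.2.2.2.2.1 q.2.2.2.2.2).K3 with hK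
  have hKf : ∀ q, K q = (V ×ˢ V ×ˢ V).filter fun p => key p = q := fun q => K3_decompOf _ _ _ _ _ _
  set bad : ι × ι × ι × κ × κ × κ → Prop := fun q =>
    ¬ ((#(R ∩ K q) : ℝ) ≤ ν * #(K q) ∨ (#(K q \ R) : ℝ) ≤ ν * #(K q)) with hbad
  set g' : ι × ι × ι × κ × κ × κ → Prop := fun q =>
    g q.1 q.2.1 q.2.2.1 q.2.2.2.1 q.2.2.2.2.1 q.2.2.2.2.2 with hg'
  have e1 := sum_product₃ V V V fun p => ic (bad (key p))
  have e2 := sum_product₃ V V V fun p => ic (¬ (p ∈ R ↔ g' (key p)))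
  have main : ν * ∑ p ∈ V ×ˢ V ×ˢ V, ic (bad (key p)) ≤
      ∑ p ∈ V ×ˢ V ×ˢ V, ic (¬ (p ∈ R ↔ g' (key p))) := by
    rw [← sum_fiberwise (V ×ˢ V ×ˢ V) key fun p => ic (bad (key p)),
      ← sum_fiberwise (V ×ˢ V ×ˢ V) key fun p => ic (¬ (p ∈ R ↔ g' (key p))), mul_sum]
    refine sum_le_sum fun q _ => ?_
    have f1 : ∑ p ∈ V ×ˢ V ×ˢ V with key p = q, ic (bad (key p)) = #(K q) * ic (bad q) := by
      rw [hKf, ← nsmul_eq_mul, ← sum_const]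
      exact sum_congr rfl fun p hp => by rw [(mem_filter.1 hp).2]
    have f2 : ∑ p ∈ V ×ˢ V ×ˢ V with key p = q, ic (¬ (p ∈ R ↔ g' (key p))) =
        ∑ p ∈ K q, ic (¬ (p ∈ R ↔ g' q)) := by
      rw [hKf]
      exact sum_congr rfl fun p hp => by rw [(mem_filter.1 hp).2]
    rw [f1, f2]
    have f3 : 0 ≤ ∑ p ∈ K q, ic (¬ (p ∈ R ↔ g' q)) := sum_nonneg fun _ _ => ic_nonneg _
    by_cases hb : bad q
    · rw [ic_of hb, mul_one]
      simp only [hbad, not_or, not_le] at hb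
      have f4 : ∑ p ∈ K q, ic (¬ (p ∈ R ↔ g' q)) =
          if g' q then (#(K q \ R) : ℝ) else #(R ∩ K q) := by
        split_ifs with hq
        · rw [sdiff_eq_filter, card_filter]
          push_cast
          refine sum_congr rfl fun p _ => ?_
          by_cases hp : p ∈ R <;> simp [ic, hp, hq]
        · rw [inter_comm, ← filter_mem_eq_inter, card_filter]
          push_cast
          refine sum_congr rfl fun p _ => ?_
          by_cases hp : p ∈ R <;> simp [ic, hp, hq]
      rw [f4]
      split_ifs
      · exact hb.2.le
      · exact hb.1.le
    · rw [ic_not_of hb, mul_zero, mul_zero]; exact f3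
  rw [e1, e2] at main
  exact main

end

lemma card_sub_card_good_le {V : Finset ℕ} (good : ℕ × ℕ × ℕ → Prop)
    [DecidablePred fun p : ℕ × ℕ × ℕ => good (p.1, p.2.1, p.2.2)] (B light : ℕ → ℕ → Prop)
    (inh : ℕ → ℕ → ℕ → Prop)
    (point : ∀ x ∈ V, ∀ y ∈ V, ∀ z ∈ V, ¬ B x y → ¬ B x z → ¬ B y z → ¬ light x y → ¬ light x z →
      ¬ light y z → ¬ inh x y z → good (x, y, z)) :
    (#V : ℝ) ^ 3 - #((V ×ˢ V ×ˢ V).filter fun p => good (p.1, p.2.1, p.2.2)) ≤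
      3 * (#V * ∑ x ∈ V, ∑ y ∈ V, ic (B x y)) + 3 * (#V * ∑ x ∈ V, ∑ y ∈ V, ic (light x y)) +
        ∑ x ∈ V, ∑ y ∈ V, ∑ z ∈ V, ic (inh x y z) := by
  have point' : ∀ x ∈ V, ∀ y ∈ V, ∀ z ∈ V, 1 - ic (good (x, y, z)) ≤
      ic (B x y) + ic (B x z) + ic (B y z) +
      (ic (light x y) + ic (light x z) + ic (light y z)) + ic (inh x y z) := by
    intro x hx y hy z hz
    have n := ic_nonneg
    by_cases h1 : B x y
    · rw [ic_of h1]; linarith [n (B x z), n (B y z), n (light x y), n (light x z),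
        n (light y z), n (inh x y z), n (good (x, y, z))]
    by_cases h2 : B x z
    · rw [ic_of h2]; linarith [n (B x y), n (B y z), n (light x y), n (light x z),
        n (light y z), n (inh x y z), n (good (x, y, z))]
    by_cases h3 : B y z
    · rw [ic_of h3]; linarith [n (B x y), n (B x z), n (light x y), n (light x z),
        n (light y z), n (inh x y z), n (good (x, y, z))]
    by_cases h4 : light x y
    · rw [ic_of h4]; linarith [n (B x y), n (B x z), n (B y z), n (light x z),
        n (light y z), n (inh x y z), n (good (x, y, z))]
    by_cases h5 : light x z
    · rw [ic_of h5]; linarith [n (B x y), n (B x z), n (B y z), n (light x y),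
        n (light y z), n (inh x y z), n (good (x, y, z))]
    by_cases h6 : light y z
    · rw [ic_of h6]; linarith [n (B x y), n (B x z), n (B y z), n (light x y),
        n (light x z), n (inh x y z), n (good (x, y, z))]
    by_cases h7 : inh x y z
    · rw [ic_of h7]; linarith [n (B x y), n (B x z), n (B y z), n (light x y),
        n (light x z), n (light y z), n (good (x, y, z))]
    rw [ic_of (point x hx y hy z hz h1 h2 h3 h4 h5 h6 h7)]
    linarith [n (B x y), n (B x z), n (B y z), n (light x y), n (light x z),
        n (light y z), n (inh x y z)]
  have tot := sum_le_sum fun x hx => sum_le_sum fun y hy => sum_le_sum fun z hz =>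
    point' x hx y hy z hz
  have one : ∑ x ∈ V, ∑ y ∈ V, ∑ z ∈ V, (1 : ℝ) = #V ^ 3 := by simp; ring
  have r1 : ∀ F : ℕ → ℕ → ℝ, ∑ x ∈ V, ∑ y ∈ V, ∑ z ∈ V, F x y =
      #V * ∑ x ∈ V, ∑ y ∈ V, F x y := fun F => by
    simp only [sum_const, nsmul_eq_mul, mul_sum]
  have r2 : ∀ F : ℕ → ℕ → ℝ, ∑ x ∈ V, ∑ y ∈ V, ∑ z ∈ V, F x z =
      #V * ∑ x ∈ V, ∑ y ∈ V, F x y := fun F => by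
    simp only [sum_const, nsmul_eq_mul, mul_sum]
  have r3 : ∀ F : ℕ → ℕ → ℝ, ∑ x ∈ V, ∑ y ∈ V, ∑ z ∈ V, F y z =
      #V * ∑ x ∈ V, ∑ y ∈ V, F x y := fun F => by
    simp only [sum_const, nsmul_eq_mul]
  simp only [sum_add_distrib, sum_sub_distrib] at tot
  rw [r1 fun x y => ic (B x y), r2 fun x y => ic (B x y),
    r3 fun x y => ic (B x y), r1 fun x y => ic (light x y), r2 fun x y => ic (light x y),
    r3 fun x y => ic (light x y), one, sum_ic_eq_card V fun x y z => good (x, y, z)] at tot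
  linarith

lemma regWrt_decompOf {V : Finset ℕ} {ι κ : Type} [Fintype ι] [Fintype κ] {c : ℕ → ι}
    {a : ℕ → ℕ → κ} (R : Finset (ℕ × ℕ × ℕ)) (g : ι → ι → ι → κ → κ → κ → Prop)
    {ε ε₁ ε₂ η τ ν m : ℝ} (hε : 0 ≤ ε) (hη : 0 ≤ η) (hτ : 0 < τ) (hν : 0 < ν) (hν' : 4 * ν ≤ ε₁)
    (hητ : 2 * (6 * ν + 9) * η ≤ ε₁ * τ ^ 12) (hε₂ : ε ≤ ε₂) (hεη : ε ≤ η ^ 4)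
    (hbad : (#(badPairs ε V (fun l x y => a x y = l) c) : ℝ) ≤ ε * #V ^ 2)
    (hg : ∑ x ∈ V, ∑ y ∈ V, ∑ z ∈ V, ic (¬ ((x, y, z) ∈ R ↔
      g (c x) (c y) (c z) (a x y) (a x z) (a y z))) ≤ m * #V ^ 3)
    (hsum : 3 * ε + 3 * (Fintype.card κ * τ) + m / ν ≤ ε₁) :
    (decompOf V c a).regWrt R ε₁ ε₂ := by
  have hN : (0 : ℝ) ≤ #V := Nat.cast_nonneg _
  have hN3 : (0 : ℝ) ≤ #V ^ 3 := pow_nonneg hN 3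
  set P := decompOf V c a with hP
  set T : ℕ → ℕ → ℕ → Triad := fun x y z =>
    P.triadOf (c x) (c y) (c z) (a x y) (a x z) (a y z) with hT
  set good : ℕ × ℕ × ℕ → Prop := fun p => ∃ i j k α β γ, p ∈ (P.triadOf i j k α β γ).K3 ∧
    dev23 R (P.triadOf i j k α β γ) ε₁ ε₂ with hgood
  set B := badPairs ε V (fun l x y => a x y = l) c with hB
  set light : ℕ → ℕ → Prop := fun x y => (P.pairBG (c x) (c y) (a x y)).density < τ with hlight
  set inh : ℕ → ℕ → ℕ → Prop := fun x y z => ¬ ((#(R ∩ (T x y z).K3) : ℝ) ≤ ν * #(T x y z).K3 ∨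
    (#((T x y z).K3 \ R) : ℝ) ≤ ν * #(T x y z).K3) with hinh
  have tot := card_sub_card_good_le (V := V) good (fun x y => (x, y) ∈ B) light inh (by
    intro x hx y hy z hz h1 h2 h3 h4 h5 h6 h7
    refine ⟨c x, c y, c z, a x y, a x z, a y z, ?_, ?_⟩
    · rw [hP, K3_decompOf]
      exact mem_filter.2 ⟨mem_product.2 ⟨hx, mem_product.2 ⟨hy, hz⟩⟩, rfl⟩
    · refine dev23_of_homogeneous R _ (τ := τ) (ν := ν) hη hτ hν.le hν' hητ
        (dev2self_decompOf hε hεη hx hy h1 _) (dev2self_decompOf hε hεη hx hz h2 _)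
        (dev2self_decompOf hε hεη hy hz h3 _) (dev2self_decompOf hε hε₂ hx hy h1 _)
        (dev2self_decompOf hε hε₂ hx hz h2 _) (dev2self_decompOf hε hε₂ hy hz h3 _)
        (not_lt.1 h4) (not_lt.1 h5) (not_lt.1 h6) (not_not.1 h7))
  have hBs : ∑ x ∈ V, ∑ y ∈ V, ic ((x, y) ∈ B) = #B := sum_ic_mem badPairs_subset
  have hL : ∑ x ∈ V, ∑ y ∈ V, ic (light x y) ≤ Fintype.card κ * τ * #V ^ 2 :=
    sum_ic_light_le τ hτ.le
  have hI : ν * ∑ x ∈ V, ∑ y ∈ V, ∑ z ∈ V, ic (inh x y z) ≤ _ := sum_ic_inhomogeneous_le R ν g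
  have hI' : ∑ x ∈ V, ∑ y ∈ V, ∑ z ∈ V, ic (inh x y z) ≤ m / ν * #V ^ 3 := by
    rw [div_mul_eq_mul_div, le_div_iff₀ hν, mul_comm]
    exact hI.trans hg
  unfold Decomp.regWrt
  have fin : (1 - ε₁) * (#V : ℝ) ^ 3 ≤
      #((V ×ˢ V ×ˢ V).filter fun p => good (p.1, p.2.1, p.2.2)) := by
    have s1 := mul_le_mul_of_nonneg_left hbad hN
    have s2 := mul_le_mul_of_nonneg_left hL hN
    have s3 := mul_le_mul_of_nonneg_right hsum hN3
    have s4 : (#V : ℝ) ^ 3 = #V * #V ^ 2 := by ring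
    have s5 : (3 * ε + 3 * (Fintype.card κ * τ) + m / ν) * #V ^ 3 =
      3 * (#V * (ε * #V ^ 2)) + 3 * (#V * (Fintype.card κ * τ * #V ^ 2)) + m / ν * #V ^ 3 := by ring
    rw [hBs] at tot
    linarith
  convert fin

lemma ThreeGraph.noShatter {H : ThreeGraph} {k : ℕ} (h : ∀ k' : ℕ, H.VC2AtLeast k' → k' ≤ k) :
    NoShatter (k + 1) H.verts fun x y z => ({x, y, z} : Finset ℕ) ∈ H.edges := by
  intro a b c ha hb hc hcon
  have := h (k + 1) ⟨a, b, c, ha, hb, hc, fun i j S => by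
    rw [← hcon i j S]
    have : ({a i, b j, c S} : Finset ℕ) = {c S, b j, a i} := by
      ext; simp only [mem_insert, mem_singleton]; tauto
    rw [this]⟩
  omega

lemma exists_psi {ℋ : Set ThreeGraph} {k : ℕ} (hVC : ∀ H ∈ ℋ, ∀ k' : ℕ, H.VC2AtLeast k' → k' ≤ k)
    (j : ℕ) {ε₁ : ℝ} {ε₂ : ℕ → ℝ} (h₁ : 0 < ε₁) (h₂ : ∀ x, 0 < ε₂ x)
    (hj : (2 * k + 8) / 2 ^ j ≤ ε₁ ^ 2 / 64) :
    ∃ T : ℕ, 1 ≤ T ∧ psi ε₁ ε₂ T ((4 ^ j + 1) ^ k + 1) ℋ := by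
  set ℓ := (4 ^ j + 1) ^ k + 1 with hℓ
  have hℓ0 : (0 : ℝ) < ℓ := by rw [hℓ]; positivity
  set τ : ℝ := ε₁ / (12 * ℓ) with hτ
  have hτ0 : 0 < τ := by positivity
  set ν : ℝ := ε₁ / 4 with hν
  have hν0 : 0 < ν := by positivity
  set η : ℝ := ε₁ * τ ^ 12 / (2 * (6 * ν + 9)) with hη
  have hη0 : 0 < η := by positivity
  set ε : ℝ := min (ε₁ / 12) (min (ε₂ ℓ) (η ^ 4)) with hε
  have hε0 : 0 < ε := lt_min (by positivity) (lt_min (h₂ _) (by positivity))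
  have e1 : ε ≤ ε₁ / 12 := min_le_left _ _
  have e2 : ε ≤ ε₂ ℓ := (min_le_right _ _).trans (min_le_left _ _)
  have e3 : ε ≤ η ^ 4 := (min_le_right _ _).trans (min_le_right _ _)
  obtain ⟨T, hT⟩ := exists_regular_approx k j hε0
  refine ⟨max T 1, le_max_right _ _, 0, fun H hH _ => ?_⟩
  obtain ⟨c, a, g, hbad, hg⟩ := hT H.verts (fun x y z => ({x, y, z} : Finset ℕ) ∈ H.edges)
    (ThreeGraph.noShatter (hVC H hH)) (fun x y z => by
      have : ({x, y, z} : Finset ℕ) = {x, z, y} := by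
        ext; simp only [mem_insert, mem_singleton]; tauto
      rw [this]) (fun x y z => by
      have : ({x, y, z} : Finset ℕ) = {y, z, x} := by
        ext; simp only [mem_insert, mem_singleton]; tauto
      rw [this])
  refine ⟨T, ℓ, (Nat.zero_le _).trans_lt (c 0).2, le_max_left _ _, Nat.le_add_left _ _, le_rfl,
    decompOf H.verts c a, isReg_decompOf hε0.le e2 (by linarith) hbad, ?_⟩
  refine regWrt_decompOf (η := η) (τ := τ) (ν := ν) (m := 8 * ((2 * k + 8) / 2 ^ j)) H.obar g
    hε0.le hη0.le hτ0 hν0 ?_ ?_ e2 e3 hbad ?_ ?_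
  · rw [hν]; linarith
  · rw [hη]; apply le_of_eq; field_simp
  · refine le_of_eq_of_le (sum_congr rfl fun x hx => sum_congr rfl fun y hy =>
      sum_congr rfl fun z hz => ?_) hg
    have : (x, y, z) ∈ H.obar ↔ ({x, y, z} : Finset ℕ) ∈ H.edges := by
      simp [ThreeGraph.obar, hx, hy, hz]
    rw [this]
  · have s1 : (Fintype.card (Fin ℓ) : ℝ) * τ = ε₁ / 12 := by
      rw [Fintype.card_fin, hτ]; field_simp
    have s2 : 8 * ((2 * k + 8) / 2 ^ j) / ν ≤ ε₁ / 2 := by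
      rw [div_le_iff₀ hν0, hν]; nlinarith
    rw [s1]; linarith

lemma upper_bound_aux (k : ℕ) : ∃ e : ℝ, 0 < e ∧ e ≤ 1 ∧ ∀ ε₁ : ℝ, 0 < ε₁ → ε₁ < e → ∃ j : ℕ,
    (2 * k + 8 : ℝ) / 2 ^ j ≤ ε₁ ^ 2 / 64 ∧
    (((4 ^ j + 1) ^ k + 1 : ℕ) : ℝ) ≤ ε₁ ^ (-(4 * k + 1 : ℝ)) := by
  set A : ℝ := 64 * (2 * k + 8) with hA
  have hA1 : 1 ≤ A := by rw [hA]; have : (0 : ℝ) ≤ k := by positivity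
                         linarith
  have hA0 : 0 < A := by linarith
  refine ⟨min 1 (1 / (2 * (8 * A ^ 2) ^ k)), by positivity, min_le_left _ _, fun ε h0 h1 => ?_⟩
  have hε1 : ε < 1 := h1.trans_le (min_le_left _ _)
  have hε2 : ε < 1 / (2 * (8 * A ^ 2) ^ k) := h1.trans_le (min_le_right _ _)
  have hε3 : ε ^ 2 ≤ 1 := pow_le_one₀ h0.le hε1.le
  have hx : 1 ≤ A / ε ^ 2 := by rw [le_div_iff₀ (by positivity)]; linarith
  obtain ⟨n, hn1, hn2⟩ := exists_nat_pow_near hx (one_lt_two)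
  refine ⟨n + 1, ?_, ?_⟩
  · rw [div_le_iff₀ (by positivity)]
    have : A < 2 ^ (n + 1) * ε ^ 2 := by rwa [div_lt_iff₀ (by positivity)] at hn2
    rw [hA] at this; linarith
  · have h2 : (2 : ℝ) ^ (n + 1) ≤ 2 * A / ε ^ 2 := by
      rw [pow_succ]; calc _ ≤ A / ε ^ 2 * 2 := by gcongr
        _ = _ := by ring
    have h4 : (4 : ℝ) ^ (n + 1) ≤ 4 * A ^ 2 / ε ^ 4 := by
      calc (4 : ℝ) ^ (n + 1) = (2 ^ (n + 1)) ^ 2 := by rw [← pow_mul, mul_comm, pow_mul]; norm_num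
        _ ≤ (2 * A / ε ^ 2) ^ 2 := by gcongr
        _ = _ := by ring
    have h5 : (1 : ℝ) ≤ 4 * A ^ 2 / ε ^ 4 := by
      rw [le_div_iff₀ (by positivity)]
      have : ε ^ 4 ≤ 1 := pow_le_one₀ h0.le hε1.le
      nlinarith
    have h6 : ((4 : ℝ) ^ (n + 1) + 1) ^ k ≤ (8 * A ^ 2 / ε ^ 4) ^ k := by
      gcongr
      calc (4 : ℝ) ^ (n + 1) + 1 ≤ 4 * A ^ 2 / ε ^ 4 + 4 * A ^ 2 / ε ^ 4 := add_le_add h4 h5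
        _ = _ := by ring
    have h7 : (1 : ℝ) ≤ (8 * A ^ 2 / ε ^ 4) ^ k := by
      apply one_le_pow₀
      calc (1 : ℝ) ≤ 4 * A ^ 2 / ε ^ 4 := h5
        _ ≤ 8 * A ^ 2 / ε ^ 4 := by gcongr; norm_num
    have h8 : ε ^ (-(4 * k + 1 : ℝ)) = 1 / (ε ^ 4) ^ k * (1 / ε) := by
      rw [Real.rpow_neg h0.le, show (4 * k + 1 : ℝ) = ((4 * k + 1 : ℕ) : ℝ) by push_cast; ring,
        Real.rpow_natCast, pow_succ, pow_mul]
      field_simp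
    have h9 : 2 * (8 * A ^ 2) ^ k ≤ 1 / ε := by
      rw [le_div_iff₀ h0]
      rw [lt_div_iff₀ (by positivity)] at hε2
      linarith
    push_cast
    rw [h8]
    calc ((4 : ℝ) ^ (n + 1) + 1) ^ k + 1 ≤ 2 * (8 * A ^ 2 / ε ^ 4) ^ k := by linarith
      _ = 1 / (ε ^ 4) ^ k * (2 * (8 * A ^ 2) ^ k) := by rw [div_pow]; ring
      _ ≤ _ := by gcongr

lemma pow_four_sum_sum_le {α : Type} (X Y : Finset α) (g : α → α → ℝ) :
    (∑ x ∈ X, ∑ y ∈ Y, g x y) ^ 4 ≤ (#X : ℝ) ^ 2 * (#Y : ℝ) ^ 2 *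
      ∑ x₀ ∈ X, ∑ x₁ ∈ X, ∑ y₀ ∈ Y, ∑ y₁ ∈ Y, g x₀ y₀ * g x₀ y₁ * g x₁ y₀ * g x₁ y₁ := by
  have h1 : (∑ x ∈ X, ∑ y ∈ Y, g x y) ^ 2 ≤ #X * ∑ x ∈ X, (∑ y ∈ Y, g x y) ^ 2 :=
    sq_sum_le_card_mul_sum_sq
  have h2 : ∑ x ∈ X, (∑ y ∈ Y, g x y) ^ 2 = ∑ y₀ ∈ Y, ∑ y₁ ∈ Y, ∑ x ∈ X, g x y₀ * g x y₁ := by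
    simp only [sq, sum_mul_sum]
    rw [sum_comm]
    exact sum_congr rfl fun y _ => sum_comm
  have h3 : (∑ y₀ ∈ Y, ∑ y₁ ∈ Y, ∑ x ∈ X, g x y₀ * g x y₁) ^ 2 ≤
      #Y ^ 2 * ∑ y₀ ∈ Y, ∑ y₁ ∈ Y, (∑ x ∈ X, g x y₀ * g x y₁) ^ 2 := by
    rw [← sum_product' (f := fun y₀ y₁ => ∑ x ∈ X, g x y₀ * g x y₁),
      ← sum_product' (f := fun y₀ y₁ => (∑ x ∈ X, g x y₀ * g x y₁) ^ 2)]
    refine sq_sum_le_card_mul_sum_sq.trans_eq ?_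
    rw [card_product]; push_cast; ring
  have h4 : ∑ y₀ ∈ Y, ∑ y₁ ∈ Y, (∑ x ∈ X, g x y₀ * g x y₁) ^ 2 =
      ∑ x₀ ∈ X, ∑ x₁ ∈ X, ∑ y₀ ∈ Y, ∑ y₁ ∈ Y, g x₀ y₀ * g x₀ y₁ * g x₁ y₀ * g x₁ y₁ := by
    simp only [sq, sum_mul_sum]
    calc _ = ∑ y₀ ∈ Y, ∑ x₀ ∈ X, ∑ y₁ ∈ Y, ∑ x₁ ∈ X, g x₀ y₀ * g x₀ y₁ * (g x₁ y₀ * g x₁ y₁) :=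
          sum_congr rfl fun _ _ => sum_comm
      _ = ∑ x₀ ∈ X, ∑ y₀ ∈ Y, ∑ y₁ ∈ Y, ∑ x₁ ∈ X, g x₀ y₀ * g x₀ y₁ * (g x₁ y₀ * g x₁ y₁) :=
          sum_comm
      _ = ∑ x₀ ∈ X, ∑ y₀ ∈ Y, ∑ x₁ ∈ X, ∑ y₁ ∈ Y, g x₀ y₀ * g x₀ y₁ * (g x₁ y₀ * g x₁ y₁) :=
          sum_congr rfl fun _ _ => sum_congr rfl fun _ _ => sum_comm
      _ = ∑ x₀ ∈ X, ∑ x₁ ∈ X, ∑ y₀ ∈ Y, ∑ y₁ ∈ Y, g x₀ y₀ * g x₀ y₁ * (g x₁ y₀ * g x₁ y₁) :=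
          sum_congr rfl fun _ _ => sum_comm
      _ = _ := by simp only [mul_assoc]
  rw [h2] at h1
  have h0 : 0 ≤ (#X : ℝ) * ∑ y₀ ∈ Y, ∑ y₁ ∈ Y, ∑ x ∈ X, g x y₀ * g x y₁ :=
    (sq_nonneg _).trans h1
  calc (∑ x ∈ X, ∑ y ∈ Y, g x y) ^ 4 = ((∑ x ∈ X, ∑ y ∈ Y, g x y) ^ 2) ^ 2 := by ring
    _ ≤ (#X * ∑ y₀ ∈ Y, ∑ y₁ ∈ Y, ∑ x ∈ X, g x y₀ * g x y₁) ^ 2 := by gcongr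
    _ = #X ^ 2 * (∑ y₀ ∈ Y, ∑ y₁ ∈ Y, ∑ x ∈ X, g x y₀ * g x y₁) ^ 2 := by ring
    _ ≤ #X ^ 2 * (#Y ^ 2 * ∑ y₀ ∈ Y, ∑ y₁ ∈ Y, (∑ x ∈ X, g x y₀ * g x y₁) ^ 2) := by gcongr
    _ = _ := by rw [h4]; ring

lemma pow_eight_sum_le {α : Type} (X Y Z : Finset α) (h : α → α → α → ℝ) (a : α → α → ℝ)
    (b : α → ℝ) (ha : ∀ x y, |a x y| ≤ 1) (hb : ∀ z, |b z| ≤ 1) :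
    (∑ x ∈ X, ∑ y ∈ Y, ∑ z ∈ Z, h x y z * (a x y * b z)) ^ 8 ≤
      ((#X : ℝ) * #Y * #Z) ^ 6 * ∑ z₀ ∈ Z, ∑ z₁ ∈ Z, ∑ x₀ ∈ X, ∑ x₁ ∈ X, ∑ y₀ ∈ Y, ∑ y₁ ∈ Y,
        (h x₀ y₀ z₀ * h x₀ y₀ z₁) * (h x₀ y₁ z₀ * h x₀ y₁ z₁) *
          (h x₁ y₀ z₀ * h x₁ y₀ z₁) * (h x₁ y₁ z₀ * h x₁ y₁ z₁) := by
  have h1 : (∑ x ∈ X, ∑ y ∈ Y, ∑ z ∈ Z, h x y z * (a x y * b z)) ^ 2 ≤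
      (#X * #Y) * ∑ x ∈ X, ∑ y ∈ Y, (∑ z ∈ Z, h x y z * b z) ^ 2 := by
    rw [← sum_product', ← sum_product' (f := fun x y => (∑ z ∈ Z, h x y z * b z) ^ 2)]
    refine sq_sum_le_card_mul_sum_sq.trans ?_
    rw [card_product, Nat.cast_mul]
    refine mul_le_mul_of_nonneg_left (sum_le_sum fun p _ => ?_) (by positivity)
    have : ∑ z ∈ Z, h p.1 p.2 z * (a p.1 p.2 * b z) = a p.1 p.2 * ∑ z ∈ Z, h p.1 p.2 z * b z := by
      rw [mul_sum]; exact sum_congr rfl fun _ _ => by ring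
    rw [this, mul_pow]
    have := (sq_le_one_iff_abs_le_one _).2 (ha p.1 p.2)
    exact mul_le_of_le_one_left (sq_nonneg _) this
  set D : α → α → ℝ := fun z₀ z₁ => ∑ x ∈ X, ∑ y ∈ Y, h x y z₀ * h x y z₁ with hD
  have h2 : ∑ x ∈ X, ∑ y ∈ Y, (∑ z ∈ Z, h x y z * b z) ^ 2 ≤ ∑ z₀ ∈ Z, ∑ z₁ ∈ Z, |D z₀ z₁| := by
    have e : ∑ x ∈ X, ∑ y ∈ Y, (∑ z ∈ Z, h x y z * b z) ^ 2 =
        ∑ z₀ ∈ Z, ∑ z₁ ∈ Z, D z₀ z₁ * (b z₀ * b z₁) := by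
      simp only [sq, sum_mul_sum]
      calc _ = ∑ x ∈ X, ∑ z₀ ∈ Z, ∑ y ∈ Y, ∑ z₁ ∈ Z, h x y z₀ * b z₀ * (h x y z₁ * b z₁) :=
            sum_congr rfl fun _ _ => sum_comm
        _ = ∑ z₀ ∈ Z, ∑ x ∈ X, ∑ y ∈ Y, ∑ z₁ ∈ Z, h x y z₀ * b z₀ * (h x y z₁ * b z₁) := sum_comm
        _ = ∑ z₀ ∈ Z, ∑ x ∈ X, ∑ z₁ ∈ Z, ∑ y ∈ Y, h x y z₀ * b z₀ * (h x y z₁ * b z₁) :=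
            sum_congr rfl fun _ _ => sum_congr rfl fun _ _ => sum_comm
        _ = ∑ z₀ ∈ Z, ∑ z₁ ∈ Z, ∑ x ∈ X, ∑ y ∈ Y, h x y z₀ * b z₀ * (h x y z₁ * b z₁) :=
            sum_congr rfl fun _ _ => sum_comm
        _ = _ := sum_congr rfl fun _ _ => sum_congr rfl fun _ _ => by
            simp only [hD, sum_mul]
            exact sum_congr rfl fun _ _ => sum_congr rfl fun _ _ => by ring
    rw [e]
    refine sum_le_sum fun z₀ _ => sum_le_sum fun z₁ _ => (le_abs_self _).trans ?_
    rw [abs_mul, abs_mul]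
    exact mul_le_of_le_one_right (abs_nonneg _) (mul_le_one₀ (hb _) (abs_nonneg _) (hb _))
  have h3 : (∑ z₀ ∈ Z, ∑ z₁ ∈ Z, |D z₀ z₁|) ^ 4 ≤ #Z ^ 6 * ∑ z₀ ∈ Z, ∑ z₁ ∈ Z, D z₀ z₁ ^ 4 := by
    rw [← sum_product' (f := fun z₀ z₁ => |D z₀ z₁|),
      ← sum_product' (f := fun z₀ z₁ => D z₀ z₁ ^ 4)]
    refine (pow_sum_le_card_mul_sum_pow (fun _ _ => abs_nonneg _) 3).trans_eq ?_
    rw [card_product, sum_congr rfl fun p _ => (by decide : Even 4).pow_abs _]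
    push_cast; ring
  calc _ = ((∑ x ∈ X, ∑ y ∈ Y, ∑ z ∈ Z, h x y z * (a x y * b z)) ^ 2) ^ 4 := by ring
    _ ≤ ((#X * #Y) * ∑ z₀ ∈ Z, ∑ z₁ ∈ Z, |D z₀ z₁|) ^ 4 := by
        refine pow_le_pow_left₀ (sq_nonneg _) (h1.trans ?_) 4
        gcongr
    _ = (#X * #Y) ^ 4 * (∑ z₀ ∈ Z, ∑ z₁ ∈ Z, |D z₀ z₁|) ^ 4 := by ring
    _ ≤ (#X * #Y) ^ 4 * (#Z ^ 6 * ∑ z₀ ∈ Z, ∑ z₁ ∈ Z, (#X ^ 2 * #Y ^ 2 *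
        ∑ x₀ ∈ X, ∑ x₁ ∈ X, ∑ y₀ ∈ Y, ∑ y₁ ∈ Y,
        (h x₀ y₀ z₀ * h x₀ y₀ z₁) * (h x₀ y₁ z₀ * h x₀ y₁ z₁) *
          (h x₁ y₀ z₀ * h x₁ y₀ z₁) * (h x₁ y₁ z₀ * h x₁ y₁ z₁))) := by
        refine mul_le_mul_of_nonneg_left (h3.trans ?_) (by positivity)
        refine mul_le_mul_of_nonneg_left ?_ (by positivity)
        exact sum_le_sum fun z₀ _ => sum_le_sum fun z₁ _ =>
          pow_four_sum_sum_le X Y fun x y => h x y z₀ * h x y z₁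
    _ = _ := by simp only [← mul_sum]; ring

lemma sum_comm₅ {α : Type} (X Y Z : Finset α) (F : α → α → α → α → α → ℝ) :
    ∑ z ∈ Z, ∑ x₀ ∈ X, ∑ x₁ ∈ X, ∑ y₀ ∈ Y, ∑ y₁ ∈ Y, F z x₀ x₁ y₀ y₁ =
      ∑ x₀ ∈ X, ∑ x₁ ∈ X, ∑ y₀ ∈ Y, ∑ y₁ ∈ Y, ∑ z ∈ Z, F z x₀ x₁ y₀ y₁ := by
  rw [sum_comm]
  refine sum_congr rfl fun _ _ => ?_
  rw [sum_comm]
  refine sum_congr rfl fun _ _ => ?_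
  rw [sum_comm]
  exact sum_congr rfl fun _ _ => sum_comm

lemma abs_sum_hFun_mul_le {R : Finset (ℕ × ℕ × ℕ)} {G : Triad} {ε₁ ε₂ η : ℝ}
    (h : dev23 R G ε₁ ε₂) (hε₁ : 0 ≤ ε₁) (hε₂ : ε₂ ≤ 1) (hη : 0 ≤ η) (hεη : 2 ^ 12 * ε₁ ≤ η ^ 8)
    (a : ℕ → ℕ → ℝ) (b : ℕ → ℝ) (ha : ∀ x y, |a x y| ≤ 1) (hb : ∀ z, |b z| ≤ 1) :
    |∑ x ∈ G.X, ∑ y ∈ G.Y, ∑ z ∈ G.Z, hFun R G x y z * (a x y * b z)| ≤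
      η * (#G.X * #G.Y * #G.Z) := by
  obtain ⟨d₁, d₂, d₃, h₁, h₂, h₃, hd₁, hd₃, hd₂, hS⟩ := h
  have hle : ∀ (B : Bigraph) (d : ℝ), B.dev2 ε₂ d → d ≤ 2 := fun B d hB => by
    have := (abs_le.1 hB.1).1
    linarith [B.density_mem.2]
  have e₁ := pow_le_pow_left₀ h₁.le (hle _ _ hd₁) 4
  have e₂ := pow_le_pow_left₀ h₂.le (hle _ _ hd₂) 4
  have e₃ := pow_le_pow_left₀ h₃.le (hle _ _ hd₃) 4
  have p := pow_eight_sum_le G.X G.Y G.Z (hFun R G) a b ha hb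
  rw [sum_congr rfl fun z₀ _ => sum_comm₅ G.X G.Y G.Z _, sum_comm₅ G.X G.Y G.Z] at p
  have e : ∑ x₀ ∈ G.X, ∑ x₁ ∈ G.X, ∑ y₀ ∈ G.Y, ∑ y₁ ∈ G.Y, ∑ z₀ ∈ G.Z, ∑ z₁ ∈ G.Z,
      (hFun R G x₀ y₀ z₀ * hFun R G x₀ y₀ z₁) * (hFun R G x₀ y₁ z₀ * hFun R G x₀ y₁ z₁) *
        (hFun R G x₁ y₀ z₀ * hFun R G x₁ y₀ z₁) * (hFun R G x₁ y₁ z₀ * hFun R G x₁ y₁ z₁) =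
      devSum3 R G := by
    simp only [devSum3, mul_assoc]
  rw [e] at p
  set S := ∑ x ∈ G.X, ∑ y ∈ G.Y, ∑ z ∈ G.Z, hFun R G x y z * (a x y * b z)
  have hX : (0 : ℝ) ≤ #G.X := Nat.cast_nonneg _
  have hY : (0 : ℝ) ≤ #G.Y := Nat.cast_nonneg _
  have hZ : (0 : ℝ) ≤ #G.Z := Nat.cast_nonneg _
  clear_value S
  generalize (#G.X : ℝ) = x at *
  generalize (#G.Y : ℝ) = y at *
  generalize (#G.Z : ℝ) = z at *
  have hd : d₁ ^ 4 * d₂ ^ 4 * d₃ ^ 4 ≤ 2 ^ 4 * 2 ^ 4 * 2 ^ 4 := by gcongr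
  refine (pow_le_pow_iff_left₀ (abs_nonneg _) (by positivity) (by norm_num : (8 : ℕ) ≠ 0)).1 ?_
  rw [(by decide : Even 8).pow_abs]
  calc S ^ 8 ≤ (x * y * z) ^ 6 * (ε₁ * d₁ ^ 4 * d₂ ^ 4 * d₃ ^ 4 * x ^ 2 * y ^ 2 * z ^ 2) :=
        p.trans (mul_le_mul_of_nonneg_left hS (by positivity))
    _ = ε₁ * (d₁ ^ 4 * d₂ ^ 4 * d₃ ^ 4) * (x * y * z) ^ 8 := by ring
    _ ≤ ε₁ * (2 ^ 4 * 2 ^ 4 * 2 ^ 4) * (x * y * z) ^ 8 := by gcongr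
    _ = (2 ^ 12 * ε₁) * (x * y * z) ^ 8 := by ring
    _ ≤ η ^ 8 * (x * y * z) ^ 8 := by gcongr
    _ = _ := by ring

/-- In a regular triad, a rectangle on which the triples are constant with the minority value is
small. -/
lemma card_minority_le {R : Finset (ℕ × ℕ × ℕ)} {G : Triad} {ε₁ ε₂ η : ℝ}
    (h : dev23 R G ε₁ ε₂) (hε₁ : 0 ≤ ε₁) (hε₂ : ε₂ ≤ 1) (hη : 0 ≤ η) (hεη : 2 ^ 12 * ε₁ ≤ η ^ 8)
    (S : ℕ → ℕ → Prop) (C : Finset ℕ) (val : Prop)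
    (hS : ∀ x y z, S x y → z ∈ C → ((x, y, z) ∈ R ↔ val))
    (hval : ¬ (1 / 2 ≤ relDensity R G ↔ val)) :
    (#(G.K3.filter fun p => S p.1 p.2.1 ∧ p.2.2 ∈ C) : ℝ) ≤ 2 * η * (#G.X * #G.Y * #G.Z) := by
  have key := abs_sum_hFun_mul_le h hε₁ hε₂ hη hεη (fun x y => ic (S x y)) (fun z => ic (z ∈ C))
    (fun x y => by rw [abs_of_nonneg (ic_nonneg _)]; exact ic_le_one _)
    (fun z => by rw [abs_of_nonneg (ic_nonneg _)]; exact ic_le_one _)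
  set d := relDensity R G with hd
  have e : ∀ v : ℝ, (∀ x y z, (x, y, z) ∈ G.K3 → S x y → z ∈ C → hFun R G x y z = v) →
      ∑ x ∈ G.X, ∑ y ∈ G.Y, ∑ z ∈ G.Z, hFun R G x y z * (ic (S x y) * ic (z ∈ C)) =
        v * #(G.K3.filter fun p => S p.1 p.2.1 ∧ p.2.2 ∈ C) := by
    intro v hv
    rw [← sum_product₃ G.X G.Y G.Z fun p => hFun R G p.1 p.2.1 p.2.2 *
      (ic (S p.1 p.2.1) * ic (p.2.2 ∈ C)), mul_comm, ← nsmul_eq_mul, ← sum_const]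
    refine (sum_subset_zero_on_sdiff ((filter_subset _ _).trans (filter_subset _ _)) ?_ ?_).symm
    · intro p hp
      rw [mem_sdiff, mem_filter] at hp
      by_cases hK : (p.1, p.2.1, p.2.2) ∈ G.K3
      · by_cases h1 : S p.1 p.2.1
        · by_cases h2 : p.2.2 ∈ C
          · exact absurd ⟨hK, h1, h2⟩ hp.2
          · rw [ic_not_of h2]; ring
        · rw [ic_not_of h1]; ring
      · rw [hFun, if_neg hK, zero_mul]
    · intro p hp
      rw [mem_filter] at hp
      rw [ic_of hp.2.1, ic_of hp.2.2, hv _ _ _ hp.1 hp.2.1 hp.2.2]; ring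
  have hn : (0 : ℝ) ≤ #(G.K3.filter fun p => S p.1 p.2.1 ∧ p.2.2 ∈ C) := Nat.cast_nonneg _
  by_cases hv : val
  · have hd2 : d < 1 / 2 := by
      by_contra hc
      exact hval (iff_of_true (not_lt.1 hc) hv)
    rw [e (1 - d) fun x y z hK h1 h2 => by
      rw [hFun, if_pos hK, if_pos ((hS x y z h1 h2).2 hv)]] at key
    have := (abs_le.1 key).2
    nlinarith
  · have hd2 : 1 / 2 ≤ d := by
      by_contra hc
      exact hval (iff_of_false hc hv)
    rw [e (-d) fun x y z hK h1 h2 => by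
      rw [hFun, if_pos hK, if_neg (mt (hS x y z h1 h2).1 hv)]] at key
    have := (abs_le.1 key).1
    nlinarith

/-- The index of the triad containing a triple. -/
def triadIdx {ι κ : Type} (c : ℕ → ι) (a : ℕ → ℕ → κ) (x y z : ℕ) : ι × ι × ι × κ × κ × κ :=
  (c x, c y, c z, a x y, a x z, a y z)

/-- Whether most triples of a triad are in `R`. -/
def majority {V : Finset ℕ} {ι κ : Type} (R : Finset (ℕ × ℕ × ℕ)) (P : Decomp V ι κ)
    (τ : ι × ι × ι × κ × κ × κ) : Prop :=
  1 / 2 ≤ relDensity R (P.triadOf τ.1 τ.2.1 τ.2.2.1 τ.2.2.2.1 τ.2.2.2.2.1 τ.2.2.2.2.2)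

lemma card_minority_triples_le {V : Finset ℕ} {ι κ : Type} [Fintype ι] [Fintype κ] {c : ℕ → ι}
    {a : ℕ → ℕ → κ} {R : Finset (ℕ × ℕ × ℕ)} {ε₁ ε₂ η : ℝ} {m : ℕ}
    (h : (decompOf V c a).regWrt R ε₁ ε₂) (hε₁ : 0 ≤ ε₁) (hε₂ : ε₂ ≤ 1) (hη : 0 ≤ η)
    (hεη : 2 ^ 12 * ε₁ ≤ η ^ 8) (S : Fin m → ℕ → ℕ → Prop) (C : Finset ℕ) (M : Fin m → Prop)
    (hS : ∀ w x y z, S w x y → z ∈ C → ((x, y, z) ∈ R ↔ M w)) :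
    (#((V ×ˢ V ×ˢ V).filter fun p => (p.2.2 ∈ C ∧ ∃ w, S w p.1 p.2.1) ∧
      ¬ ((p.1, p.2.1, p.2.2) ∈ R ↔
        majority R (decompOf V c a) (triadIdx c a p.1 p.2.1 p.2.2))) : ℝ) ≤
      (ε₁ + 2 * η * (m * Fintype.card κ ^ 3)) * #V ^ 3 := by
  set P := decompOf V c a with hP
  set tri : ι × ι × ι × κ × κ × κ → Triad := fun τ =>
    P.triadOf τ.1 τ.2.1 τ.2.2.1 τ.2.2.2.1 τ.2.2.2.2.1 τ.2.2.2.2.2 with htri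
  set Good := (V ×ˢ V ×ˢ V).filter fun p =>
      ∃ i j k α β γ, p ∈ (P.triadOf i j k α β γ).K3 ∧ dev23 R (P.triadOf i j k α β γ) ε₁ ε₂ with hG
  have hbad : (#((V ×ˢ V ×ˢ V) \ Good) : ℝ) ≤ ε₁ * #V ^ 3 := by
    have h1 : (1 - ε₁) * (#V : ℝ) ^ 3 ≤ #Good := by
      unfold Decomp.regWrt at h
      convert h
    have h2 : (#((V ×ˢ V ×ˢ V) \ Good) : ℝ) + #Good = #(V ×ˢ V ×ˢ V) := by
      exact_mod_cast card_sdiff_add_card_eq_card (filter_subset _ _)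
    rw [card_product, card_product] at h2
    push_cast at h2
    nlinarith
  set J : Finset ((ι × ι × ι × κ × κ × κ) × Fin m) := univ.filter fun q =>
    dev23 R (tri q.1) ε₁ ε₂ ∧ ¬ (majority R P q.1 ↔ M q.2) with hJ
  set box : (ι × ι × ι × κ × κ × κ) × Fin m → Finset (ℕ × ℕ × ℕ) := fun q =>
    (tri q.1).K3.filter fun p => S q.2 p.1 p.2.1 ∧ p.2.2 ∈ C with hbox
  have hsub : ((V ×ˢ V ×ˢ V).filter fun p => (p.2.2 ∈ C ∧ ∃ w, S w p.1 p.2.1) ∧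
      ¬ ((p.1, p.2.1, p.2.2) ∈ R ↔ majority R P (triadIdx c a p.1 p.2.1 p.2.2))) ⊆
      ((V ×ˢ V ×ˢ V) \ Good) ∪ J.biUnion box := by
    rintro ⟨x, y, z⟩ hp
    rw [mem_filter] at hp
    obtain ⟨hpV, ⟨hzC, w, hw⟩, hwrong⟩ := hp
    by_cases hg : (x, y, z) ∈ Good
    · refine mem_union_right _ (mem_biUnion.2 ⟨(triadIdx c a x y z, w), ?_, ?_⟩)
      all_goals
        obtain ⟨-, i, j, k, α, β, γ, hK, hd⟩ := mem_filter.1 hg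
        have hK' := hK
        rw [K3_decompOf, mem_filter] at hK'
        have hτ : triadIdx c a x y z = (i, j, k, α, β, γ) := hK'.2
      · rw [hJ, mem_filter]
        refine ⟨mem_univ _, ?_, ?_⟩
        · rw [hτ]; exact hd
        · intro hc
          exact hwrong ((hS w x y z hw hzC).trans hc.symm)
      · rw [hbox]
        refine mem_filter.2 ⟨?_, hw, hzC⟩
        change (x, y, z) ∈ (tri (triadIdx c a x y z)).K3
        rw [hτ]; exact hK
    · exact mem_union_left _ (mem_sdiff.2 ⟨hpV, hg⟩)
  have hb : ∀ q ∈ J, (#(box q) : ℝ) ≤ 2 * η * (#(tri q.1).X * #(tri q.1).Y * #(tri q.1).Z) := by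
    intro q hq
    rw [hJ, mem_filter] at hq
    exact card_minority_le hq.2.1 hε₁ hε₂ hη hεη (S q.2) C (M q.2)
      (fun x y z hs hz => hS q.2 x y z hs hz) hq.2.2
  have hcell : ∑ i : ι, (#(cellOf V c i) : ℝ) = #V := by
    have := sum_cells V c fun _ => (1 : ℝ)
    simpa using this.symm
  have htot : ∑ q : (ι × ι × ι × κ × κ × κ) × Fin m,
      2 * η * ((#(tri q.1).X : ℝ) * #(tri q.1).Y * #(tri q.1).Z) =
      2 * η * (m * Fintype.card κ ^ 3) * #V ^ 3 := by
    have hX : ∀ τ, (tri τ).X = cellOf V c τ.1 := fun _ => rfl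
    have hY : ∀ τ, (tri τ).Y = cellOf V c τ.2.1 := fun _ => rfl
    have hZ : ∀ τ, (tri τ).Z = cellOf V c τ.2.2.1 := fun _ => rfl
    simp only [hX, hY, hZ, Fintype.sum_prod_type, sum_const, card_univ, Fintype.card_fin,
      nsmul_eq_mul, ← mul_sum, hcell]
    simp only [← sum_mul, hcell, mul_assoc, ← mul_sum, Fintype.card_prod]
    push_cast
    ring
  calc _ ≤ (#(((V ×ˢ V ×ˢ V) \ Good) ∪ J.biUnion box) : ℝ) := by exact_mod_cast card_le_card hsub
    _ ≤ #((V ×ˢ V ×ˢ V) \ Good) + #(J.biUnion box) := by exact_mod_cast card_union_le _ _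
    _ ≤ ε₁ * #V ^ 3 + ∑ q ∈ J, (#(box q) : ℝ) :=
        add_le_add hbad (by exact_mod_cast card_biUnion_le)
    _ ≤ ε₁ * #V ^ 3 + ∑ q ∈ J, 2 * η * ((#(tri q.1).X : ℝ) * #(tri q.1).Y * #(tri q.1).Z) :=
        add_le_add le_rfl (sum_le_sum hb)
    _ ≤ ε₁ * #V ^ 3 + ∑ q : (ι × ι × ι × κ × κ × κ) × Fin m,
          2 * η * ((#(tri q.1).X : ℝ) * #(tri q.1).Y * #(tri q.1).Z) := by
        refine add_le_add le_rfl (sum_le_sum_of_subset_of_nonneg (subset_univ _) fun _ _ _ => ?_)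
        positivity
    _ = _ := by rw [htot]; ring

/-- Every decomposition comes from colourings of the vertices and the pairs. -/
lemma exists_eq_decompOf {V : Finset ℕ} {ι κ : Type} [Nonempty ι] [Nonempty κ]
    (P : Decomp V ι κ) : ∃ (c : ℕ → ι) (a : ℕ → ℕ → κ), P = decompOf V c a := by
  have h1 : ∀ x, ∃ i, x ∈ V → x ∈ P.part i := fun x => by
    by_cases hx : x ∈ V
    · obtain ⟨i, hi⟩ := P.part_cover x hx
      exact ⟨i, fun _ => hi⟩
    · exact ⟨Classical.arbitrary _, fun h => absurd h hx⟩
  choose c hc using h1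
  have hpart : ∀ i x, x ∈ P.part i ↔ x ∈ V ∧ c x = i := fun i x => by
    refine ⟨fun h => ⟨P.part_sub i h, ?_⟩, fun h => h.2 ▸ hc x h.1⟩
    by_contra hne
    exact disjoint_left.1 (P.part_disj _ _ hne) (hc x (P.part_sub i h)) h
  have h2 : ∀ x y, ∃ l, x ∈ V → y ∈ V → (x, y) ∈ P.pairs (c x) (c y) l := fun x y => by
    by_cases h : x ∈ V ∧ y ∈ V
    · obtain ⟨l, hl⟩ := P.pairs_cover (c x) (c y) (x, y) (mem_product.2 ⟨hc x h.1, hc y h.2⟩)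
      exact ⟨l, fun _ _ => hl⟩
    · exact ⟨Classical.arbitrary _, fun hx hy => absurd ⟨hx, hy⟩ h⟩
  choose a ha using h2
  have hp : P.part = (decompOf V c a).part := by
    ext i x
    rw [hpart]
    exact mem_cellOf.symm
  have hpp : P.pairs = (decompOf V c a).pairs := by
    ext i j l ⟨x, y⟩
    rw [mem_pairs_decompOf, mem_cellOf, mem_cellOf]
    constructor
    · intro h
      have h' := mem_product.1 (P.pairs_sub i j l h)
      obtain ⟨hx, rfl⟩ := (hpart i x).1 h'.1
      obtain ⟨hy, rfl⟩ := (hpart j y).1 h'.2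
      refine ⟨⟨hx, rfl⟩, ⟨hy, rfl⟩, ?_⟩
      by_contra hne
      exact disjoint_left.1 (P.pairs_disj _ _ _ _ hne) (ha x y hx hy) h
    · rintro ⟨⟨hx, rfl⟩, ⟨hy, rfl⟩, rfl⟩
      exact ha x y hx hy
  refine ⟨c, a, ?_⟩
  cases P
  simp only [decompOf] at hp hpp ⊢
  subst hp hpp
  rfl

/-- An averaging argument: some `z ∈ C` lies in few of the triples of `W`. -/
lemma exists_mem_card_le {n : ℕ} {W : Finset (ℕ × ℕ × ℕ)} {x y : Fin n → ℕ}
    (hx : Function.Injective x) (hy : Function.Injective y) {C : Finset ℕ} (hC : #C = n)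
    (hn : 0 < n) {E : ℝ} (hW : (#W : ℝ) ≤ E) :
    ∃ z ∈ C, (n : ℝ) * #(univ.filter fun p : Fin n × Fin n => (x p.1, y p.2, z) ∈ W) ≤ E := by
  by_contra! hcon
  have hne : C.Nonempty := card_pos.1 (hC ▸ hn)
  set D : Finset ((Fin n × Fin n) × ℕ) :=
    (univ ×ˢ C).filter fun q => (x q.1.1, y q.1.2, q.2) ∈ W with hD
  have h1 : #D ≤ #W := by
    refine card_le_card_of_injOn (fun q => (x q.1.1, y q.1.2, q.2)) (fun q hq => ?_) ?_
    · exact (mem_filter.1 hq).2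
    · rintro ⟨⟨i, j⟩, z⟩ _ ⟨⟨i', j'⟩, z'⟩ _ h
      simp only [Prod.mk.injEq] at h
      rw [hx h.1, hy h.2.1, h.2.2]
  have h2 : (#D : ℝ) =
      ∑ z ∈ C, (#(univ.filter fun p : Fin n × Fin n => (x p.1, y p.2, z) ∈ W) : ℝ) := by
    rw [hD, card_filter, sum_product_right]
    push_cast
    exact sum_congr rfl fun z _ => by rw [card_filter]; push_cast; rfl
  have h3 : ∑ z ∈ C, E < ∑ z ∈ C, (n : ℝ) *
      #(univ.filter fun p : Fin n × Fin n => (x p.1, y p.2, z) ∈ W) :=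
        sum_lt_sum_of_nonempty hne hcon
  rw [← mul_sum, ← h2, sum_const, nsmul_eq_mul, hC] at h3
  have hn' : (0 : ℝ) < n := by exact_mod_cast hn
  have h4 := lt_of_mul_lt_mul_left h3 hn'.le
  have h5 : (#D : ℝ) ≤ #W := by exact_mod_cast h1
  linarith

/-- The pair colourings of a blowup are determined, up to few errors, by codes of the vertices and
an `L`-colouring of the pairs. -/
lemma exists_codes {H : ThreeGraph} {t ℓ T L n m q : ℕ} {ε₁ ε₂ η : ℝ} (hP : GoodDecomp H t ℓ ε₁ ε₂)
    (ht : 1 ≤ t) (htT : t ≤ T) (hℓ : 1 ≤ ℓ) (hℓL : ℓ ≤ L) (hε₁ : 0 ≤ ε₁) (hε₂ : ε₂ ≤ 1) (hη : 0 ≤ η)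
    (hεη : 2 ^ 12 * ε₁ ≤ η ^ 8) (hn : 0 < n) (hV : #H.verts = (2 + q) * n)
    {x y : Fin n → ℕ} (hx : Function.Injective x) (hy : Function.Injective y)
    (hxV : ∀ i, x i ∈ H.verts) (hyV : ∀ i, y i ∈ H.verts) (C : Fin q → Finset ℕ)
    (hC : ∀ v, #(C v) = n) (hCV : ∀ v, C v ⊆ H.verts) (M : Fin q → Fin m → Prop)
    (hM : ∀ w w', (∀ v, M v w ↔ M v w') → w = w') (u : Fin n → Fin n → Fin m)
    (hu : ∀ i j v, ∀ z ∈ C v, (({x i, y j, z} : Finset ℕ) ∈ H.edges ↔ M v (u i j))) :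
    ∃ (f g : Fin n → Fin T × (Fin q → Fin L)) (b : Fin n → Fin n → Fin L)
      (Ψ : Fin T × (Fin q → Fin L) → Fin T × (Fin q → Fin L) → Fin L → Fin m),
      (#(univ.filter fun p : Fin n × Fin n => u p.1 p.2 ≠ Ψ (f p.1) (g p.2) (b p.1 p.2)) : ℝ) ≤
        q * ((ε₁ + 2 * η * (m * L ^ 3)) * (2 + q) ^ 3) * n ^ 2 := by
  obtain ⟨P, -, hreg⟩ := hP
  have : NeZero t := ⟨by omega⟩
  have : NeZero ℓ := ⟨by omega⟩
  obtain ⟨c, a, rfl⟩ := exists_eq_decompOf P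
  set V := H.verts with hVdef
  set E : ℝ := (ε₁ + 2 * η * (m * L ^ 3)) * ((2 + q) * n) ^ 3 with hE
  set W : Fin q → Finset (ℕ × ℕ × ℕ) := fun v => (V ×ˢ V ×ˢ V).filter fun p =>
      (p.2.2 ∈ C v ∧ ∃ w, (∃ i j, x i = p.1 ∧ y j = p.2.1 ∧ u i j = w)) ∧
      ¬ ((p.1, p.2.1, p.2.2) ∈ H.obar ↔
        majority H.obar (decompOf V c a) (triadIdx c a p.1 p.2.1 p.2.2)) with hWdef
  have hobar : ∀ i j v, ∀ z ∈ C v, ((x i, y j, z) ∈ H.obar ↔ M v (u i j)) := fun i j v z hz => by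
    rw [← hu i j v z hz, ThreeGraph.obar, mem_filter]
    exact ⟨fun h => h.2, fun h => ⟨mem_product.2 ⟨hxV i, mem_product.2 ⟨hyV j, hCV v hz⟩⟩, h⟩⟩
  have hW : ∀ v, (#(W v) : ℝ) ≤ E := fun v => by
    have h0 := card_minority_triples_le hreg hε₁ hε₂ hη hεη
      (fun w x' y' => ∃ i j, x i = x' ∧ y j = y' ∧ u i j = w) (C v) (M v) (by
        rintro w _ _ z ⟨i, j, rfl, rfl, rfl⟩ hz
        exact hobar i j v z hz)
    refine le_trans (le_of_eq ?_) (h0.trans ?_)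
    · simp only [hWdef]
      congr!
    · rw [hV, Fintype.card_fin, hE]
      push_cast
      have : (ℓ : ℝ) ≤ L := by exact_mod_cast hℓL
      gcongr
  choose z hz hcard using fun v => exists_mem_card_le hx hy (hC v) hn (hW v)
  set f : Fin n → Fin T × (Fin q → Fin L) := fun i =>
    (Fin.castLE htT (c (x i)), fun v => Fin.castLE hℓL (a (x i) (z v))) with hf
  set g : Fin n → Fin T × (Fin q → Fin L) := fun j =>
    (Fin.castLE htT (c (y j)), fun v => Fin.castLE hℓL (a (y j) (z v))) with hg
  set b : Fin n → Fin n → Fin L := fun i j => Fin.castLE hℓL (a (x i) (y j)) with hb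
  have hgood : ∀ i j, (∀ v, (x i, y j, z v) ∉ W v) → ∀ v, (M v (u i j) ↔
      majority H.obar (decompOf V c a) (triadIdx c a (x i) (y j) (z v))) := fun i j h v => by
    rw [← hobar i j v (z v) (hz v)]
    by_contra hne
    refine h v (mem_filter.2 ⟨mem_product.2 ⟨hxV i, mem_product.2 ⟨hyV j, hCV v (hz v)⟩⟩,
      ⟨hz v, _, i, j, rfl, rfl, rfl⟩, hne⟩)
  have hwell : ∀ i j i' j', (∀ v, (x i, y j, z v) ∉ W v) → (∀ v, (x i', y j', z v) ∉ W v) →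
      f i = f i' → g j = g j' → b i j = b i' j' → u i j = u i' j' := by
    intro i j i' j' h h' hff hgg hbb
    refine hM _ _ fun v => ?_
    rw [hgood i j h v, hgood i' j' h' v]
    have e : triadIdx c a (x i) (y j) (z v) = triadIdx c a (x i') (y j') (z v) := by
      have i1 := Fin.castLE_injective htT (congrArg Prod.fst hff)
      have i2 := Fin.castLE_injective htT (congrArg Prod.fst hgg)
      have i3 := Fin.castLE_injective hℓL (congrFun (congrArg Prod.snd hff) v)
      have i4 := Fin.castLE_injective hℓL (congrFun (congrArg Prod.snd hgg) v)
      have i5 := Fin.castLE_injective hℓL hbb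
      simp only [triadIdx, i1, i2, i3, i4, i5]
    rw [e]
  refine ⟨f, g, b, fun p p' l => if h : ∃ ij : Fin n × Fin n, (∀ v, (x ij.1, y ij.2, z v) ∉ W v) ∧
    f ij.1 = p ∧ g ij.2 = p' ∧ b ij.1 ij.2 = l then u h.choose.1 h.choose.2 else
      u ⟨0, hn⟩ ⟨0, hn⟩, ?_⟩
  have hsub : (univ.filter fun p : Fin n × Fin n => u p.1 p.2 ≠
      (fun p p' l => if h : ∃ ij : Fin n × Fin n, (∀ v, (x ij.1, y ij.2, z v) ∉ W v) ∧
        f ij.1 = p ∧ g ij.2 = p' ∧ b ij.1 ij.2 = l then u h.choose.1 h.choose.2 else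
          u ⟨0, hn⟩ ⟨0, hn⟩) (f p.1) (g p.2) (b p.1 p.2)) ⊆
      univ.biUnion fun v => univ.filter fun p : Fin n × Fin n => (x p.1, y p.2, z v) ∈ W v := by
    rintro ⟨i, j⟩ hp
    rw [mem_filter] at hp
    by_contra hcon
    have hno : ∀ v, (x i, y j, z v) ∉ W v := fun v hv =>
      hcon (mem_biUnion.2 ⟨v, mem_univ _, mem_filter.2 ⟨mem_univ _, hv⟩⟩)
    refine hp.2 ?_
    have hex : ∃ ij : Fin n × Fin n, (∀ v, (x ij.1, y ij.2, z v) ∉ W v) ∧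
        f ij.1 = f i ∧ g ij.2 = g j ∧ b ij.1 ij.2 = b i j := ⟨(i, j), hno, rfl, rfl, rfl⟩
    change u i j = dite _ _ _
    rw [dif_pos hex]
    obtain ⟨s1, s2, s3, s4⟩ := hex.choose_spec
    exact hwell _ _ _ _ hno s1 s2.symm s3.symm s4.symm
  have hn' : (0 : ℝ) < n := by exact_mod_cast hn
  have hcard' : ∀ v, (#(univ.filter fun p : Fin n × Fin n => (x p.1, y p.2, z v) ∈ W v) : ℝ) ≤
      (ε₁ + 2 * η * (m * L ^ 3)) * (2 + q) ^ 3 * n ^ 2 := fun v => by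
    refine le_of_mul_le_mul_left ((hcard v).trans_eq ?_) hn'
    rw [hE]; ring
  have h1 := card_le_card hsub
  have h2 := h1.trans card_biUnion_le
  calc _ ≤ ((∑ v, #(univ.filter fun p : Fin n × Fin n => (x p.1, y p.2, z v) ∈ W v) : ℕ) : ℝ) := by
        exact_mod_cast h2
    _ ≤ ∑ v : Fin q, (ε₁ + 2 * η * (m * L ^ 3)) * (2 + q) ^ 3 * n ^ 2 := by
        push_cast
        exact sum_le_sum fun v _ => hcard' v
    _ = _ := by
        rw [sum_const, card_univ, Fintype.card_fin, nsmul_eq_mul]; ring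

lemma pair_add_inj {n : ℕ} {i i' j j' : Fin n}
    (h : ({(i : ℕ), n + j} : Finset ℕ) = {(i' : ℕ), n + j'}) : i = i' ∧ j = j' := by
  have h1 : (i : ℕ) ∈ ({(i' : ℕ), n + j'} : Finset ℕ) := h ▸ by simp
  have h2 : n + (j : ℕ) ∈ ({(i' : ℕ), n + j'} : Finset ℕ) := h ▸ by simp
  simp only [mem_insert, mem_singleton] at h1 h2
  have := i.2; have := i'.2
  exact ⟨Fin.ext (by omega), Fin.ext (by omega)⟩

/-- The bipartite coloured graph of a colouring of `Fin n × Fin n`. -/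
noncomputable def colouredOf (U : Finset ℕ) {n m : ℕ} (e : Fin m → ℕ) (he : ∀ w, e w ∈ U)
    (u : Fin n → Fin n → Fin m) : BipColored U where
  A := range n
  B := Ico n (n + n)
  disjAB := by
    rw [disjoint_left]
    intro x hx hx'
    rw [mem_range] at hx
    rw [mem_Ico] at hx'
    omega
  P w := (univ.filter fun p : Fin n × Fin n => e (u p.1 p.2) = w).image
    fun p => {(p.1 : ℕ), n + (p.2 : ℕ)}
  P_disj := by
    intro w _ w' _ hne
    rw [disjoint_left]
    intro s hs hs'
    simp only [mem_image, mem_filter, mem_univ, true_and, Prod.exists] at hs hs'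
    obtain ⟨i, j, h, rfl⟩ := hs
    obtain ⟨i', j', h', hs⟩ := hs'
    obtain ⟨rfl, rfl⟩ := pair_add_inj hs
    exact hne (h.symm.trans h')
  P_cover := by
    ext s
    simp only [mem_biUnion, mem_image, mem_filter, mem_univ, true_and, Prod.exists, pairsAB,
      mem_product, mem_range, mem_Ico]
    constructor
    · rintro ⟨w, -, i, j, -, rfl⟩
      exact ⟨i, n + j, ⟨i.2, by omega, by omega⟩, rfl⟩
    · rintro ⟨i, j, ⟨hi, hj, hj'⟩, rfl⟩
      have hjn : j - n < n := by omega
      refine ⟨_, he (u ⟨i, hi⟩ ⟨j - n, hjn⟩), ⟨i, hi⟩, ⟨j - n, hjn⟩, rfl, ?_⟩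
      have : n + (j - n) = j := by omega
      simp only [this]

lemma exists_blowup {ℋ : Set ThreeGraph} (hℋ : Hereditary ℋ) {G : Bigraph} (hG : InBH ℋ G)
    {m q : ℕ} {e : Fin m → ℕ} (heL : ∀ w, e w ∈ G.left) {r : Fin q → ℕ}
    (hr : Function.Injective r) (hrR : ∀ v, r v ∈ G.right) {n : ℕ} (u : Fin n → Fin n → Fin m) :
    ∃ H ∈ ℋ, #H.verts = (2 + q) * n ∧ ∃ (x y : Fin n → ℕ) (C : Fin q → Finset ℕ),
      Function.Injective x ∧ Function.Injective y ∧ (∀ i, x i ∈ H.verts) ∧ (∀ i, y i ∈ H.verts) ∧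
      (∀ v, #(C v) = n) ∧ (∀ v, C v ⊆ H.verts) ∧
      ∀ i j v, ∀ z ∈ C v, (({x i, y j, z} : Finset ℕ) ∈ H.edges ↔ (e (u i j), r v) ∈ G.edges) := by
  obtain ⟨H, hH, hdim⟩ := hG.2 n
  obtain ⟨H', ⟨D, hD1, hD2, hD3, hD4, hD5⟩, W, hiso⟩ := hdim (colouredOf G.left e heL u)
    (card_range n) (by simp [colouredOf])
  have hH' : H' ∈ ℋ := hℋ.1 _ _ hiso (hℋ.2 H hH W)
  set W' : Finset ℕ := range n ∪ Ico n (n + n) ∪ univ.biUnion fun v => D (r v) with hW'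
  have hsub : W' ⊆ H'.verts := by
    rw [hD4]
    refine union_subset_union (subset_refl _) fun z hz => ?_
    obtain ⟨v, -, hv⟩ := mem_biUnion.1 hz
    exact mem_biUnion.2 ⟨r v, hrR v, hv⟩
  have hverts : (H'.induce W').verts = W' := inter_eq_right.2 hsub
  have hxW : ∀ i : Fin n, (i : ℕ) ∈ W' := fun i =>
    mem_union_left _ (mem_union_left _ (mem_range.2 i.2))
  have hyW : ∀ i : Fin n, n + (i : ℕ) ∈ W' := fun i =>
    mem_union_left _ (mem_union_right _ (mem_Ico.2 ⟨by omega, by omega⟩))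
  have hCW : ∀ v, D (r v) ⊆ W' := fun v z hz =>
    mem_union_right _ (mem_biUnion.2 ⟨v, mem_univ _, hz⟩)
  refine ⟨H'.induce W', hℋ.2 H' hH' W', ?_, fun i => i, fun j => n + j, fun v => D (r v),
    Fin.val_injective, fun j j' h => Fin.ext (by simpa using h), fun i => hverts.ge (hxW i),
    fun i => hverts.ge (hyW i), fun v => hD1 _ (hrR v), fun v => (hCW v).trans hverts.ge, ?_⟩
  · have hAB : Disjoint (range n) (Ico n (n + n)) := (colouredOf G.left e heL u).disjAB
    have hABC : Disjoint (range n ∪ Ico n (n + n)) (univ.biUnion fun v => D (r v)) :=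
      (disjoint_biUnion_right _ _ _).2 fun v _ => (hD3 _ (hrR v)).symm
    have hCC : ((univ : Finset (Fin q)) : Set (Fin q)).PairwiseDisjoint fun v => D (r v) :=
      fun v _ v' _ hne => hD2 _ (hrR v) _ (hrR v') (hr.ne hne)
    rw [hverts, hW', card_union_of_disjoint hABC, card_union_of_disjoint hAB, card_biUnion hCC,
      sum_congr rfl fun v _ => hD1 _ (hrR v), card_range, Nat.card_Ico, sum_const, card_univ,
      Fintype.card_fin, smul_eq_mul]
    have : n + n - n = n := by omega
    rw [this]; ring
  · intro i j v z hz
    have hP : ({(i : ℕ), n + (j : ℕ)} : Finset ℕ) ∈ (colouredOf G.left e heL u).P (e (u i j)) :=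
      mem_image.2 ⟨(i, j), mem_filter.2 ⟨mem_univ _, rfl⟩, rfl⟩
    have h5 := hD5 _ (heL (u i j)) _ (hrR v) _ hP z hz
    have hset : ({(i : ℕ), n + (j : ℕ), z} : Finset ℕ) = insert z {(i : ℕ), n + (j : ℕ)} := by
      ext w; simp only [mem_insert, mem_singleton]; tauto
    have hW'' : ({(i : ℕ), n + (j : ℕ), z} : Finset ℕ) ⊆ W' := by
      intro w hw
      simp only [mem_insert, mem_singleton] at hw
      rcases hw with rfl | rfl | rfl
      exacts [hxW i, hyW j, hCW v hz]
    change _ ∈ H'.edges.filter (fun s => s ⊆ W') ↔ _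
    rw [mem_filter, and_iff_left hW'', hset]
    exact ⟨fun h => by_contra fun hn => h5.2 hn h, h5.1⟩

/-- Finitely many vertices of an irreducible bigraph are distinguished by few vertices of the other
side. -/
lemma exists_distinguishing {G : Bigraph} (hG : G.Irreducible) {m : ℕ} (hm : m ≤ #G.left) :
    ∃ (e : Fin m → ℕ) (q : ℕ) (r : Fin q → ℕ), (∀ w, e w ∈ G.left) ∧ q ≤ m ^ 2 ∧
      Function.Injective r ∧ (∀ v, r v ∈ G.right) ∧
      ∀ w w', (∀ v, (e w, r v) ∈ G.edges ↔ (e w', r v) ∈ G.edges) → w = w' := by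
  obtain ⟨U, hU, hUm⟩ := exists_subset_card_eq hm
  set e : Fin m → ℕ := fun w => (U.equivFinOfCardEq hUm).symm w with he
  have heL : ∀ w, e w ∈ G.left := fun w => hU (Subtype.coe_prop _)
  have hinj : Function.Injective e := fun w w' h =>
    (U.equivFinOfCardEq hUm).symm.injective (Subtype.ext h)
  have h1 : ∀ p : Fin m × Fin m, ∃ v : ℕ, p.1 ≠ p.2 →
      ¬ ((e p.1, v) ∈ G.edges ↔ (e p.2, v) ∈ G.edges) := fun p => by
    by_cases hp : p.1 = p.2
    · exact ⟨0, fun h => absurd hp h⟩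
    · by_contra! hcon
      exact hp (hinj (hG.1 _ (heL _) _ (heL _) fun v => (hcon v).2))
  choose d hd using h1
  set S : Finset ℕ := (univ.image d).filter (· ∈ G.right) with hS
  have hSm : #S ≤ m ^ 2 := by
    refine (card_filter_le _ _).trans (card_image_le.trans_eq ?_)
    rw [card_univ, Fintype.card_prod, Fintype.card_fin, sq]
  refine ⟨e, #S, fun v => S.equivFin.symm v, heL, hSm, fun v v' h =>
    S.equivFin.symm.injective (Subtype.ext h), fun v =>
    (mem_filter.1 (Subtype.coe_prop (S.equivFin.symm v))).2, fun w w' h => ?_⟩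
  by_contra hne
  have h2 := hd (w, w') hne
  by_cases hR : d (w, w') ∈ G.right
  · have hmem : d (w, w') ∈ S := mem_filter.2 ⟨mem_image_of_mem _ (mem_univ _), hR⟩
    have := h (S.equivFin ⟨_, hmem⟩)
    simp only [Equiv.symm_apply_apply] at this
    exact h2 this
  · have hno : ∀ x, (x, d (w, w')) ∉ G.edges := fun x hx =>
      hR (mem_product.1 (G.edges_sub hx)).2
    exact h2 (iff_of_false (hno _) (hno _))

/-- A bound for the size of a Hamming ball. -/
lemma card_hamming_ball_mul_le {I : Type} [Fintype I] {m s : ℕ} (hm : 0 < m) (w : I → Fin m) :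
    #(univ.filter fun u : I → Fin m => #(univ.filter fun i => u i ≠ w i) ≤ s) *
      m ^ (Fintype.card I - s) ≤ (2 * m) ^ Fintype.card I := by
  have h1 : ∑ u : I → Fin m, ∏ i, (if u i = w i then m else 1) ≤ (2 * m) ^ Fintype.card I := by
    have h := prod_univ_sum (fun _ : I => (univ : Finset (Fin m)))
      fun i x => if x = w i then m else 1
    rw [Fintype.piFinset_univ] at h
    rw [← h]
    refine (prod_le_pow_card _ _ (2 * m) fun i _ => ?_).trans_eq (by rw [card_univ])
    have : ∀ x : Fin m, (if x = w i then m else 1) ≤ (if x = w i then m else 0) + 1 := fun x => by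
      split_ifs <;> omega
    refine (sum_le_sum fun x _ => this x).trans_eq ?_
    rw [sum_add_distrib, sum_ite_eq' univ (w i) fun _ => m]
    simp
    omega
  refine le_trans ?_ h1
  rw [← smul_eq_mul, ← sum_const]
  refine (sum_le_sum fun u hu => ?_).trans (sum_le_sum_of_subset (filter_subset _ _))
  rw [prod_ite, prod_const, prod_const_one, mul_one]
  refine Nat.pow_le_pow_right hm ?_
  have h2 := card_filter_add_card_filter_not (s := (univ : Finset I)) fun i => u i = w i
  have h3 := (mem_filter.1 hu).2
  rw [card_univ] at h2
  have h4 : #(univ.filter fun i => u i ≠ w i) = #(univ.filter fun i => ¬ u i = w i) := rfl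
  omega

/-- Some colouring of a square grid is far from all colourings determined by few codes. -/
lemma exists_far_colouring (K : Type) [Fintype K] {L r : ℕ} (hL : 1 ≤ L)
    (hr : 4 * Fintype.card K + Fintype.card K ^ 2 * L + 1 ≤ r) :
    ∃ u : Fin (2 * r) → Fin (2 * r) → Fin (4 * L ^ 2), ∀ (f g : Fin (2 * r) → K)
      (b : Fin (2 * r) → Fin (2 * r) → Fin L) (Ψ : K → K → Fin L → Fin (4 * L ^ 2)),
      r ^ 2 < #(univ.filter fun p : Fin (2 * r) × Fin (2 * r) =>
        u p.1 p.2 ≠ Ψ (f p.1) (g p.2) (b p.1 p.2)) := by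
  by_contra! hcon
  set m := 4 * L ^ 2 with hm
  set D := Fintype.card K with hD
  have hm4 : 4 ≤ m := by nlinarith
  let Code := (Fin (2 * r) → K) × (Fin (2 * r) → K) × (Fin (2 * r) → Fin (2 * r) → Fin L) ×
    (K → K → Fin L → Fin m)
  let val : Code → Fin (2 * r) × Fin (2 * r) → Fin m := fun s p =>
    s.2.2.2 (s.1 p.1) (s.2.1 p.2) (s.2.2.1 p.1 p.2)
  have hcode : Fintype.card Code = D ^ (4 * r) * L ^ (4 * r ^ 2) * m ^ (D ^ 2 * L) := by
    simp only [Code, Fintype.card_prod, Fintype.card_fun, Fintype.card_fin, ← hD]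
    ring
  have hcover : (univ : Finset (Fin (2 * r) × Fin (2 * r) → Fin m)) ⊆
      (univ : Finset Code).biUnion fun s =>
        univ.filter fun u => #(univ.filter fun p => u p ≠ val s p) ≤ r ^ 2 := by
    intro u _
    obtain ⟨f, g, b, Ψ, h⟩ := hcon fun i j => u (i, j)
    exact mem_biUnion.2 ⟨(f, g, b, Ψ), mem_univ _, mem_filter.2 ⟨mem_univ _, h⟩⟩
  have h1 := (card_le_card hcover).trans card_biUnion_le
  have hI : Fintype.card (Fin (2 * r) × Fin (2 * r)) = 4 * r ^ 2 := by
    rw [Fintype.card_prod, Fintype.card_fin]; ring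
  have h2 : ∀ s : Code, #(univ.filter fun u : Fin (2 * r) × Fin (2 * r) → Fin m =>
      #(univ.filter fun p => u p ≠ val s p) ≤ r ^ 2) * m ^ (3 * r ^ 2) ≤ (2 * m) ^ (4 * r ^ 2) := by
    intro s
    have h := card_hamming_ball_mul_le (s := r ^ 2) (by omega : 0 < m) (val s)
    rw [hI, show 4 * r ^ 2 - r ^ 2 = 3 * r ^ 2 by omega] at h
    convert h
  have h3 : m ^ (4 * r ^ 2) * m ^ (3 * r ^ 2) ≤
      D ^ (4 * r) * L ^ (4 * r ^ 2) * m ^ (D ^ 2 * L) * (2 * m) ^ (4 * r ^ 2) := by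
    rw [card_univ, Fintype.card_fun, hI, Fintype.card_fin] at h1
    refine (Nat.mul_le_mul_right _ h1).trans ?_
    rw [sum_mul]
    refine (sum_le_sum fun s _ => h2 s).trans_eq ?_
    rw [sum_const, card_univ, hcode, smul_eq_mul]
  have h4 : L ^ (4 * r ^ 2) * (2 * m) ^ (4 * r ^ 2) = m ^ (6 * r ^ 2) := by
    rw [← mul_pow, show 4 * r ^ 2 = 2 * (2 * r ^ 2) by ring, pow_mul,
      show (L * (2 * m)) ^ 2 = m ^ 3 by rw [hm]; ring, ← pow_mul]
    congr 1; ring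
  have hpos : 0 < m ^ (6 * r ^ 2) := Nat.pow_pos (by omega)
  have h5 : m ^ (r ^ 2) ≤ D ^ (4 * r) * m ^ (D ^ 2 * L) := by
    refine Nat.le_of_mul_le_mul_right ?_ hpos
    calc m ^ (r ^ 2) * m ^ (6 * r ^ 2) = m ^ (4 * r ^ 2) * m ^ (3 * r ^ 2) := by
          rw [← pow_add, ← pow_add]; congr 1; ring
      _ ≤ _ := h3
      _ = D ^ (4 * r) * m ^ (D ^ 2 * L) * (L ^ (4 * r ^ 2) * (2 * m) ^ (4 * r ^ 2)) := by ring
      _ = _ := by rw [h4]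
  have h6 : D ≤ m ^ D := Nat.lt_two_pow_self.le.trans (Nat.pow_le_pow_left (by omega) D)
  have h7 : m ^ (r ^ 2) ≤ m ^ (D * (4 * r) + D ^ 2 * L) := by
    refine h5.trans ?_
    rw [pow_add, pow_mul m D (4 * r)]
    exact Nat.mul_le_mul_right _ (Nat.pow_le_pow_left h6 _)
  have h8 := (Nat.pow_le_pow_iff_right (by omega : 1 < m)).1 h7
  have h9 := Nat.mul_le_mul_right r hr
  have h10 : D ^ 2 * L ≤ D ^ 2 * L * r := Nat.le_mul_of_pos_right _ (by omega)
  nlinarith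

lemma psi_mono {ε₁ : ℝ} {ε₂ : ℕ → ℝ} {T L L' : ℕ} {ℋ : Set ThreeGraph} (hL : L ≤ L')
    (h : psi ε₁ ε₂ T L ℋ) : psi ε₁ ε₂ T L' ℋ := by
  obtain ⟨n₀, hn⟩ := h
  refine ⟨n₀, fun H hH hV => ?_⟩
  obtain ⟨t, ℓ, h1, h2, h3, h4, h5⟩ := hn H hH hV
  exact ⟨t, ℓ, h1, h2, h3, h4.trans hL, h5⟩

lemma error_le {L q : ℕ} {ε₁ η : ℝ} (hL : 1 ≤ L) (hq : q ≤ (4 * L ^ 2) ^ 2) (hε₁ : ε₁ ≤ η)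
    (hη : η * (3359232 * L ^ 21) ≤ 1) (hη0 : 0 ≤ η) (hε0 : 0 ≤ ε₁) :
    4 * (q * ((ε₁ + 2 * η * ((4 * L ^ 2 : ℕ) * L ^ 3)) * (2 + q) ^ 3)) ≤ (1 : ℝ) := by
  have hL' : (1 : ℝ) ≤ L := by exact_mod_cast hL
  have hL4 : (1 : ℝ) ≤ (L : ℝ) ^ 4 := one_le_pow₀ hL'
  have hL5 : (1 : ℝ) ≤ (L : ℝ) ^ 5 := one_le_pow₀ hL'
  have hq1 : (q : ℝ) ≤ 16 * L ^ 4 := by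
    have : (q : ℝ) ≤ ((4 * L ^ 2) ^ 2 : ℕ) := by exact_mod_cast hq
    refine this.trans_eq ?_
    push_cast; ring
  have hq2 : (2 + q : ℝ) ≤ 18 * L ^ 4 := by linarith
  have h1 : ε₁ + 2 * η * ((4 * L ^ 2 : ℕ) * L ^ 3) ≤ 9 * (η * (L : ℝ) ^ 5) := by
    push_cast
    nlinarith
  have hq0 : (0 : ℝ) ≤ q := Nat.cast_nonneg _
  calc _ ≤ 4 * ((16 * L ^ 4) * ((9 * (η * (L : ℝ) ^ 5)) * (18 * L ^ 4) ^ 3)) := by gcongr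
    _ = η * (3359232 * L ^ 21) := by ring
    _ ≤ 1 := hη

lemma not_psi {ℋ : Set ThreeGraph} (hH : Hereditary ℋ)
    (hB : ∀ n : ℕ, ∃ G : Bigraph, InBH ℋ G ∧ n ≤ #G.left) {T L : ℕ} (hL : 1 ≤ L)
    {ε₁ η : ℝ} {ε₂ : ℕ → ℝ} (hε₁ : 0 ≤ ε₁) (hε₂ : ∀ x, ε₂ x ≤ 1) (hη0 : 0 ≤ η)
    (hη : η * (3359232 * L ^ 21) ≤ 1) (hεη : 2 ^ 12 * ε₁ ≤ η ^ 8) : ¬ psi ε₁ ε₂ T L ℋ := by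
  rintro ⟨n₀, hpsi⟩
  obtain ⟨G, hG, hm⟩ := hB (4 * L ^ 2)
  obtain ⟨e, q, r, heL, hq, hr, hrR, hdist⟩ := exists_distinguishing hG.1 hm
  set D := Fintype.card (Fin T × (Fin q → Fin L)) with hD
  set R := 4 * D + D ^ 2 * L + 1 + n₀ with hR
  obtain ⟨u, hfar⟩ := exists_far_colouring (Fin T × (Fin q → Fin L)) hL (r := R)
    (Nat.le_add_right _ _)
  obtain ⟨H, hHℋ, hV, x, y, C, hx, hy, hxV, hyV, hC, hCV, hu⟩ := exists_blowup hH hG heL hr hrR u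
  have hlarge : n₀ ≤ #H.verts := by rw [hV]; nlinarith
  obtain ⟨t, ℓ, ht, htT, hℓ, hℓL, hP⟩ := hpsi H hHℋ hlarge
  obtain ⟨f, g, b, Ψ, hcount⟩ := exists_codes hP ht htT hℓ hℓL hε₁ (hε₂ ℓ) hη0 hεη
    (by omega) hV hx hy hxV hyV C hC hCV (fun v w => (e w, r v) ∈ G.edges) hdist u hu
  have h1 : (R : ℝ) ^ 2 < #(univ.filter fun p : Fin (2 * R) × Fin (2 * R) =>
      u p.1 p.2 ≠ Ψ (f p.1) (g p.2) (b p.1 p.2)) := by exact_mod_cast hfar f g b Ψ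
  have hL' : (1 : ℝ) ≤ L := by exact_mod_cast hL
  have hη1 : η ≤ 1 := by
    have h2 : (1 : ℝ) ≤ (L : ℝ) ^ 21 := one_le_pow₀ hL'
    nlinarith
  have hεη' : ε₁ ≤ η := by
    have h2 : η ^ 8 ≤ η ^ 1 := pow_le_pow_of_le_one hη0 hη1 (by norm_num)
    linarith
  have h3 := error_le hL hq hεη' hη hη0 hε₁
  have h4 : (0 : ℝ) ≤ (R : ℝ) ^ 2 := sq_nonneg _
  have h5 := mul_le_mul_of_nonneg_right h3 h4
  push_cast at hcount h5
  have h6 := h1.trans_le hcount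
  nlinarith

lemma lower_bound_aux : ∃ e : ℝ, 0 < e ∧ ∀ ε₁ : ℝ, 0 < ε₁ → ε₁ < e → ∀ L : ℝ, 1 ≤ L →
    L ≤ ε₁ ^ (-(1 / 336) : ℝ) → 2 ^ 12 * ε₁ ≤ (1 / (3359232 * L ^ 21)) ^ 8 := by
  refine ⟨(1 / (2 ^ 12 * 3359232 ^ 8)) ^ 2, by norm_num, fun ε h0 h1 L hL hLε => ?_⟩
  have h2 : L ^ 168 ≤ (√ε)⁻¹ := by
    refine (pow_le_pow_left₀ (by linarith) hLε 168).trans_eq ?_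
    rw [← Real.rpow_natCast, ← Real.rpow_mul h0.le, Real.sqrt_eq_rpow, ← Real.rpow_neg h0.le]
    norm_num
  have hs : 0 < √ε := Real.sqrt_pos.2 h0
  have h3 : √ε ≤ 1 / (2 ^ 12 * 3359232 ^ 8) := (Real.sqrt_lt' (by norm_num)).2 h1 |>.le
  have hL0 : 0 < L ^ 168 := pow_pos (by linarith) _
  have h4 : L ^ 168 * √ε ≤ 1 := by
    calc _ ≤ (√ε)⁻¹ * √ε := by gcongr
      _ = 1 := inv_mul_cancel₀ hs.ne'
  rw [div_pow, one_pow, mul_pow, ← pow_mul, le_div_iff₀ (mul_pos (by norm_num) hL0)]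
  have h5 : √ε * √ε = ε := Real.mul_self_sqrt h0.le
  have h6 : √ε * (2 ^ 12 * 3359232 ^ 8) ≤ 1 := by
    rwa [le_div_iff₀ (by norm_num)] at h3
  calc 2 ^ 12 * ε * (3359232 ^ 8 * L ^ (21 * 8))
      = 2 ^ 12 * (√ε * √ε) * (3359232 ^ 8 * L ^ (21 * 8)) := by rw [h5]
    _ = (√ε * (2 ^ 12 * 3359232 ^ 8)) * (L ^ 168 * √ε) := by ring
    _ ≤ 1 * 1 := mul_le_mul h6 h4 (mul_nonneg hL0.le hs.le) zero_le_one
    _ = 1 := one_mul 1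

/-- Corollary 6.3: the polynomial range for `L_ℋ`. -/
theorem stmt_18 (ℋ : Set ThreeGraph) (hH : Hereditary ℋ)
    (hVC : ∃ k : ℕ, ∀ H ∈ ℋ, ∀ k' : ℕ, H.VC2AtLeast k' → k' ≤ k)
    (hB : ∀ n : ℕ, ∃ G : Bigraph, InBH ℋ G ∧ n ≤ G.left.card) :
    ∃ K K' : ℝ, 0 < K ∧ 0 < K' ∧ SmallEps fun ε₁ ε₂ =>
      ε₁ ^ (-K) ≤ (Lfun ℋ ε₁ ε₂ : ℝ) ∧ (Lfun ℋ ε₁ ε₂ : ℝ) ≤ ε₁ ^ (-K') := by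
  obtain ⟨k, hk⟩ := hVC
  obtain ⟨e, he0, he1, he⟩ := upper_bound_aux k
  obtain ⟨e', he0', he'⟩ := lower_bound_aux
  refine ⟨1 / 336, 4 * k + 1, by norm_num, by positivity, min e e', lt_min he0 he0',
    fun ε₁ h0 h1 => ⟨fun _ => 1, fun _ => ⟨one_pos, le_rfl⟩, fun ε₂ hε₂ _ => ?_⟩⟩
  obtain ⟨j, hj, hjL⟩ := he ε₁ h0 (h1.trans_le (min_le_left _ _))
  have hmem := exists_psi hk j (ε₂ := ε₂) h0 (fun x => (hε₂ x).1) hj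
  refine ⟨?_, le_trans (Nat.cast_le.2 (Nat.sInf_le hmem)) hjL⟩
  by_contra! hcon
  obtain ⟨T, -, hT⟩ : ∃ T, 1 ≤ T ∧ psi ε₁ ε₂ T (Lfun ℋ ε₁ ε₂) ℋ :=
    Nat.sInf_mem (s := {L : ℕ | ∃ T : ℕ, 1 ≤ T ∧ psi ε₁ ε₂ T L ℋ}) ⟨_, hmem⟩
  set L := max (Lfun ℋ ε₁ ε₂) 1 with hLdef
  have hL : 1 ≤ L := le_max_right _ _
  have hL1 : (1 : ℝ) ≤ L := by exact_mod_cast hL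
  have hone : (1 : ℝ) ≤ ε₁ ^ (-(1 / 336) : ℝ) :=
    Real.one_le_rpow_of_pos_of_le_one_of_nonpos h0
      ((h1.trans_le (min_le_left _ _)).le.trans he1) (by norm_num)
  have hLε : (L : ℝ) ≤ ε₁ ^ (-(1 / 336) : ℝ) := by
    rw [hLdef]
    push_cast
    exact max_le hcon.le hone
  have hpos : (0 : ℝ) < 3359232 * (L : ℝ) ^ 21 := by positivity
  exact not_psi hH hB hL h0.le (fun x => (hε₂ x).2) (one_div_nonneg.2 hpos.le)
    (one_div_mul_cancel hpos.ne').le (he' ε₁ h0 (h1.trans_le (min_le_right _ _)) L hL1 hLε)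
    (psi_mono (le_max_left _ _) hT)
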